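/- Let d ≥ 2, γ > 0 and p > p_c. There exists β > 0 such that for every c > 0, Q-almost surely on the event {|C| = +∞}, for all sufficiently large n and all k ≥ 1: Fol_{C_n^g}^{C^g}(k) ≥ k if k < c n^γ, and Fol_{C_n^g}^{C^g}(k) ≥ (βk)^d if k ≥ c n^γ. -/

import Mathlib

open MeasureTheory
open scoped ENNReal

namespace Perco

/-- Vertices of the lattice `Z^d`. -/
abbrev Zd (d : ℕ) := Fin d → ℤ

/-- A percolation configuration: each (unordered) edge of the lattice is open or closed.
(Only the values on nearest-neighbour pairs matter.) -/
abbrev Config (d : ℕ) := Sym2 (Zd d) → Bool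

/-- Lattice adjacency: `(x,y) ∈ E^d`. -/
def latAdj {d : ℕ} (x y : Zd d) : Prop := (∑ i, |x i - y i|) = 1

/-- Open adjacency in the configuration `ω`. -/
def openAdj {d : ℕ} (ω : Config d) (x y : Zd d) : Prop :=
  latAdj x y ∧ ω s(x, y) = true

/-- `C`: the open cluster of the origin. -/
def cluster {d : ℕ} (ω : Config d) : Set (Zd d) :=
  {y | Relation.ReflTransGen (openAdj ω) 0 y}

/-- `Q` is the product measure making the edge states i.i.d. Bernoulli(p). -/
def IsBernoulli {d : ℕ} (p : ℝ) (Q : Measure (Config d)) : Prop :=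
  IsProbabilityMeasure Q ∧
    ∀ (s : Finset (Sym2 (Zd d))) (f : Sym2 (Zd d) → Bool),
      Q {ω : Config d | ∀ e ∈ s, ω e = f e} =
        ∏ e ∈ s, (if f e then ENNReal.ofReal p else ENNReal.ofReal (1 - p))

/-- The critical probability `p_c`. -/
noncomputable def pc (d : ℕ) : ℝ :=
  sSup {p : ℝ | 0 ≤ p ∧ p ≤ 1 ∧
    ∀ Q : Measure (Config d), IsBernoulli p Q → Q {ω | (cluster ω).Infinite} = 0}

/-- The box `B_n = [-n,n]^d`. -/
def box (d n : ℕ) : Set (Zd d) := {x | ∀ i, |x i| ≤ (n : ℤ)}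

/-- `C_n`: the connected component of `0` in `C ∩ B_n`. -/
def clusterN {d : ℕ} (ω : Config d) (n : ℕ) : Set (Zd d) :=
  {y | Relation.ReflTransGen
    (fun a b => openAdj ω a b ∧ a ∈ box d n ∧ b ∈ box d n) 0 y}

/-- `A` is connected in the open subgraph. -/
def ConnOpen {d : ℕ} (ω : Config d) (A : Set (Zd d)) : Prop :=
  ∀ x ∈ A, ∀ y ∈ A,
    Relation.ReflTransGen (fun a b => openAdj ω a b ∧ a ∈ A ∧ b ∈ A) x y

/-- `A` is connected in the lattice. -/
def ConnLat {d : ℕ} (A : Set (Zd d)) : Prop :=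
  ∀ x ∈ A, ∀ y ∈ A,
    Relation.ReflTransGen (fun a b => latAdj a b ∧ a ∈ A ∧ b ∈ A) x y

/-- The boundary `∂_{C^g} A` = open lattice edges from `A` to its complement. -/
def bdry {d : ℕ} (ω : Config d) (A : Set (Zd d)) : Set (Zd d × Zd d) :=
  {e | openAdj ω e.1 e.2 ∧ e.1 ∈ A ∧ e.2 ∉ A}

/-- The profile `f_c` (at scale `n`, exponent `γ`). -/
noncomputable def fcut (d : ℕ) (γ c : ℝ) (n : ℕ) (x : ℝ) : ℝ :=
  if x < c * (n : ℝ) ^ γ then 1 else x ^ (1 - 1 / (d : ℝ))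

/-- `ν(x)`: number of open neighbours of `x`. -/
noncomputable def nu {d : ℕ} (ω : Config d) (x : Zd d) : ℕ :=
  Set.ncard {y | openAdj ω x y}

-- Transition kernel of the simple random walk on the open subgraph.
open Classical in
noncomputable def step {d : ℕ} (ω : Config d) (x y : Zd d) : ℝ :=
  if openAdj ω x y then ((nu ω x : ℝ))⁻¹ else 0

/-- Weight of a path of length `n`. -/
noncomputable def pathW {d n : ℕ} (ω : Config d) (γ : Fin (n + 1) → Zd d) : ℝ :=
  ∏ i : Fin n, step ω (γ i.castSucc) (γ i.succ)

/-- `N_n`: number of distinct sites visited by the path. -/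
noncomputable def visits {d n : ℕ} (γ : Fin (n + 1) → Zd d) : ℕ :=
  (Set.range γ).ncard

/-- `P_0^ω(E)`, the probability of a path event for the walk started at 0. -/
noncomputable def PWalk {d : ℕ} (ω : Config d) (n : ℕ)
    (E : (Fin (n + 1) → Zd d) → Prop) : ℝ :=
  ∑' γ : Fin (n + 1) → Zd d,
    Set.indicator {γ | γ 0 = 0 ∧ E γ} (fun γ => pathW ω γ) γ

/-- `E_0^ω(α^{N_n})`. -/
noncomputable def LaplaceN {d : ℕ} (ω : Config d) (α : ℝ) (n : ℕ) : ℝ :=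
  ∑' γ : Fin (n + 1) → Zd d,
    Set.indicator {γ | γ 0 = 0} (fun γ => pathW ω γ * α ^ visits γ) γ

/-- `E_0^ω(α^{N_n} 1_{X_n = 0})`. -/
noncomputable def LaplaceNReturn {d : ℕ} (ω : Config d) (α : ℝ) (n : ℕ) : ℝ :=
  ∑' γ : Fin (n + 1) → Zd d,
    Set.indicator {γ | γ 0 = 0 ∧ γ (Fin.last n) = 0}
      (fun γ => pathW ω γ * α ^ visits γ) γ

/-- Vertices of the wreath product `C^g ≀ Z/2Z` (lamplighter states). -/
abbrev Lamp (d : ℕ) := Zd d × (Zd d →₀ ZMod 2)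

/-- Flip a lamp configuration at one point. -/
noncomputable def flipAt {σ : Type*} (f : σ →₀ ZMod 2) (x : σ) : σ →₀ ZMod 2 :=
  f + Finsupp.single x 1

/-- Transition kernel of the lamplighter walk `Z` with parameter `α`. -/
noncomputable def ptilde {d : ℕ} (ω : Config d) (α : ℝ) (u v : Lamp d) : ℝ :=
  Set.indicator
    {q : Lamp d × Lamp d | ∀ x, x ≠ q.1.1 → x ≠ q.2.1 → q.1.2 x = q.2.2 x}
    (fun q => (if q.2.2 q.1.1 = 0 then α else 1 - α) *
      (if q.2.2 q.2.1 = 0 then α else 1 - α) * step ω q.1.1 q.2.1) (u, v)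

/-- `P̃_o^ω(Z_n = o)`: return probability of the lamplighter walk. -/
noncomputable def ZReturn {d : ℕ} (ω : Config d) (α : ℝ) (n : ℕ) : ℝ :=
  ∑' γ : Fin (n + 1) → Lamp d,
    Set.indicator {γ | γ 0 = (0, 0) ∧ γ (Fin.last n) = (0, 0)}
      (fun γ => ∏ i : Fin n, ptilde ω α (γ i.castSucc) (γ i.succ)) γ

/-- Vertex set of the wreath product over a vertex set `V` of the base. -/
def wVert {d : ℕ} (V : Set (Zd d)) : Set (Lamp d) :=
  {u | u.1 ∈ V ∧ ↑u.2.support ⊆ V}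

/-- Adjacency in the wreath product `C^g ≀ Z/2Z`. -/
def wAdj {d : ℕ} (ω : Config d) (u v : Lamp d) : Prop :=
  (u.1 = v.1 ∧ (∀ x, x ≠ u.1 → u.2 x = v.2 x) ∧ u.2 u.1 ≠ v.2 u.1) ∨
    (u.2 = v.2 ∧ openAdj ω u.1 v.1)

/-- Boundary of `U` in the wreath product `C^g ≀ Z/2Z`. -/
def wBdry {d : ℕ} (ω : Config d) (U : Set (Lamp d)) : Set (Lamp d × Lamp d) :=
  {e | e.1 ∈ U ∧ e.2 ∈ wVert (cluster ω) \ U ∧ wAdj ω e.1 e.2}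

/-- Følner function `Fol_{C_n^g}^{C^g}` (with value `⊤` when no set qualifies). -/
noncomputable def FolC {d : ℕ} (ω : Config d) (n : ℕ) (k : ℝ) : ℝ≥0∞ :=
  sInf {m : ℝ≥0∞ | ∃ A : Set (Zd d), A ⊆ clusterN ω n ∧ A.Nonempty ∧
    ((bdry ω A).ncard : ℝ) / (A.ncard : ℝ) ≤ 1 / k ∧ m = (A.ncard : ℝ≥0∞)}

/-- Følner function `Fol_{C_n^g ≀ Z/2Z}^{C^g ≀ Z/2Z}`. -/
noncomputable def FolW {d : ℕ} (ω : Config d) (n : ℕ) (k : ℝ) : ℝ≥0∞ :=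
  sInf {m : ℝ≥0∞ | ∃ U : Set (Lamp d), U ⊆ wVert (clusterN ω n) ∧ U.Nonempty ∧
    ((wBdry ω U).ncard : ℝ) / (U.ncard : ℝ) ≤ 1 / k ∧ m = (U.ncard : ℝ≥0∞)}

/-- Degree of a configuration `f` in the graph `K_U`. -/
noncomputable def Kdeg {d : ℕ} (U : Set (Lamp d)) (f : Zd d →₀ ZMod 2) : ℕ :=
  Set.ncard {g : Zd d →₀ ZMod 2 | ∃ x : Zd d, (x, f) ∈ U ∧ (x, g) ∈ U ∧ g = flipAt f x}

/-- A point `u = (x,f)` of `U` is bad if `(x, f̄_x) ∉ U`. -/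
def badPt {d : ℕ} (U : Set (Lamp d)) (u : Lamp d) : Prop :=
  (u.1, flipAt u.2 u.1) ∉ U

/-- `D(0,x) ≤ r`: the chemical distance from the origin to `x` is at most `r`. -/
def chemLE {d : ℕ} (ω : Config d) (x : Zd d) (r : ℕ) : Prop :=
  ∃ m ≤ r, ∃ γ : ℕ → Zd d, γ 0 = 0 ∧ γ m = x ∧ ∀ i < m, openAdj ω (γ i) (γ (i + 1))

/-- `B_r(C)`: chemical ball of radius `r` around the origin. -/
def chemBall {d : ℕ} (ω : Config d) (r : ℕ) : Set (Zd d) := {x | chemLE ω x r}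

/-- Lattice connected component of `x` inside a vertex set `V`. -/
def latCompIn {d : ℕ} (V : Set (Zd d)) (x : Zd d) : Set (Zd d) :=
  {y | Relation.ReflTransGen (fun a b => latAdj a b ∧ a ∈ V ∧ b ∈ V) x y}

/-- Open connected component of `x` inside a vertex set `V`. -/
def openCompIn {d : ℕ} (ω : Config d) (V : Set (Zd d)) (x : Zd d) : Set (Zd d) :=
  {y | Relation.ReflTransGen (fun a b => openAdj ω a b ∧ a ∈ V ∧ b ∈ V) x y}

/-- `L_n`: a connected component of the open subgraph inside `B_n` of maximal cardinality. -/
def IsLargestComp {d : ℕ} (ω : Config d) (n : ℕ) (L : Set (Zd d)) : Prop :=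
  (∃ x ∈ box d n, L = openCompIn ω (box d n) x) ∧
    ∀ y ∈ box d n, (openCompIn ω (box d n) y).ncard ≤ L.ncard

/-- `\bar L`: the connected component of `L` in the full open subgraph. -/
def closureOf {d : ℕ} (ω : Config d) (L : Set (Zd d)) : Set (Zd d) :=
  {y | ∃ x ∈ L, Relation.ReflTransGen (openAdj ω) x y}

/-- The boundary `∂_{\bar L_n^g} A`. -/
def bdryBar {d : ℕ} (ω : Config d) (n : ℕ) (L A : Set (Zd d)) : Set (Zd d × Zd d) :=
  {e | openAdj ω e.1 e.2 ∧ e.1 ∈ A ∩ closureOf ω L ∧ e.2 ∈ box d (n + 1) \ A}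

/-- `n(A)`: number of connected components of `B_n − L` containing a component of `A`. -/
noncomputable def nComp {d : ℕ} (n : ℕ) (L A : Set (Zd d)) : ℕ :=
  Set.ncard {P : Set (Zd d) |
    (∃ x ∈ box d n \ L, P = latCompIn (box d n \ L) x) ∧
    ∃ x ∈ A, latCompIn A x ⊆ P}

/-- The killed kernel `P^{B_r(C)}` acting on functions. -/
noncomputable def Pball {d : ℕ} (ω : Config d) (r : ℕ) (f : Zd d → ℝ) : Zd d → ℝ :=
  Set.indicator (chemBall ω r) (fun x =>
    ∑' y : Zd d, Set.indicator (chemBall ω r) (fun y => step ω x y * f y) y)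

/-- The Dirichlet form `ξ(f,f) = ((Id − P^{B_r(C)}) 1_{B_r(C)} f | f)_ν`. -/
noncomputable def dirichletForm {d : ℕ} (ω : Config d) (r : ℕ) (f : Zd d → ℝ) : ℝ :=
  ∑' x : Zd d, (nu ω x : ℝ) * f x *
    (Set.indicator (chemBall ω r) f x - Pball ω r (Set.indicator (chemBall ω r) f) x)

/-- `‖f‖²_{l²(ν)}`. -/
noncomputable def normSq {d : ℕ} (ω : Config d) (f : Zd d → ℝ) : ℝ :=
  ∑' x : Zd d, (nu ω x : ℝ) * f x ^ 2

/-- `λ_1(B_r(C))`: smallest Dirichlet eigenvalue of the killed walk. -/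
noncomputable def lambda1 {d : ℕ} (ω : Config d) (r : ℕ) : ℝ :=
  sInf {t : ℝ | ∃ f : Zd d → ℝ, f ≠ 0 ∧ Function.support f ⊆ chemBall ω r ∧
    t = dirichletForm ω r f / normSq ω f}

open scoped unitInterval

section Prob
open Classical

/-- The Bernoulli law on `Bool`. -/
noncomputable def ber (q : I) : Measure Bool :=
  ENNReal.ofReal q • Measure.dirac true + ENNReal.ofReal (1 - q) • Measure.dirac false

instance (q : I) : IsProbabilityMeasure (ber q) := by
  constructor
  simp only [ber, Measure.add_apply, Measure.smul_apply, measure_univ, smul_eq_mul, mul_one]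
  rw [← ENNReal.ofReal_add q.2.1 (by linarith [q.2.2])]
  simp

lemma ber_singleton (q : I) (b : Bool) :
    ber q {b} = if b then ENNReal.ofReal q else ENNReal.ofReal (1 - q) := by
  cases b <;> simp [ber]

/-- Product Bernoulli measure with parameters `q`. -/
noncomputable def PM {ι : Type*} (q : ι → I) : Measure (ι → Bool) :=
  Measure.infinitePi fun i => ber (q i)

instance {ι : Type*} (q : ι → I) : IsProbabilityMeasure (PM q) := by
  unfold PM; infer_instance

/-- Real-valued probability under the product Bernoulli measure. -/
noncomputable def Pr {ι : Type*} (q : ι → I) (A : Set (ι → Bool)) : ℝ := (PM q).real A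

variable {ι κ : Type*}

lemma PM_cylinder (q : ι → I) (s : Finset ι) (f : ι → Bool) :
    PM q {ω | ∀ e ∈ s, ω e = f e} =
      ∏ e ∈ s, (if f e then ENNReal.ofReal (q e) else ENNReal.ofReal (1 - q e)) := by
  have : {ω : ι → Bool | ∀ e ∈ s, ω e = f e} = Set.pi s (fun e => {f e}) := by
    ext ω; simp [Set.pi]
  rw [this, PM, Measure.infinitePi_pi _ (fun _ _ => measurableSet_singleton _)]
  exact Finset.prod_congr rfl fun e _ => ber_singleton _ _

lemma eq_PM (q : ι → I) (ν : Measure (ι → Bool))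
    (h : ∀ (s : Finset ι) (f : ι → Bool), ν {ω | ∀ e ∈ s, ω e = f e} =
      ∏ e ∈ s, (if f e then ENNReal.ofReal (q e) else ENNReal.ofReal (1 - q e))) :
    ν = PM q := by
  apply Measure.eq_infinitePi
  intro s t _
  have hU : Set.pi (s : Set ι) t = ⋃ f ∈ (Fintype.piFinset (fun i : s => (Finset.univ.filter
      (fun b => b ∈ t i)))), {ω : ι → Bool | ∀ e (he : e ∈ s), ω e = f ⟨e, he⟩} := by
    ext ω
    simp only [Set.mem_pi, Set.mem_iUnion, Fintype.mem_piFinset, Finset.mem_filter,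
      Finset.mem_univ, true_and, Set.mem_ofPred_eq, exists_prop, SetLike.mem_coe]
    constructor
    · intro H
      exact ⟨fun i => ω i, fun a => H a a.2, fun _ _ => rfl⟩
    · rintro ⟨f, hf, hω⟩ i hi
      rw [hω i hi]; exact hf ⟨i, hi⟩
  have key : ∀ f : s → Bool, ν {ω : ι → Bool | ∀ e (he : e ∈ s), ω e = f ⟨e, he⟩} =
      ∏ i : s, ber (q i) {f i} := by
    intro f
    have := h s (fun e => if he : e ∈ s then f ⟨e, he⟩ else true)
    rw [← Finset.prod_coe_sort s (fun e => if (if he : e ∈ s then f ⟨e, he⟩ else true) then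
      ENNReal.ofReal (q e) else ENNReal.ofReal (1 - q e))] at this
    have hset : {ω : ι → Bool | ∀ e (he : e ∈ s), ω e = f ⟨e, he⟩} =
        {ω | ∀ e ∈ s, ω e = if he : e ∈ s then f ⟨e, he⟩ else true} := by
      ext ω
      refine forall₂_congr fun e he => ?_
      simp [he]
    rw [hset, this]
    refine Finset.prod_congr rfl fun e _ => ?_
    rw [ber_singleton]; simp
  have hm : ∀ f : s → Bool, MeasurableSet {ω : ι → Bool | ∀ e (he : e ∈ s), ω e = f ⟨e, he⟩} := by
    intro f
    have : {ω : ι → Bool | ∀ e (he : e ∈ s), ω e = f ⟨e, he⟩} =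
      ⋂ e : s, (fun ω : ι → Bool => ω e) ⁻¹' {f e} := by ext; simp
    rw [this]
    exact MeasurableSet.iInter fun e => measurable_pi_apply _ (measurableSet_singleton _)
  rw [hU, measure_biUnion_finset _ (fun f _ => hm f)]
  · simp_rw [key]
    rw [← Finset.prod_coe_sort, ← Finset.prod_univ_sum (fun i : s => Finset.univ.filter (fun b => b ∈ t i))
      (fun i b => ber (q i) {b})]
    refine Finset.prod_congr rfl fun i _ => ?_
    rw [← measure_biUnion_finset _ (fun _ _ => measurableSet_singleton _)]
    · congr 1; ext b; simp
    · intro a _ b _ hab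
      simpa [Function.onFun] using hab
  · intro f _ g _ hfg
    rw [Function.onFun, Set.disjoint_left]
    intro ω hω hω'
    exact hfg (funext fun i => (hω i i.2).symm.trans (hω' i i.2))

/-- `A` only depends on the coordinates in `s`. -/
def DetBy {β : Type*} (s : Set ι) (f : (ι → Bool) → β) : Prop :=
  ∀ ω ω' : ι → Bool, (∀ i ∈ s, ω i = ω' i) → f ω = f ω'

lemma DetBy.mono {β : Type*} {s t : Set ι} {f : (ι → Bool) → β} (h : DetBy s f) (hst : s ⊆ t) :
    DetBy t f := fun ω ω' H => h ω ω' fun i hi => H i (hst hi)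

lemma detBy_iff {s : Set ι} {A : (ι → Bool) → Prop} :
    DetBy s A ↔ ∀ ω ω' : ι → Bool, (∀ i ∈ s, ω i = ω' i) → A ω → A ω' := by
  refine ⟨fun h ω ω' H => (h ω ω' H).mp, fun h ω ω' H => propext ⟨h ω ω' H, h ω' ω ?_⟩⟩
  exact fun i hi => (H i hi).symm

lemma DetBy.comp {β γ : Type*} {s : Set ι} {f : (ι → Bool) → β} (h : DetBy s f) (g : β → γ) :
    DetBy s (fun ω => g (f ω)) := fun ω ω' H => by simp only [h ω ω' H]

lemma DetBy.comp₂ {β β' γ : Type*} {s : Set ι} {f : (ι → Bool) → β} {f' : (ι → Bool) → β'}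
    (h : DetBy s f) (h' : DetBy s f') (g : β → β' → γ) :
    DetBy s (fun ω => g (f ω) (f' ω)) := fun ω ω' H => by simp only [h ω ω' H, h' ω ω' H]

lemma DetBy.forall {α : Sort*} {s : Set ι} {A : α → (ι → Bool) → Prop} (h : ∀ a, DetBy s (A a)) :
    DetBy s (fun ω => ∀ a, A a ω) := fun ω ω' H => by simp only [fun a => h a ω ω' H]

lemma DetBy.exists {α : Sort*} {s : Set ι} {A : α → (ι → Bool) → Prop} (h : ∀ a, DetBy s (A a)) :
    DetBy s (fun ω => ∃ a, A a ω) := fun ω ω' H => by simp only [fun a => h a ω ω' H]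

lemma DetBy.and {s : Set ι} {A B : (ι → Bool) → Prop} (h : DetBy s A) (h' : DetBy s B) :
    DetBy s (fun ω => A ω ∧ B ω) := h.comp₂ h' _

lemma DetBy.not {s : Set ι} {A : (ι → Bool) → Prop} (h : DetBy s A) :
    DetBy s (fun ω => ¬ A ω) := h.comp _

lemma detBy_const {β : Type*} (s : Set ι) (b : β) : DetBy s (fun _ => b) := fun _ _ _ => rfl

lemma DetBy.precomp {β : Type*} {s : Set κ} {f : (κ → Bool) → β} (h : DetBy s f)
    {φ : (ι → Bool) → κ → Bool} {t : Set ι}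
    (hφ : ∀ k ∈ s, DetBy t fun ω => φ ω k) : DetBy t (fun ω => f (φ ω)) :=
  fun ω ω' H => h _ _ fun k hk => hφ k hk ω ω' H

lemma detBy_eval (i : ι) : DetBy {i} (fun ω : ι → Bool => ω i) := fun _ _ H => H i rfl

lemma DetBy.factor {β : Type*} {s : Set ι} {f : (ι → Bool) → β} (h : DetBy s f) :
    ∃ g : (s → Bool) → β, f = fun ω => g (fun i => ω i) := by
  refine ⟨fun η => f (fun i => if hi : i ∈ s then η ⟨i, hi⟩ else true), ?_⟩
  ext ω
  exact h _ _ fun i hi => by simp [hi]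

lemma DetBy.measurable {β : Type*} [MeasurableSpace β] {s : Set ι} (hs : s.Finite)
    {f : (ι → Bool) → β} (h : DetBy s f) : Measurable f := by
  obtain ⟨g, rfl⟩ := h.factor
  have := hs.to_subtype
  exact (measurable_of_countable g).comp (by fun_prop)

lemma DetBy.measurableSet {s : Set ι} (hs : s.Finite)
    {A : (ι → Bool) → Prop} (h : DetBy s A) : MeasurableSet {ω | A ω} :=
  measurableSet_setOfPred.2 (h.measurable hs)

lemma DetBy.finite_range {β : Type*} {s : Set ι} (hs : s.Finite)
    {f : (ι → Bool) → β} (h : DetBy s f) : (Set.range f).Finite := by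
  obtain ⟨g, rfl⟩ := h.factor
  have := hs.to_subtype
  refine (Set.finite_range g).subset ?_
  rintro _ ⟨ω, rfl⟩
  exact ⟨_, rfl⟩

lemma DetBy.integrable {s : Set ι} (hs : s.Finite) {f : (ι → Bool) → ℝ} (h : DetBy s f)
    (q : ι → I) : Integrable f (PM q) := by
  obtain ⟨C, hC⟩ := ((h.finite_range hs).image (fun x : ℝ => ‖x‖)).bddAbove
  exact Integrable.of_bound (h.measurable hs).aestronglyMeasurable C
    (Filter.Eventually.of_forall fun ω => hC ⟨_, ⟨ω, rfl⟩, rfl⟩)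

open ProbabilityTheory in
lemma DetBy.indepFun {β γ : Type*} [MeasurableSpace β] [MeasurableSpace γ] {s t : Set ι}
    (hs : s.Finite) (ht : t.Finite)
    {f : (ι → Bool) → β} {g : (ι → Bool) → γ} (hf : DetBy s f) (hg : DetBy t g)
    (hst : Disjoint s t) (q : ι → I) : IndepFun f g (PM q) := by
  lift s to Finset ι using hs
  lift t to Finset ι using ht
  obtain ⟨f, rfl⟩ := hf.factor
  obtain ⟨g, rfl⟩ := hg.factor
  have h := iIndepFun_infinitePi (P := fun i => ber (q i)) (X := fun _ b => b)
    (fun _ => measurable_id)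
  exact (h.indepFun_finset s t (by exact_mod_cast hst) (fun i => by fun_prop)).comp
    (φ := f) (ψ := g) (measurable_of_countable _) (measurable_of_countable _)

lemma integral_mul_of_detBy {s t : Set ι}
    (hs : s.Finite) (ht : t.Finite) {f g : (ι → Bool) → ℝ} (hf : DetBy s f) (hg : DetBy t g)
    (hst : Disjoint s t) (q : ι → I) :
    ∫ ω, f ω * g ω ∂(PM q) = (∫ ω, f ω ∂(PM q)) * ∫ ω, g ω ∂(PM q) :=
  (hf.indepFun hs ht hg hst q).integral_fun_mul_eq_mul_integral
    (hf.measurable hs).aestronglyMeasurable (hg.measurable ht).aestronglyMeasurable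

lemma Pr_and {s t : Set ι}
    (hs : s.Finite) (ht : t.Finite) {A B : (ι → Bool) → Prop} (hA : DetBy s A) (hB : DetBy t B)
    (hst : Disjoint s t) (q : ι → I) :
    Pr q {ω | A ω ∧ B ω} = Pr q {ω | A ω} * Pr q {ω | B ω} := by
  have := ProbabilityTheory.indepFun_iff_measure_inter_preimage_eq_mul.1
    (hA.indepFun hs ht hB hst q) {True} {True} (measurableSet_singleton _)
      (measurableSet_singleton _)
  have h2 := congrArg ENNReal.toReal this
  rw [ENNReal.toReal_mul] at h2
  simp only [Pr, Measure.real]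
  convert h2 using 3 <;> [skip; congr 1; congr 1] <;> ext ω <;> simp

lemma Pr_nonneg (q : ι → I) (A : Set (ι → Bool)) : 0 ≤ Pr q A := measureReal_nonneg
lemma Pr_le_one (q : ι → I) (A : Set (ι → Bool)) : Pr q A ≤ 1 := measureReal_le_one
lemma Pr_mono (q : ι → I) {A B : Set (ι → Bool)} (h : A ⊆ B) : Pr q A ≤ Pr q B :=
  measureReal_mono h
lemma Pr_union_le (q : ι → I) (A B : Set (ι → Bool)) : Pr q (A ∪ B) ≤ Pr q A + Pr q B :=
  measureReal_union_le A B
lemma Pr_univ (q : ι → I) : Pr q Set.univ = 1 := by simp [Pr]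
lemma Pr_empty (q : ι → I) : Pr q ∅ = 0 := by simp [Pr]

lemma Pr_compl (q : ι → I) {A : Set (ι → Bool)} (h : MeasurableSet A) :
    Pr q Aᶜ = 1 - Pr q A := by
  rw [Pr, measureReal_compl h]; simp [Pr]

lemma Pr_cylinder (q : ι → I) (s : Finset ι) (f : ι → Bool) :
    Pr q {ω | ∀ e ∈ s, ω e = f e} = ∏ e ∈ s, (if f e then (q e : ℝ) else 1 - q e) := by
  rw [Pr, Measure.real, PM_cylinder, ENNReal.toReal_prod]
  refine Finset.prod_congr rfl fun e _ => ?_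
  split_ifs
  · exact ENNReal.toReal_ofReal (q e).2.1
  · exact ENNReal.toReal_ofReal (by linarith [(q e).2.2])

lemma Pr_all_true (q : ι → I) (s : Finset ι) :
    Pr q {ω | ∀ e ∈ s, ω e = true} = ∏ e ∈ s, (q e : ℝ) := by
  simpa using Pr_cylinder q s (fun _ => true)

lemma Pr_all_false (q : ι → I) (s : Finset ι) :
    Pr q {ω | ∀ e ∈ s, ω e = false} = ∏ e ∈ s, (1 - q e : ℝ) := by
  simpa using Pr_cylinder q s (fun _ => false)

lemma Pr_true (q : ι → I) (i : ι) : Pr q {ω | ω i = true} = q i := by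
  simpa using Pr_all_true q {i}

/-- Finite families of events with pairwise disjoint supports are independent. -/
lemma Pr_forall {α : Type*} (T : Finset α) (c : α → Set ι) (A : α → (ι → Bool) → Prop)
    (hc : ∀ a ∈ T, (c a).Finite) (hA : ∀ a ∈ T, DetBy (c a) (A a))
    (hd : ∀ a ∈ T, ∀ b ∈ T, a ≠ b → Disjoint (c a) (c b)) (q : ι → I) :
    Pr q {ω | ∀ a ∈ T, A a ω} = ∏ a ∈ T, Pr q {ω | A a ω} := by
  induction T using Finset.induction_on with
  | empty => simp [Pr_univ]
  | insert a T ha ih =>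
    rw [Finset.prod_insert ha, ← ih (fun b hb => hc b (by simp [hb]))
      (fun b hb => hA b (by simp [hb])) (fun b hb b' hb' => hd b (by simp [hb]) b' (by simp [hb']))]
    have hfin : (⋃ b ∈ T, c b).Finite :=
      T.finite_toSet.biUnion fun b hb => hc b (by simp [Finset.mem_coe.1 hb])
    rw [← Pr_and (hc a (by simp)) hfin (hA a (by simp)) ?_ ?_ q]
    · congr 1; ext ω; simp
    · refine DetBy.forall fun b => DetBy.forall fun hb => (hA b (by simp [hb])).mono ?_
      exact Set.subset_biUnion_of_mem (u := c) hb
    · rw [Set.disjoint_iUnion₂_right]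
      intro b hb
      exact hd a (by simp) b (by simp [hb]) (by rintro rfl; exact ha hb)

/-- Law of a configuration built from disjoint blocks of coordinates. -/
lemma map_PM {q : ι → I} {q' : κ → I} {φ : (ι → Bool) → κ → Bool} (c : κ → Set ι)
    (hc : ∀ k, (c k).Finite) (hφ : ∀ k, DetBy (c k) fun ω => φ ω k)
    (hd : ∀ k l, k ≠ l → Disjoint (c k) (c l)) (hq : ∀ k, Pr q {ω | φ ω k = true} = q' k) :
    Measurable φ ∧ (PM q).map φ = PM q' := by
  have hm : Measurable φ := measurable_pi_lambda _ fun k => (hφ k).measurable (hc k)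
  refine ⟨hm, eq_PM _ _ fun s f => ?_⟩
  have hcyl : {ω : κ → Bool | ∀ e ∈ s, ω e = f e} = ⋂ e ∈ s, (fun ω => ω e) ⁻¹' {f e} := by
    ext; simp
  rw [Measure.map_apply hm]
  · have h1 := Pr_forall s c (fun k ω => φ ω k = f k) (fun k _ => hc k)
      (fun k _ => (hφ k).comp (· = f k)) (fun k _ l _ => hd k l) q
    rw [← ENNReal.ofReal_toReal (measure_ne_top (PM q) _)]
    change ENNReal.ofReal (Pr q {ω | ∀ e ∈ s, φ ω e = f e}) = _
    rw [h1, ENNReal.ofReal_prod_of_nonneg fun _ _ => Pr_nonneg _ _]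
    refine Finset.prod_congr rfl fun e _ => ?_
    cases hfe : f e
    · have := Pr_compl q (((hφ e).comp (· = true)).measurableSet (hc e))
      rw [hq] at this
      simp only [Bool.false_eq_true, if_false]
      rw [← this]
      congr 2; ext; simp
    · simp [hq]
  · rw [hcyl]
    exact Finset.measurableSet_biInter _ fun e _ =>
      measurable_pi_apply _ (measurableSet_singleton _)

lemma Pr_map {q : ι → I} {q' : κ → I} {φ : (ι → Bool) → κ → Bool} (h : Measurable φ)
    (h' : (PM q).map φ = PM q') {A : Set (κ → Bool)} (hA : MeasurableSet A) :
    Pr q' A = Pr q (φ ⁻¹' A) := by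
  rw [Pr, ← h', Pr, measureReal_def, Measure.map_apply h hA, measureReal_def]

/-- Reading the coordinates along an injection. -/
lemma map_PM_inj {q : ι → I} {q' : κ → I} (g : κ → ι) (hg : g.Injective)
    (hq : ∀ k, q (g k) = q' k) :
    Measurable (fun (ω : ι → Bool) k => ω (g k)) ∧ (PM q).map (fun ω k => ω (g k)) = PM q' :=
  map_PM (fun k => {g k}) (fun _ => Set.finite_singleton _) (fun k => detBy_eval _)
    (fun k l hkl => by simpa using hg.ne hkl) (fun k => by rw [Pr_true, hq])

/-- Total probability over the values of a finitely determined map. -/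
lemma Pr_partition {β : Type*} {q : ι → I} {s : Set ι} (hs : s.Finite) {f : (ι → Bool) → β}
    (hf : DetBy s f) (T : Finset β) (hT : ∀ ω, f ω ∈ T) (A : Set (ι → Bool)) :
    Pr q A = ∑ b ∈ T, Pr q {ω | ω ∈ A ∧ f ω = b} := by
  have hm : ∀ b, MeasurableSet {ω | f ω = b} := fun b => (hf.comp (· = b)).measurableSet hs
  have h := measureReal_biUnion_finset (μ := (PM q).restrict A) (s := T)
    (f := fun b => {ω | f ω = b}) (by
      intro a _ b _ hab
      rw [Function.onFun, Set.disjoint_left]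
      rintro ω rfl h2
      exact hab h2) (fun b _ => hm b)
  have hu : (⋃ b ∈ T, {ω | f ω = b}) = Set.univ := by
    ext ω; simp [hT ω]
  rw [hu] at h
  simp only [measureReal_def, Measure.restrict_apply MeasurableSet.univ, Set.univ_inter,
    Measure.restrict_apply (hm _)] at h
  simp only [Pr, measureReal_def, h]
  refine Finset.sum_congr rfl fun b _ => ?_
  congr 2
  ext ω; simp [and_comm]

lemma Pr_iUnion_le {α : Type*} (q : ι → I) (T : Finset α) (A : α → Set (ι → Bool)) :
    Pr q (⋃ a ∈ T, A a) ≤ ∑ a ∈ T, Pr q (A a) := measureReal_biUnion_finset_le T A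

lemma Pr_exists_le {α : Type*} (q : ι → I) (T : Finset α) (A : α → (ι → Bool) → Prop) :
    Pr q {ω | ∃ a ∈ T, A a ω} ≤ ∑ a ∈ T, Pr q {ω | A a ω} := by
  refine le_trans (Pr_mono q ?_) (Pr_iUnion_le q T fun a => {ω | A a ω})
  intro ω; simp

/-- Increasing events. -/
def Incr (A : (ι → Bool) → Prop) : Prop := ∀ ω ω' : ι → Bool, ω ≤ ω' → A ω → A ω'

lemma Pr_split (q : ι → I) (i : ι) {s : Set ι} (hs : s.Finite) (hi : i ∉ s)
    {A : (ι → Bool) → Prop} (hA : DetBy (insert i s) A) :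
    Pr q {ω | A ω} = q i * Pr q {ω | A (Function.update ω i true)} +
      (1 - q i) * Pr q {ω | A (Function.update ω i false)} := by
  have hd : ∀ b, DetBy s (fun ω => A (Function.update ω i b)) := fun b ω ω' H =>
    hA _ _ fun j hj => by
      by_cases hji : j = i
      · subst hji; simp
      · simp [hji, H j (hj.resolve_left hji)]
  rw [Pr_partition (Set.finite_singleton i) (detBy_eval i) {true, false} (by intro ω; simp)
    {ω | A ω}]
  rw [Finset.sum_pair (by simp)]
  have hdis : Disjoint {i} s := by simpa using hi
  have h1 : ∀ b, Pr q {ω | ω ∈ {ω | A ω} ∧ ω i = b} =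
      Pr q {ω | ω i = b} * Pr q {ω | A (Function.update ω i b)} := by
    intro b
    rw [← Pr_and (Set.finite_singleton i) hs ((detBy_eval i).comp (· = b)) (hd b) hdis]
    congr 1
    ext ω
    simp only [Set.mem_ofPred_eq]
    constructor
    · rintro ⟨h, rfl⟩; simpa using h
    · rintro ⟨rfl, h⟩; simpa using h
  rw [h1, h1, Pr_true]
  have : Pr q {ω : ι → Bool | ω i = false} = 1 - q i := by
    simpa using Pr_all_false q {i}
  rw [this]

/-- Harris inequality. -/
lemma harris (q : ι → I) {s : Set ι} (hs : s.Finite) {A B : (ι → Bool) → Prop}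
    (hA : DetBy s A) (hB : DetBy s B) (iA : Incr A) (iB : Incr B) :
    Pr q {ω | A ω} * Pr q {ω | B ω} ≤ Pr q {ω | A ω ∧ B ω} := by
  induction s, hs using Set.Finite.induction_on generalizing A B with
  | empty =>
    have := Pr_and Set.finite_empty Set.finite_empty hA hB (by simp) q
    exact this.ge
  | @insert i s hi hs ih =>
    have hd : ∀ b (A : (ι → Bool) → Prop), DetBy (insert i s) A →
        DetBy s (fun ω => A (Function.update ω i b)) := fun b A hA ω ω' H =>
      hA _ _ fun j hj => by
        by_cases hji : j = i
        · subst hji; simp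
        · simp [hji, H j (hj.resolve_left hji)]
    have hinc : ∀ b (A : (ι → Bool) → Prop), Incr A →
        Incr (fun ω => A (Function.update ω i b)) := fun b A hA ω ω' H =>
      hA _ _ (update_le_update_iff.2 ⟨le_rfl, fun j _ => H j⟩)
    have hle : ∀ (A : (ι → Bool) → Prop), Incr A →
        Pr q {ω | A (Function.update ω i false)} ≤ Pr q {ω | A (Function.update ω i true)} :=
      fun A hA => Pr_mono q fun ω h => hA _ _ (update_le_update_iff.2
        ⟨Bool.false_le _, fun j _ => le_rfl⟩) h
    rw [Pr_split q i hs hi hA, Pr_split q i hs hi hB, Pr_split q i hs hi (hA.and hB)]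
    have t := ih (hd true A hA) (hd true B hB) (hinc true A iA) (hinc true B iB)
    have f := ih (hd false A hA) (hd false B hB) (hinc false A iA) (hinc false B iB)
    have h1 := hle A iA
    have h2 := hle B iB
    have q0 := (q i).2.1
    have q1 := (q i).2.2
    have e1 := mul_le_mul_of_nonneg_left t q0
    have e2 := mul_le_mul_of_nonneg_left f (sub_nonneg.2 q1)
    have e3 := mul_nonneg (mul_nonneg q0 (sub_nonneg.2 q1))
      (mul_nonneg (sub_nonneg.2 h1) (sub_nonneg.2 h2))
    nlinarith

end Prob

section Lattice

variable {d : ℕ}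

lemma latAdj_comm {x y : Zd d} : latAdj x y ↔ latAdj y x := by
  simp only [latAdj, abs_sub_comm]

lemma openAdj_comm {ω : Config d} {x y : Zd d} : openAdj ω x y ↔ openAdj ω y x := by
  rw [openAdj, openAdj, latAdj_comm, Sym2.eq_swap]

/-- The `i`-th coordinate vector. -/
abbrev ee (i : Fin d) : Zd d := Pi.single i 1

lemma latAdj_add (x : Zd d) (i : Fin d) : latAdj x (x + ee i) := by
  unfold latAdj
  rw [Finset.sum_eq_single i]
  · simp
  · intro j _ hj; simp [hj]
  · simp

lemma latAdj_iff {x y : Zd d} : latAdj x y ↔ ∃ i, y = x + ee i ∨ x = y + ee i := by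
  constructor
  · intro h
    have h1 : ∃ i, |x i - y i| = 1 := by
      by_contra! hne
      have h0 : ∀ i, |x i - y i| = 0 := by
        intro i
        have := Finset.single_le_sum (f := fun i => |x i - y i|) (fun i _ => abs_nonneg _)
          (Finset.mem_univ i)
        have hh : |x i - y i| ≤ 1 := by rw [← h]; exact this
        have := hne i
        have := abs_nonneg (x i - y i)
        omega
      unfold latAdj at h
      simp [h0] at h
    obtain ⟨i, hi⟩ := h1
    have h0 : ∀ j, j ≠ i → x j = y j := by
      intro j hj
      have := Finset.add_sum_erase Finset.univ (fun i => |x i - y i|) (Finset.mem_univ i)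
      have h2 := Finset.single_le_sum (f := fun i => |x i - y i|) (fun i _ => abs_nonneg _)
          (Finset.mem_erase.2 ⟨hj, Finset.mem_univ j⟩)
      have hh : (∑ i, |x i - y i|) = 1 := h
      have : |x j - y j| ≤ 0 := by omega
      have := abs_nonpos_iff.1 this
      omega
    refine ⟨i, ?_⟩
    rcases (abs_eq (by norm_num)).1 hi with h' | h'
    · right
      ext j
      by_cases hj : j = i
      · subst hj; simp; omega
      · simp [hj, h0 j hj]
    · left
      ext j
      by_cases hj : j = i
      · subst hj; simp; omega
      · simp [hj, h0 j hj]
  · rintro ⟨i, rfl | rfl⟩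
    · exact latAdj_add _ _
    · exact latAdj_comm.1 (latAdj_add _ _)

lemma latAdj.abs_le {x y : Zd d} (h : latAdj x y) (i : Fin d) : |x i - y i| ≤ 1 := by
  have := Finset.single_le_sum (f := fun i => |x i - y i|) (fun i _ => abs_nonneg _)
          (Finset.mem_univ i)
  exact this.trans h.le

/-- The sup-norm ball. -/
def ball (c : Zd d) (n : ℤ) : Set (Zd d) := {y | ∀ i, |y i - c i| ≤ n}

lemma mem_ball {c : Zd d} {n : ℤ} {y : Zd d} : y ∈ ball c n ↔ ∀ i, |y i - c i| ≤ n := Iff.rfl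

lemma ball_eq_Icc (c : Zd d) (n : ℤ) : ball c n = Set.Icc (fun i => c i - n) (fun i => c i + n) := by
  ext y
  simp only [mem_ball, Set.mem_Icc, Pi.le_def, ← forall_and]
  refine forall_congr' fun i => ?_
  rw [abs_le]; constructor <;> rintro ⟨h1, h2⟩ <;> constructor <;> linarith

lemma ball_finite (c : Zd d) (n : ℤ) : (ball c n).Finite := by
  rw [ball_eq_Icc]; exact Set.finite_Icc _ _

lemma self_mem_ball (c : Zd d) {n : ℤ} (hn : 0 ≤ n) : c ∈ ball c n := by simp [mem_ball, hn]

lemma ball_subset_ball {c c' : Zd d} {n n' m : ℤ} (hc : c ∈ ball c' m) (h : n + m ≤ n') :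
    ball c n ⊆ ball c' n' := by
  intro y hy i
  have h1 := hy i
  have h2 := hc i
  rw [abs_le] at *
  constructor <;> linarith [h1.1, h1.2, h2.1, h2.2]

lemma ball_mono (c : Zd d) {n n' : ℤ} (h : n ≤ n') : ball c n ⊆ ball c n' :=
  fun _ hy i => (hy i).trans h

lemma mem_ball_comm {x y : Zd d} {n : ℤ} : x ∈ ball y n ↔ y ∈ ball x n := by
  simp only [mem_ball, abs_sub_comm]

/-- Sup-norm distance at least `n`. -/
def far (c : Zd d) (n : ℤ) : Set (Zd d) := {y | ∃ i, n ≤ |y i - c i|}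

/-- The sup-norm sphere. -/
def sph (c : Zd d) (n : ℤ) : Set (Zd d) := ball c n ∩ far c n

lemma not_mem_ball {c : Zd d} {n : ℤ} {y : Zd d} : y ∉ ball c n ↔ y ∈ far c (n + 1) := by
  simp only [ball, far, Set.mem_ofPred_eq, not_forall, not_le, Int.add_one_le_iff]

lemma far_anti (c : Zd d) {n n' : ℤ} (h : n ≤ n') : far c n' ⊆ far c n :=
  fun _ ⟨i, hi⟩ => ⟨i, h.trans hi⟩

/-- Open connection inside a set of vertices. -/
def Conn (ω : Config d) (V : Set (Zd d)) (x y : Zd d) : Prop :=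
  x ∈ V ∧ Relation.ReflTransGen (fun a b => openAdj ω a b ∧ a ∈ V ∧ b ∈ V) x y

variable {ω ω' : Config d} {V W K F : Set (Zd d)} {x y z : Zd d}

lemma Conn.refl (h : x ∈ V) : Conn ω V x x := ⟨h, .refl⟩

lemma Conn.left (h : Conn ω V x y) : x ∈ V := h.1

lemma Conn.right (h : Conn ω V x y) : y ∈ V := by
  obtain ⟨h1, h2⟩ := h
  cases h2 with
  | refl => exact h1
  | tail _ h => exact h.2.2

lemma Conn.trans (h : Conn ω V x y) (h' : Conn ω V y z) : Conn ω V x z := ⟨h.1, h.2.trans h'.2⟩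

lemma Conn.symm (h : Conn ω V x y) : Conn ω V y x :=
  ⟨h.right, Relation.reflTransGen_swap.1 (Relation.ReflTransGen.mono
    (fun _ _ ⟨h1, h2, h3⟩ => ⟨openAdj_comm.1 h1, h3, h2⟩) _ _ h.2)⟩

lemma Conn.mono (h : Conn ω V x y) (hVW : V ⊆ W) : Conn ω W x y :=
  ⟨hVW h.1, Relation.ReflTransGen.mono (fun _ _ ⟨a, b, c⟩ => ⟨a, hVW b, hVW c⟩) _ _ h.2⟩

lemma openAdj.mono (hω : ω ≤ ω') (h : openAdj ω x y) : openAdj ω' x y :=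
  ⟨h.1, Bool.eq_true_of_true_le (h.2 ▸ hω _)⟩

lemma Conn.mono_config (h : Conn ω V x y) (hω : ω ≤ ω') : Conn ω' V x y :=
  ⟨h.1, Relation.ReflTransGen.mono (fun _ _ ⟨a, b, c⟩ => ⟨a.mono hω, b, c⟩) _ _ h.2⟩

lemma Conn.of_adj (h : openAdj ω x y) (hx : x ∈ V) (hy : y ∈ V) : Conn ω V x y :=
  ⟨hx, .single ⟨h, hx, hy⟩⟩

lemma Conn.induct (h : Conn ω V x y) {P : Zd d → Prop} (h0 : P x)
    (hs : ∀ a b, Conn ω V x a → openAdj ω a b → b ∈ V → P a → P b) : P y := by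
  obtain ⟨h1, h2⟩ := h
  induction h2 with
  | refl => exact h0
  | tail hab hbc ih => exact hs _ _ ⟨h1, hab⟩ hbc.1 hbc.2.2 ih

/-- First exit from `K`. -/
lemma Conn.exit (h : Conn ω V x y) (hx : x ∈ K) (hy : y ∉ K) :
    ∃ u v, Conn ω (V ∩ K) x u ∧ openAdj ω u v ∧ v ∈ V ∧ v ∉ K := by
  by_contra! hne
  refine hy (h.induct (P := fun y => Conn ω (V ∩ K) x y) (.refl ⟨h.1, hx⟩) ?_).right.2
  intro a b _ hab hb ha
  have hbK := hne a b ha hab hb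
  exact ha.trans (.of_adj hab ha.right ⟨hb, hbK⟩)

/-- Last exit from `K`. -/
lemma Conn.last_exit (h : Conn ω V x y) (hx : x ∈ K) (hy : y ∉ K) :
    ∃ u v, u ∈ V ∧ u ∈ K ∧ openAdj ω u v ∧ Conn ω (V \ K) v y := by
  obtain ⟨u, v, h1, h2, h3, h4⟩ := h.symm.exit (K := Kᶜ) hy (by simpa using hx)
  exact ⟨v, u, h3, by simpa using h4, openAdj_comm.1 h2, h1.symm⟩

lemma Conn.to_sph {c : Zd d} {n : ℤ} (h : Conn ω V x y) (hx : x ∈ ball c n) (hy : y ∈ far c n) :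
    ∃ u ∈ sph c n, Conn ω (V ∩ ball c n) x u := by
  by_cases hyb : y ∈ ball c n
  · by_cases hf : ∃ u v, Conn ω (V ∩ ball c n) x u ∧ openAdj ω u v ∧ v ∈ V ∧ v ∉ ball c n
    · obtain ⟨u, v, h1, h2, h3, h4⟩ := hf
      refine ⟨u, ⟨h1.right.2, ?_⟩, h1⟩
      obtain ⟨i, hi⟩ := not_mem_ball.1 h4
      refine ⟨i, ?_⟩
      have := h2.1.abs_le i
      rw [abs_sub_comm] at this
      have := abs_sub_abs_le_abs_sub (v i - c i) (u i - c i)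
      rw [show v i - c i - (u i - c i) = v i - u i by ring] at this
      linarith
    · push Not at hf
      refine ⟨y, ⟨hyb, hy⟩, h.induct (P := fun y => Conn ω (V ∩ ball c n) x y) (.refl ⟨h.1, hx⟩) ?_⟩
      intro a b _ hab hb ha
      exact ha.trans (.of_adj hab ha.right ⟨hb, hf a b ha hab hb⟩)
  · obtain ⟨u, v, h1, h2, h3, h4⟩ := h.exit hx hyb
    refine ⟨u, ⟨h1.right.2, ?_⟩, h1⟩
    obtain ⟨i, hi⟩ := not_mem_ball.1 h4
    refine ⟨i, ?_⟩
    have := h2.1.abs_le i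
    rw [abs_sub_comm] at this
    have := abs_sub_abs_le_abs_sub (v i - c i) (u i - c i)
    rw [show v i - c i - (u i - c i) = v i - u i by ring] at this
    linarith

/-- Edges with both ends in `V`. -/
def edgesIn (V : Set (Zd d)) : Set (Sym2 (Zd d)) := {e | ∀ a ∈ e, a ∈ V}

lemma mk_mem_edgesIn : s(x, y) ∈ edgesIn V ↔ x ∈ V ∧ y ∈ V := by
  simp [edgesIn]

lemma edgesIn_mono (h : V ⊆ W) : edgesIn V ⊆ edgesIn W := fun _ he a ha => h (he a ha)

lemma edgesIn_finite (h : V.Finite) : (edgesIn V).Finite := by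
  refine ((h.prod h).image (fun p : Zd d × Zd d => s(p.1, p.2))).subset ?_
  intro e he
  induction e using Sym2.ind with
  | _ x y =>
    rw [mk_mem_edgesIn] at he
    exact ⟨(x, y), he, rfl⟩

lemma edgesIn_disjoint (h : Disjoint V W) : Disjoint (edgesIn V) (edgesIn W) := by
  rw [Set.disjoint_left]
  intro e he he'
  induction e using Sym2.ind with
  | _ x y => exact Set.disjoint_left.1 h (he x (by simp)) (he' x (by simp))

lemma detBy_conn (V : Set (Zd d)) (x y : Zd d) : DetBy (edgesIn V) fun ω => Conn ω V x y := by
  rw [detBy_iff]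
  rintro ω ω' H ⟨h1, h2⟩
  refine ⟨h1, Relation.ReflTransGen.mono ?_ _ _ h2⟩
  rintro a b ⟨⟨h, hab⟩, ha, hb⟩
  exact ⟨⟨h, by rw [← H _ (mk_mem_edgesIn.2 ⟨ha, hb⟩), hab]⟩, ha, hb⟩

/-- `x` is connected inside `V` to the set `F`. -/
def CT (ω : Config d) (V : Set (Zd d)) (x : Zd d) (F : Set (Zd d)) : Prop := ∃ y ∈ F, Conn ω V x y

lemma detBy_CT (V : Set (Zd d)) (x : Zd d) (F : Set (Zd d)) :
    DetBy (edgesIn V) fun ω => CT ω V x F := by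
  unfold CT
  exact .exists fun y => (detBy_const _ _).and (detBy_conn V x y)

lemma incr_CT (V : Set (Zd d)) (x : Zd d) (F : Set (Zd d)) : Incr fun ω => CT ω V x F :=
  fun _ _ h ⟨y, hy, h'⟩ => ⟨y, hy, h'.mono_config h⟩

lemma CT.mono (h : CT ω V x F) (hVW : V ⊆ W) : CT ω W x F :=
  let ⟨y, hy, h⟩ := h; ⟨y, hy, h.mono hVW⟩

lemma Conn.CT_sph {c : Zd d} {n : ℤ} (h : Conn ω V x y) (hx : x ∈ ball c n) (hy : y ∈ far c n) :
    CT ω (ball c n) x (sph c n) := by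
  obtain ⟨u, hu, h⟩ := h.to_sph hx hy
  exact ⟨u, hu, h.mono Set.inter_subset_right⟩

/-- `x` lies in an infinite open cluster. -/
def Inf (ω : Config d) (x : Zd d) : Prop := ∀ n : ℕ, CT ω (ball x n) x (sph x n)

lemma inf_iff : Inf ω x ↔ {y | Conn ω Set.univ x y}.Infinite := by
  constructor
  · intro h hfin
    obtain ⟨n, hn⟩ : ∃ n : ℕ, {y | Conn ω Set.univ x y} ⊆ ball x n := by
      obtain ⟨n, hn⟩ := (hfin.image (fun y => ∑ i, (y i - x i).natAbs)).bddAbove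
      refine ⟨n, fun y hy i => ?_⟩
      have h1 := hn ⟨y, hy, rfl⟩
      have h2 := Finset.single_le_sum (f := fun i => (y i - x i).natAbs) (fun i _ => Nat.zero_le _)
        (Finset.mem_univ i)
      dsimp only at h1 h2
      rw [Int.abs_eq_natAbs]
      exact_mod_cast h2.trans h1
    obtain ⟨y, hy, hc⟩ := h (n + 1)
    have h1 := hn (hc.mono (Set.subset_univ _))
    have h2 := far_anti x (n := n + 1) (n' := (n + 1 : ℕ)) (by push_cast; rfl) hy.2
    exact not_mem_ball.2 h2 h1
  · intro h n
    obtain ⟨y, hy, hyn⟩ := h.exists_notMem_finite (ball_finite x n)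
    exact Conn.CT_sph hy (self_mem_ball x (by positivity))
      (far_anti x (by linarith) (not_mem_ball.1 hyn))

lemma cluster_eq : cluster ω = {y | Conn ω Set.univ 0 y} := by
  ext y
  simp [cluster, Conn]

lemma cluster_infinite_iff : (cluster ω).Infinite ↔ Inf ω 0 := by
  rw [cluster_eq, inf_iff]

lemma Inf.of_conn (h : Inf ω x) (hxy : Conn ω Set.univ x y) : Inf ω y := by
  rw [inf_iff] at *
  exact h.mono fun z hz => hxy.symm.trans hz

lemma measurableSet_inf (x : Zd d) : MeasurableSet {ω : Config d | Inf ω x} := by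
  have : {ω : Config d | Inf ω x} = ⋂ n : ℕ, {ω | CT ω (ball x n) x (sph x n)} := by
    ext; simp [Inf]
  rw [this]
  exact MeasurableSet.iInter fun n =>
    (detBy_CT _ _ _).measurableSet (edgesIn_finite (ball_finite _ _))

lemma conn_univ_iff : Conn ω Set.univ x y ↔ ∃ n : ℕ, Conn ω (ball 0 n) x y := by
  constructor
  · intro h
    have hbig : ∀ z : Zd d, ∃ n : ℕ, z ∈ ball 0 n := fun z =>
      ⟨∑ i, (z i).natAbs, fun i => by
        have h2 := Finset.single_le_sum (f := fun i => (z i).natAbs) (fun i _ => Nat.zero_le _)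
          (Finset.mem_univ i)
        simp only [Pi.zero_apply, sub_zero] at h2 ⊢
        rw [Int.abs_eq_natAbs]
        exact_mod_cast h2⟩
    refine h.induct (P := fun y => ∃ n : ℕ, Conn ω (ball 0 n) x y) ?_ ?_
    · obtain ⟨n, hn⟩ := hbig x
      exact ⟨n, .refl hn⟩
    · rintro a b _ hab _ ⟨n, ha⟩
      obtain ⟨m, hm⟩ := hbig b
      refine ⟨max n m, (ha.mono (ball_mono 0 (by simp))).trans (.of_adj hab ?_ ?_)⟩
      · exact ball_mono 0 (by simp) ha.right
      · exact ball_mono 0 (by simp) hm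
  · rintro ⟨n, h⟩
    exact h.mono (Set.subset_univ _)

lemma measurableSet_conn (x y : Zd d) : MeasurableSet {ω : Config d | Conn ω Set.univ x y} := by
  have : {ω : Config d | Conn ω Set.univ x y} = ⋃ n : ℕ, {ω | Conn ω (ball 0 n) x y} := by
    ext; simp [conn_univ_iff]
  rw [this]
  exact MeasurableSet.iUnion fun n =>
    (detBy_conn _ _ _).measurableSet (edgesIn_finite (ball_finite _ _))

/-- Pulling back a configuration along a lattice bijection. -/
def pull (φ : Zd d ≃ Zd d) (ω : Config d) : Config d := fun e => ω (e.map φ)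

/-- Lattice automorphisms. -/
def IsAut (φ : Zd d ≃ Zd d) : Prop := ∀ x y, latAdj (φ x) (φ y) ↔ latAdj x y

lemma IsAut.symm {φ : Zd d ≃ Zd d} (h : IsAut φ) : IsAut φ.symm := fun x y => by
  rw [← h]; simp

lemma openAdj_pull {φ : Zd d ≃ Zd d} (hφ : IsAut φ) :
    openAdj (pull φ ω) x y ↔ openAdj ω (φ x) (φ y) := by
  simp [openAdj, pull, hφ x y]

lemma Conn.of_pull {φ : Zd d ≃ Zd d} (hφ : IsAut φ) (h : Conn (pull φ ω) V x y) :
    Conn ω (φ '' V) (φ x) (φ y) :=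
  ⟨Set.mem_image_of_mem _ h.1, h.2.lift φ fun _ _ ⟨a, b, c⟩ =>
    ⟨(openAdj_pull hφ).1 a, Set.mem_image_of_mem _ b, Set.mem_image_of_mem _ c⟩⟩

lemma pull_pull_symm (φ : Zd d ≃ Zd d) (ω : Config d) : pull φ.symm (pull φ ω) = ω := by
  ext e
  simp [pull, Sym2.map_map]

lemma conn_pull {φ : Zd d ≃ Zd d} (hφ : IsAut φ) :
    Conn (pull φ ω) V x y ↔ Conn ω (φ '' V) (φ x) (φ y) := by
  refine ⟨.of_pull hφ, fun h => ?_⟩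
  have h' : Conn (pull φ.symm (pull φ ω)) (φ '' V) (φ x) (φ y) := by rwa [pull_pull_symm]
  simpa [Set.image_image] using Conn.of_pull hφ.symm h'

lemma CT_pull {φ : Zd d ≃ Zd d} (hφ : IsAut φ) :
    CT (pull φ ω) V x F ↔ CT ω (φ '' V) (φ x) (φ '' F) := by
  simp only [CT, conn_pull hφ, Set.exists_mem_image]

/-- The homogeneous Bernoulli percolation measure. -/
noncomputable abbrev PP (d : ℕ) (p : I) : Measure (Config d) := PM fun _ => p

/-- Probability under homogeneous Bernoulli percolation. -/
noncomputable abbrev Pb (p : I) (A : Set (Config d)) : ℝ := Pr (fun _ => p) A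

lemma pull_law (p : I) (φ : Zd d ≃ Zd d) :
    Measurable (pull φ) ∧ (PP d p).map (pull φ) = PP d p :=
  map_PM_inj (fun e => Sym2.map φ e) (Sym2.map.injective φ.injective) (fun _ => rfl)

lemma Pb_pull (p : I) (φ : Zd d ≃ Zd d) {A : Set (Config d)} (hA : MeasurableSet A) :
    Pb p {ω | pull φ ω ∈ A} = Pb p A :=
  (Pr_map (pull_law p φ).1 (pull_law p φ).2 hA).symm

/-- Translation. -/
def tr (a : Zd d) : Zd d ≃ Zd d := Equiv.addRight a

@[simp] lemma tr_apply (a x : Zd d) : tr a x = x + a := rfl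

lemma isAut_tr (a : Zd d) : IsAut (tr a) := fun x y => by simp [latAdj]

lemma tr_image_ball (a c : Zd d) (n : ℤ) : tr a '' ball c n = ball (c + a) n := by
  ext y
  rw [Equiv.image_eq_preimage_symm]
  simp only [Set.mem_preimage, mem_ball]
  refine forall_congr' fun i => ?_
  rw [show (tr a).symm y i - c i = y i - (c + a) i by
    simp [tr, Equiv.addRight]; ring]

lemma tr_image_sph (a c : Zd d) (n : ℤ) : tr a '' sph c n = sph (c + a) n := by
  rw [sph, Set.image_inter (tr a).injective, tr_image_ball, sph]
  congr 1
  ext y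
  rw [Equiv.image_eq_preimage_symm]
  simp only [Set.mem_preimage, far, Set.mem_ofPred_eq]
  refine exists_congr fun i => ?_
  rw [show (tr a).symm y i - c i = y i - (c + a) i by
    simp [tr, Equiv.addRight]; ring]

/-- Coordinate permutation followed by sign changes. -/
def sgnPerm (π : Equiv.Perm (Fin d)) (ε : Fin d → ℤˣ) : Zd d ≃ Zd d where
  toFun x := fun k => (ε k : ℤ) * x (π k)
  invFun y := fun k => (ε (π.symm k) : ℤ) * y (π.symm k)
  left_inv x := by ext k; simp [← mul_assoc, ← Units.val_mul]
  right_inv y := by ext k; simp [← mul_assoc, ← Units.val_mul]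

lemma isAut_sgnPerm (π : Equiv.Perm (Fin d)) (ε : Fin d → ℤˣ) : IsAut (sgnPerm π ε) := fun x y => by
  have : ∑ i, |sgnPerm π ε x i - sgnPerm π ε y i| = ∑ i, |x i - y i| := by
    rw [← Equiv.sum_comp π (fun i => |x i - y i|)]
    refine Finset.sum_congr rfl fun i _ => ?_
    change |(ε i : ℤ) * x (π i) - ε i * y (π i)| = _
    rw [← mul_sub, abs_mul]
    rcases Int.units_eq_one_or (ε i) with h | h <;> simp [h]
  simp [latAdj, this]

lemma sgnPerm_image_ball (π : Equiv.Perm (Fin d)) (ε : Fin d → ℤˣ) (n : ℤ) :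
    sgnPerm π ε '' ball 0 n = ball 0 n := by
  ext y
  rw [Equiv.image_eq_preimage_symm]
  simp only [Set.mem_preimage, mem_ball, Pi.zero_apply, sub_zero]
  rw [← π.forall_congr_right]
  refine forall_congr' fun i => ?_
  have : (sgnPerm π ε).symm y (π i) = (ε i : ℤ) * y i := by simp [sgnPerm]
  rw [this, abs_mul]
  rcases Int.units_eq_one_or (ε i) with h | h <;> simp [h]

lemma isBernoulli_eq {p : I} {Q : Measure (Config d)} (h : IsBernoulli (p : ℝ) Q) : Q = PP d p :=
  eq_PM _ _ h.2

lemma pc_nonneg (d : ℕ) : 0 ≤ pc d := Real.sSup_nonneg fun _ hx => hx.1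

/-- Above `p_c` the origin percolates with positive probability. -/
lemma theta_pos {p : I} (hp : pc d < p) : 0 < Pb p {ω : Config d | Inf ω 0} := by
  by_contra! h
  have h0 : Pb p {ω : Config d | Inf ω 0} = 0 := le_antisymm h (Pr_nonneg _ _)
  refine hp.not_ge (le_csSup ⟨1, fun x hx => hx.2.1⟩ ⟨p.2.1, p.2.2, fun Q hQ => ?_⟩)
  rw [isBernoulli_eq hQ]
  simp only [cluster_infinite_iff]
  simpa [Pr, Measure.real, ENNReal.toReal_eq_zero_iff] using h0

end Lattice

section Uniqueness
open Classical

lemma integral_prod_eq_one {ι : Type*} (q : ι → I) (r : ι → Bool → ℝ)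
    (hr : ∀ i, ∫ ω, r i (ω i) ∂(PM q) = 1) (S : Finset ι) :
    ∫ ω, ∏ i ∈ S, r i (ω i) ∂(PM q) = 1 := by
  induction S using Finset.induction_on with
  | empty => simp
  | insert i S hi ih =>
    simp only [Finset.prod_insert hi]
    rw [integral_mul_of_detBy (Set.finite_singleton i) S.finite_toSet ((detBy_eval i).comp (r i)) ?_
      (by simpa using hi), hr, ih, one_mul]
    intro ω ω' H
    exact Finset.prod_congr rfl fun j hj => by rw [H j hj]

/-- Change of measure along a self-determined random set of coordinates. -/
lemma integral_stopping {ι : Type*} (q : ι → I) (r : ι → Bool → ℝ)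
    (hr : ∀ i, ∫ ω, r i (ω i) ∂(PM q) = 1) (E : Finset ι) (A : (ι → Bool) → Finset ι)
    (hAE : ∀ ω, A ω ⊆ E) (hA : ∀ ω ω', (∀ i ∈ A ω, ω i = ω' i) → A ω' = A ω) :
    ∫ ω, ∏ i ∈ A ω, r i (ω i) ∂(PM q) = 1 := by
  have hprod : ∀ S : Finset ι, DetBy (S : Set ι) (fun ω : ι → Bool => ∏ i ∈ S, r i (ω i)) :=
    fun S ω ω' H => Finset.prod_congr rfl fun j hj => by rw [H j hj]
  have hAS : ∀ S : Finset ι, DetBy (S : Set ι) (fun ω => A ω = S) := fun S => by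
    rw [detBy_iff]
    rintro ω ω' H rfl
    exact hA ω ω' H
  have hind : ∀ S : Finset ι, DetBy (S : Set ι)
      (fun ω : ι → Bool => (if A ω = S then 1 else 0) * ∏ i ∈ S, r i (ω i)) := by
    intro S ω ω' H
    have h1 : (A ω = S) = (A ω' = S) := hAS S ω ω' H
    have h2 : ∏ i ∈ S, r i (ω i) = ∏ i ∈ S, r i (ω' i) := hprod S ω ω' H
    simp only [h1, h2]
  have hS : ∀ S ∈ E.powerset, ∫ ω, (if A ω = S then 1 else 0) * ∏ i ∈ S, r i (ω i) ∂(PM q) =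
      ∫ ω, (if A ω = S then 1 else 0) * ∏ i ∈ E, r i (ω i) ∂(PM q) := by
    intro S hS
    have h1 := integral_mul_of_detBy S.finite_toSet (E \ S).finite_toSet (hind S)
      (hprod (E \ S)) (by exact_mod_cast Finset.disjoint_sdiff) q
    rw [integral_prod_eq_one q r hr, mul_one] at h1
    rw [← h1]
    congr 1; ext ω
    rw [mul_assoc, mul_comm (∏ i ∈ S, _), Finset.prod_sdiff (Finset.mem_powerset.1 hS)]
  have hsum : ∀ f : Finset ι → (ι → Bool) → ℝ, ∀ ω,
      f (A ω) ω = ∑ S ∈ E.powerset, (if A ω = S then 1 else 0) * f S ω := by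
    intro f ω
    rw [Finset.sum_eq_single (A ω)]
    · simp
    · intro S _ hne; simp [hne.symm]
    · intro h; exact absurd (Finset.mem_powerset.2 (hAE ω)) h
  rw [← integral_prod_eq_one q r hr E]
  calc _ = ∫ ω, ∑ S ∈ E.powerset, (if A ω = S then 1 else 0) * ∏ i ∈ S, r i (ω i) ∂(PM q) := by
        congr 1; ext ω; exact hsum (fun S ω => ∏ i ∈ S, r i (ω i)) ω
    _ = ∑ S ∈ E.powerset, ∫ ω, (if A ω = S then 1 else 0) * ∏ i ∈ E, r i (ω i) ∂(PM q) := by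
        rw [integral_finsetSum _ fun S _ => (hind S).integrable S.finite_toSet q]
        exact Finset.sum_congr rfl hS
    _ = ∫ ω, ∑ S ∈ E.powerset, (if A ω = S then 1 else 0) * ∏ i ∈ E, r i (ω i) ∂(PM q) := by
        rw [integral_finsetSum _ fun S hS => ?_]
        refine DetBy.integrable E.finite_toSet ?_ q
        intro ω ω' H
        have h1 : (A ω = S) = (A ω' = S) :=
          hAS S ω ω' fun i hi => H i (Finset.mem_powerset.1 hS hi)
        have h2 : ∏ i ∈ E, r i (ω i) = ∏ i ∈ E, r i (ω' i) := hprod E ω ω' H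
        simp only [h1, h2]
    _ = _ := by
        congr 1; ext ω; exact (hsum (fun S ω => ∏ i ∈ E, r i (ω i)) ω).symm

lemma integral_bool {ι : Type*} (q : ι → I) (i : ι) (f : Bool → ℝ) :
    ∫ ω, f (ω i) ∂(PM q) = q i * f true + (1 - q i) * f false := by
  have h : ∀ ω : ι → Bool, f (ω i) = f true * Set.indicator {ω | ω i = true} 1 ω +
      f false * Set.indicator {ω | ω i = false} 1 ω := by
    intro ω
    cases h : ω i <;> simp [Set.indicator, h]
  have hm : ∀ b, MeasurableSet {ω : ι → Bool | ω i = b} := fun b =>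
    ((detBy_eval i).comp (· = b)).measurableSet (Set.finite_singleton i)
  have h1 : (PM q).real {ω : ι → Bool | ω i = true} = q i := Pr_true q i
  have h2 : (PM q).real {ω : ι → Bool | ω i = false} = 1 - q i :=
    (by simpa using Pr_all_false q {i} : Pr q {ω | ω i = false} = 1 - q i)
  simp_rw [h]
  rw [integral_add, integral_const_mul, integral_const_mul, integral_indicator_one (hm _),
    integral_indicator_one (hm _), h1, h2]
  · ring
  all_goals
    exact ((integrable_const (1 : ℝ)).indicator (hm _)).const_mul _

variable {d : ℕ}

/-- The lattice edges inside a box. -/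
noncomputable def boxE (d : ℕ) (n : ℕ) : Finset (Sym2 (Zd d)) :=
  (((ball_finite (0 : Zd d) n).toFinset ×ˢ (Finset.univ : Finset (Fin d))).image
    fun x => s(x.1, x.1 + ee x.2)).filter fun e => e ∈ edgesIn (ball (0 : Zd d) n)

lemma mem_boxE {n : ℕ} {x y : Zd d} :
    s(x, y) ∈ boxE d n ↔ latAdj x y ∧ x ∈ ball (0 : Zd d) n ∧ y ∈ ball (0 : Zd d) n := by
  simp only [boxE, Finset.mem_filter, Finset.mem_image, Finset.mem_product, Set.Finite.mem_toFinset,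
    Finset.mem_univ, and_true, mk_mem_edgesIn, Prod.exists]
  constructor
  · rintro ⟨⟨a, i, ha, h⟩, h'⟩
    refine ⟨?_, h'⟩
    rcases Sym2.eq_iff.1 h with ⟨rfl, rfl⟩ | ⟨rfl, rfl⟩
    · exact latAdj_add _ _
    · exact latAdj_comm.1 (latAdj_add _ _)
  · rintro ⟨h, hx, hy⟩
    refine ⟨?_, hx, hy⟩
    obtain ⟨i, rfl | rfl⟩ := latAdj_iff.1 h
    · exact ⟨x, i, hx, rfl⟩
    · exact ⟨y, i, hy, Sym2.eq_swap⟩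

lemma card_ball (d n : ℕ) : (ball_finite (0 : Zd d) n).toFinset.card = (2 * n + 1) ^ d := by
  have : (ball_finite (0 : Zd d) n).toFinset =
      Finset.Icc (fun _ : Fin d => -(n : ℤ)) (fun _ => (n : ℤ)) := by
    ext y
    rw [Set.Finite.mem_toFinset, ball_eq_Icc]
    simp [Pi.le_def]
  rw [this, Pi.card_Icc]
  simp only [Int.card_Icc, Finset.prod_const, Finset.card_univ, Fintype.card_fin]
  congr 1
  omega

lemma card_boxE (d n : ℕ) : (boxE d n).card ≤ d * (2 * n + 1) ^ d := by
  refine (Finset.card_filter_le _ _).trans (Finset.card_image_le.trans ?_)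
  rw [Finset.card_product, card_ball, Finset.card_univ, Fintype.card_fin, mul_comm]

/-- The cluster of `x` in the box. -/
noncomputable def cl (n : ℕ) (x : Zd d) (ω : Config d) : Finset (Zd d) :=
  (ball_finite (0 : Zd d) n).toFinset.filter fun y => Conn ω (ball 0 n) x y

lemma mem_cl {n : ℕ} {x y : Zd d} {ω : Config d} : y ∈ cl n x ω ↔ Conn ω (ball 0 n) x y := by
  simp only [cl, Finset.mem_filter, Set.Finite.mem_toFinset, and_iff_right_iff_imp]
  exact fun h => h.right

/-- Edges of the box touching a set of vertices. -/
noncomputable def touch (n : ℕ) (C : Finset (Zd d)) : Finset (Sym2 (Zd d)) :=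
  (boxE d n).filter fun e => ∃ a ∈ e, a ∈ C

lemma touch_self_det (n : ℕ) (x : Zd d) (ω ω' : Config d)
    (h : ∀ e ∈ touch n (cl n x ω), ω e = ω' e) : touch n (cl n x ω') = touch n (cl n x ω) := by
  congr 1
  ext y
  rw [mem_cl, mem_cl]
  constructor
  · intro hy
    refine hy.induct (P := fun y => Conn ω (ball 0 n) x y) (.refl hy.left) ?_
    intro a b hxa hab hb ha
    refine ha.trans (.of_adj ⟨hab.1, ?_⟩ ha.right hb)
    rw [h, hab.2]
    exact Finset.mem_filter.2 ⟨mem_boxE.2 ⟨hab.1, ha.right, hb⟩, a, by simp, mem_cl.2 ha⟩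
  · intro hy
    refine hy.induct (P := fun y => Conn ω' (ball 0 n) x y) (.refl hy.left) ?_
    intro a b hxa hab hb ha
    refine ha.trans (.of_adj ⟨hab.1, ?_⟩ ha.right hb)
    rw [← h, hab.2]
    exact Finset.mem_filter.2 ⟨mem_boxE.2 ⟨hab.1, ha.right, hb⟩, a, by simp, mem_cl.2 hxa⟩

/-- The edge `e` touches a cluster of the box reaching the boundary. -/
def bTouch (n : ℕ) (e : Sym2 (Zd d)) (ω : Config d) : Prop :=
  ∃ a ∈ e, CT ω (ball 0 n) a (sph 0 n)

lemma bTouch_det (n : ℕ) (e : Sym2 (Zd d)) :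
    DetBy (edgesIn (ball 0 n) \ {e}) (bTouch n e) := by
  rw [detBy_iff]
  rintro ω ω' H ⟨a, ha, y, hy, hc⟩
  by_cases hye : y ∈ e
  · exact ⟨y, hye, y, hy, .refl hc.right⟩
  · obtain ⟨u, v, hu, hue, huv, hv⟩ := hc.last_exit (K := {z | z ∈ e}) ha hye
    refine ⟨u, hue, y, hy, ?_⟩
    have h1 : ∀ z w : Zd d, z ∈ ball 0 n → w ∈ ball 0 n → w ∉ e → openAdj ω z w → openAdj ω' z w := by
      intro z w hz hw hwe h
      refine ⟨h.1, ?_⟩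
      rw [← H _ ⟨mk_mem_edgesIn.2 ⟨hz, hw⟩, ?_⟩, h.2]
      rintro rfl
      simp at hwe
    refine Conn.trans (.of_adj (h1 u v hu hv.left.1 hv.left.2 huv) hu hv.left.1) ?_
    refine hv.induct (P := fun y => Conn ω' (ball 0 n) v y) (.refl hv.left.1) ?_
    intro a b hva hab hb ha
    exact ha.trans (.of_adj (h1 _ _ ha.right hb.1 hb.2 hab) ha.right hb.1)

/-- Closed-edge count: both ends reach the boundary, in distinct clusters. -/
def sepE (n : ℕ) (e : Sym2 (Zd d)) (ω : Config d) : Prop :=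
  ∃ a b, e = s(a, b) ∧ CT ω (ball 0 n) a (sph 0 n) ∧ CT ω (ball 0 n) b (sph 0 n) ∧
    ¬ Conn ω (ball 0 n) a b

lemma detBy_sepE (n : ℕ) (e : Sym2 (Zd d)) : DetBy (edgesIn (ball 0 n)) (sepE n e) := by
  unfold sepE
  exact .exists fun a => .exists fun b => (detBy_const _ _).and
    ((detBy_CT _ _ _).and ((detBy_CT _ _ _).and (detBy_conn _ _ _).not))

/-- The deterministic comparison behind the Aizenman-Kesten-Newman argument. -/
lemma akn_pointwise {p : ℝ} (hp : 0 ≤ p) (n : ℕ) (ω : Config d) {lam φ : ℝ} (hl : 0 < lam)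
    (hφ0 : 0 < φ) (hφ : φ ≤ Real.exp (lam ^ 2)) :
    ∑ e ∈ boxE d n, (if bTouch n e ω then (p - if ω e then 1 else 0) else 0) +
      p * ∑ e ∈ boxE d n, (if sepE n e ω then 1 else 0) ≤
    2 * lam * (boxE d n).card + lam⁻¹ * ∑ x ∈ ((ball_finite (0 : Zd d) n).toFinset.filter
      fun x => x ∈ sph 0 n), ∏ e ∈ touch n (cl n x ω),
        (Real.exp (lam * (p - if ω e then 1 else 0)) / φ) := by
  set S := (ball_finite (0 : Zd d) n).toFinset.filter fun x => x ∈ sph 0 n with hS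
  have hmS : ∀ x, x ∈ S ↔ x ∈ sph 0 n := fun x => by
    simp only [hS, Finset.mem_filter, Set.Finite.mem_toFinset, and_iff_right_iff_imp]
    exact fun h => h.1
  set CC := S.image (fun x => cl n x ω) with hCC
  have hCCmem : ∀ C ∈ CC, ∀ a ∈ C, CT ω (ball 0 n) a (sph 0 n) ∧ cl n a ω = C := by
    intro C hC a ha
    obtain ⟨x, hx, rfl⟩ := Finset.mem_image.1 hC
    have h := mem_cl.1 ha
    refine ⟨⟨x, (hmS x).1 hx, h.symm⟩, ?_⟩
    ext y
    rw [mem_cl, mem_cl]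
    exact ⟨h.trans, h.symm.trans⟩
  have hCT : ∀ a, CT ω (ball 0 n) a (sph 0 n) → cl n a ω ∈ CC ∧ a ∈ cl n a ω := by
    rintro a ⟨y, hy, h⟩
    refine ⟨Finset.mem_image.2 ⟨y, (hmS y).2 hy, ?_⟩, mem_cl.2 (.refl h.left)⟩
    ext z
    rw [mem_cl, mem_cl]
    exact ⟨h.trans, h.symm.trans⟩
  set Y : Sym2 (Zd d) → ℝ := fun e => p - if ω e then 1 else 0 with hY
  set N : Sym2 (Zd d) → ℕ := fun e => (CC.filter fun C => e ∈ touch n C).card with hN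
  have hcomm : ∀ f : Sym2 (Zd d) → ℝ,
      ∑ C ∈ CC, ∑ e ∈ touch n C, f e = ∑ e ∈ boxE d n, N e * f e := by
    intro f
    have h1 : ∀ C ∈ CC, ∑ e ∈ touch n C, f e =
        ∑ e ∈ boxE d n, if e ∈ touch n C then f e else 0 := by
      intro C _
      rw [← Finset.sum_filter]
      congr 1
      ext e; simp [touch]
    rw [Finset.sum_congr rfl h1, Finset.sum_comm]
    refine Finset.sum_congr rfl fun e _ => ?_
    rw [← Finset.sum_filter, Finset.sum_const, nsmul_eq_mul]
  have hfil : ∀ x y : Zd d, CC.filter (fun C => s(x, y) ∈ touch n C) ⊆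
      {cl n x ω, cl n y ω} := by
    intro x y C hC
    rw [Finset.mem_filter, touch, Finset.mem_filter] at hC
    obtain ⟨hC, -, a, ha, haC⟩ := hC
    have := (hCCmem C hC a haC).2
    rw [Sym2.mem_iff] at ha
    rcases ha with rfl | rfl <;> simp [this]
  have hN2 : ∀ e ∈ boxE d n, N e ≤ 2 := by
    intro e _
    induction e using Sym2.ind with
    | _ x y => exact (Finset.card_le_card (hfil x y)).trans Finset.card_le_two
  have hlow : ∀ e ∈ boxE d n, (if bTouch n e ω then Y e else 0) + p * (if sepE n e ω then 1 else 0) ≤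
      N e * Y e := by
    intro e he
    have hb : bTouch n e ω → 1 ≤ N e := by
      rintro ⟨a, ha, hc⟩
      refine Finset.card_pos.2 ⟨cl n a ω, Finset.mem_filter.2 ⟨(hCT a hc).1, ?_⟩⟩
      exact Finset.mem_filter.2 ⟨he, a, ha, (hCT a hc).2⟩
    have hb' : ¬ bTouch n e ω → N e = 0 := by
      intro h
      refine Finset.card_eq_zero.2 (Finset.filter_eq_empty_iff.2 fun C hC hC' => h ?_)
      obtain ⟨-, a, ha, haC⟩ := Finset.mem_filter.1 hC'
      exact ⟨a, ha, (hCCmem C hC a haC).1⟩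
    have hs : sepE n e ω → 2 ≤ N e ∧ bTouch n e ω := by
      rintro ⟨a, b, rfl, ha, hb, hab⟩
      refine ⟨?_, a, by simp, ha⟩
      have hne : cl n a ω ≠ cl n b ω := by
        intro h
        have := (hCT b hb).2
        rw [← h] at this
        exact hab (mem_cl.1 this)
      rw [← Finset.card_pair hne]
      refine Finset.card_le_card ?_
      intro C hC
      rw [Finset.mem_insert, Finset.mem_singleton] at hC
      rcases hC with rfl | rfl
      · exact Finset.mem_filter.2 ⟨(hCT a ha).1,
          Finset.mem_filter.2 ⟨he, a, by simp, (hCT a ha).2⟩⟩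
      · exact Finset.mem_filter.2 ⟨(hCT b hb).1,
          Finset.mem_filter.2 ⟨he, b, by simp, (hCT b hb).2⟩⟩
    have hop : 2 ≤ N e → ω e = false := by
      intro h2
      by_contra hω
      rw [Bool.not_eq_false] at hω
      induction e using Sym2.ind with
      | _ x y =>
        have hxy := mem_boxE.1 he
        have hc : Conn ω (ball 0 n) x y := .of_adj ⟨hxy.1, hω⟩ hxy.2.1 hxy.2.2
        have : cl n x ω = cl n y ω := by
          ext z
          rw [mem_cl, mem_cl]
          exact ⟨hc.symm.trans, hc.trans⟩
        have h3 := Finset.card_le_card (hfil x y)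
        rw [this] at h3
        simp only [Finset.pair_eq_singleton, Finset.card_singleton] at h3
        have : N s(x, y) ≤ 1 := h3
        omega
    by_cases hbt : bTouch n e ω
    · by_cases hse : sepE n e ω
      · have h2 := (hs hse).1
        have hω := hop h2
        have h2' : (2 : ℝ) ≤ N e := by exact_mod_cast h2
        simp only [hbt, hse, if_true, hY, hω]
        simp only [Bool.false_eq_true, if_false]
        nlinarith
      · simp only [hbt, hse, if_true, if_false, mul_zero, add_zero]
        by_cases h2 : 2 ≤ N e
        · have hω := hop h2
          have h2' : (2 : ℝ) ≤ N e := by exact_mod_cast h2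
          simp only [hY, hω, Bool.false_eq_true, if_false]
          nlinarith
        · have : N e = 1 := by have := hb hbt; omega
          simp [this]
    · have hse : ¬ sepE n e ω := fun h => hbt (hs h).2
      simp [hbt, hse, hb' hbt]
  have hup : ∀ C ∈ CC, ∑ e ∈ touch n C, Y e ≤
      lam * (touch n C).card + lam⁻¹ * ∏ e ∈ touch n C, (Real.exp (lam * Y e) / φ) := by
    intro C _
    have h1 : Real.exp (lam * ∑ e ∈ touch n C, Y e - lam ^ 2 * (touch n C).card) ≤
        ∏ e ∈ touch n C, (Real.exp (lam * Y e) / φ) := by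
      rw [Finset.prod_div_distrib, Finset.prod_const, ← Real.exp_sum, Real.exp_sub,
        ← Finset.mul_sum]
      gcongr
      calc φ ^ (touch n C).card ≤ (Real.exp (lam ^ 2)) ^ (touch n C).card := by gcongr
        _ = _ := by rw [← Real.exp_nat_mul, mul_comm]
    have h2 := (Real.add_one_le_exp _).trans h1
    have h3 : lam * ∑ e ∈ touch n C, Y e ≤ lam * (lam * (touch n C).card +
        lam⁻¹ * ∏ e ∈ touch n C, (Real.exp (lam * Y e) / φ)) := by
      rw [mul_add, ← mul_assoc lam lam⁻¹, mul_inv_cancel₀ hl.ne']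
      nlinarith
    exact le_of_mul_le_mul_left h3 hl
  calc _ = ∑ e ∈ boxE d n, ((if bTouch n e ω then Y e else 0) +
        p * (if sepE n e ω then 1 else 0)) := by
        rw [Finset.sum_add_distrib, Finset.mul_sum]
    _ ≤ ∑ e ∈ boxE d n, N e * Y e := Finset.sum_le_sum hlow
    _ = ∑ C ∈ CC, ∑ e ∈ touch n C, Y e := (hcomm Y).symm
    _ ≤ ∑ C ∈ CC, (lam * (touch n C).card + lam⁻¹ * ∏ e ∈ touch n C, (Real.exp (lam * Y e) / φ)) :=
        Finset.sum_le_sum hup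
    _ = lam * ∑ C ∈ CC, ((touch n C).card : ℝ) +
        lam⁻¹ * ∑ C ∈ CC, ∏ e ∈ touch n C, (Real.exp (lam * Y e) / φ) := by
        rw [Finset.sum_add_distrib, Finset.mul_sum, Finset.mul_sum]
    _ ≤ _ := by
        have h1 : ∑ C ∈ CC, ((touch n C).card : ℝ) ≤ 2 * (boxE d n).card := by
          have := hcomm (fun _ => 1)
          simp only [Finset.sum_const, nsmul_eq_mul, mul_one] at this
          rw [this]
          calc ∑ e ∈ boxE d n, (N e : ℝ) ≤ ∑ e ∈ boxE d n, (2 : ℝ) :=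
                Finset.sum_le_sum fun e he => by exact_mod_cast hN2 e he
            _ = _ := by simp [mul_comm]
        have h2 : ∑ C ∈ CC, ∏ e ∈ touch n C, (Real.exp (lam * Y e) / φ) ≤
            ∑ x ∈ S, ∏ e ∈ touch n (cl n x ω), (Real.exp (lam * Y e) / φ) :=
          Finset.sum_image_le_of_nonneg fun C _ => Finset.prod_nonneg fun e _ => by positivity
        have h3 := mul_le_mul_of_nonneg_left h1 hl.le
        have h4 := mul_le_mul_of_nonneg_left h2 (inv_pos.2 hl).le
        linarith

end Uniqueness

section Uniqueness
open Classical
variable {d : ℕ}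

lemma mgf_le (p : I) {lam : ℝ} (hl : 0 < lam) (hl1 : lam ≤ 1) :
    (p : ℝ) * Real.exp (lam * (p - 1)) + (1 - p) * Real.exp (lam * p) ≤ Real.exp (lam ^ 2) := by
  have hp0 := p.2.1
  have hp1 := p.2.2
  have h1 := Real.abs_exp_sub_one_sub_id_le (x := lam * (p - 1)) (by
    rw [abs_le]; constructor <;> nlinarith)
  have h2 := Real.abs_exp_sub_one_sub_id_le (x := lam * p) (by
    rw [abs_le]; constructor <;> nlinarith)
  have h1 := (abs_le.1 h1).2
  have h2 := (abs_le.1 h2).2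
  have h3 := Real.add_one_le_exp (lam ^ 2)
  have h4 := mul_le_mul_of_nonneg_left (sub_le_iff_le_add.1 h1) hp0
  have h5 := mul_le_mul_of_nonneg_left (sub_le_iff_le_add.1 h2) (sub_nonneg.2 hp1)
  nlinarith [mul_nonneg (sq_nonneg lam) (mul_nonneg hp0 (sub_nonneg.2 hp1)), sq_nonneg lam,
    mul_nonneg (sq_nonneg lam) (sq_nonneg ((p : ℝ) - 1 / 2)), mul_nonneg hp0 (sub_nonneg.2 hp1)]

lemma akn_sum (p : I) (n : ℕ) {lam : ℝ} (hl : 0 < lam) (hl1 : lam ≤ 1) :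
    (p : ℝ) * ∑ e ∈ boxE d n, Pb p {ω | sepE n e ω} ≤
    2 * lam * (boxE d n).card + lam⁻¹ * ((ball_finite (0 : Zd d) n).toFinset.filter
      fun x => x ∈ sph 0 n).card := by
  set S := (ball_finite (0 : Zd d) n).toFinset.filter fun x => x ∈ sph 0 n with hS
  set φ : ℝ := p * Real.exp (lam * (p - 1)) + (1 - p) * Real.exp (lam * p) with hφ
  have hp0 := p.2.1
  have hp1 := p.2.2
  have hφ0 : 0 < φ := by
    have h1 := Real.exp_pos (lam * (p - 1))
    have h2 := Real.exp_pos (lam * p)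
    rcases hp0.eq_or_lt with h | h
    · rw [hφ, ← h]; simp
    · have := mul_nonneg (sub_nonneg.2 hp1) h2.le
      have := mul_pos h h1
      linarith
  set r : Sym2 (Zd d) → Bool → ℝ := fun _ b => Real.exp (lam * (p - if b then 1 else 0)) / φ with hr
  have hr1 : ∀ e, ∫ ω, r e (ω e) ∂(PP d p) = 1 := by
    intro e
    rw [integral_bool (fun _ => p) e (r e)]
    simp only [hr, if_true, Bool.false_eq_true, if_false, sub_zero]
    rw [← mul_div_assoc, ← mul_div_assoc, ← add_div, div_self hφ0.ne']
  have hfin := edgesIn_finite (ball_finite (0 : Zd d) n)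
  have hbE : ∀ e ∈ boxE d n, e ∈ edgesIn (ball (0 : Zd d) n) := fun e he =>
    (Finset.mem_filter.1 he).2
  have d1 : ∀ e ∈ boxE d n, DetBy (edgesIn (ball (0 : Zd d) n))
      (fun ω => if bTouch n e ω then ((p : ℝ) - if ω e then 1 else 0) else 0) := by
    intro e he ω ω' H
    have h1 : bTouch n e ω = bTouch n e ω' := bTouch_det n e ω ω' fun i hi => H i hi.1
    simp only [h1, H e (hbE e he)]
  have d2 : ∀ e ∈ boxE d n, DetBy (edgesIn (ball (0 : Zd d) n))
      (fun ω => if sepE n e ω then (1 : ℝ) else 0) := fun e _ =>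
    (detBy_sepE n e).comp fun P => if P then (1 : ℝ) else 0
  have d3 : ∀ x ∈ S, DetBy (edgesIn (ball (0 : Zd d) n))
      (fun ω => ∏ e ∈ touch n (cl n x ω), r e (ω e)) := by
    intro x _ ω ω' H
    have h1 := touch_self_det n x ω ω' fun e he => H e (hbE e (Finset.mem_filter.1 he).1)
    simp only [h1]
    exact Finset.prod_congr rfl fun e he => by rw [H e (hbE e (Finset.mem_filter.1 he).1)]
  have e1 : ∀ e ∈ boxE d n,
      ∫ ω, (if bTouch n e ω then ((p : ℝ) - if ω e then 1 else 0) else 0) ∂(PP d p) = 0 := by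
    intro e _
    have h := integral_mul_of_detBy (f := fun ω => if bTouch n e ω then (1 : ℝ) else 0)
      (g := fun ω => (p : ℝ) - if ω e then 1 else 0)
      (hfin.subset Set.sdiff_subset) (Set.finite_singleton e)
      ((bTouch_det n e).comp fun P => if P then (1 : ℝ) else 0)
      ((detBy_eval e).comp fun b => (p : ℝ) - if b then 1 else 0) Set.disjoint_sdiff_left
      (fun _ => p)
    rw [integral_bool (fun _ => p) e fun b => (p : ℝ) - if b then 1 else 0] at h
    calc _ = ∫ ω, (if bTouch n e ω then (1 : ℝ) else 0) * ((p : ℝ) - if ω e then 1 else 0)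
          ∂(PP d p) := by
          congr 1; ext ω; split_ifs <;> simp
      _ = 0 := by
          rw [h]
          convert mul_zero _
          simp; ring
  have e2 : ∀ e ∈ boxE d n, ∫ ω, (if sepE n e ω then (1 : ℝ) else 0) ∂(PP d p) =
      Pb p {ω | sepE n e ω} := by
    intro e _
    change _ = (PM fun _ => p).real {ω | sepE n e ω}
    rw [← integral_indicator_one ((detBy_sepE n e).measurableSet hfin)]
    congr 1
  have e3 : ∀ x ∈ S, ∫ ω, ∏ e ∈ touch n (cl n x ω), r e (ω e) ∂(PP d p) = 1 := by
    intro x _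
    exact integral_stopping _ r hr1 (boxE d n) (fun ω => touch n (cl n x ω))
      (fun ω => Finset.filter_subset _ _) fun ω ω' h => touch_self_det n x ω ω' h
  have i1 := fun e he => (d1 e he).integrable hfin (fun _ => p)
  have i2 := fun e he => (d2 e he).integrable hfin (fun _ => p)
  have i3 := fun x hx => (d3 x hx).integrable hfin (fun _ => p)
  have h := integral_mono (μ := PP d p)
    ((integrable_finsetSum _ i1).add ((integrable_finsetSum _ i2).const_mul (p : ℝ)))
    ((integrable_const (2 * lam * (boxE d n).card)).add
      ((integrable_finsetSum _ i3).const_mul lam⁻¹))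
    (fun ω => akn_pointwise hp0 n ω hl hφ0 (mgf_le p hl hl1))
  simp only [Pi.add_apply] at h
  rw [integral_add (integrable_finsetSum _ i1) ((integrable_finsetSum _ i2).const_mul (p : ℝ)),
    integral_add (integrable_const _) ((integrable_finsetSum _ i3).const_mul lam⁻¹),
    integral_const_mul, integral_const_mul, integral_const_mul, integral_finsetSum _ i1, integral_finsetSum _ i2,
    integral_finsetSum _ i3, Finset.sum_congr rfl e1, Finset.sum_congr rfl e2,
    Finset.sum_congr rfl e3] at h
  simpa using h

/-- Both vertices lie in infinite clusters, and these are distinct. -/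
def Sep (ω : Config d) (x y : Zd d) : Prop := Inf ω x ∧ Inf ω y ∧ ¬ Conn ω Set.univ x y

lemma measurableSet_sep (x y : Zd d) : MeasurableSet {ω : Config d | Sep ω x y} :=
  (measurableSet_inf x).inter ((measurableSet_inf y).inter (measurableSet_conn x y).compl)

lemma inf_pull {φ : Zd d ≃ Zd d} (hφ : IsAut φ) {ω : Config d} {x : Zd d} :
    Inf (pull φ ω) x ↔ Inf ω (φ x) := by
  rw [inf_iff, inf_iff]
  have : {y | Conn ω Set.univ (φ x) y} = φ '' {y | Conn (pull φ ω) Set.univ x y} := by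
    ext y
    simp only [Set.mem_ofPred_eq, Set.mem_image, conn_pull hφ, Set.image_univ, φ.range_eq_univ]
    constructor
    · intro h; exact ⟨φ.symm y, by simpa using h, by simp⟩
    · rintro ⟨z, h, rfl⟩; exact h
  rw [this, Set.infinite_image_iff φ.injective.injOn]

lemma Pb_sep_tr (p : I) (a x y : Zd d) :
    Pb p {ω | Sep ω (x + a) (y + a)} = Pb p {ω | Sep ω x y} := by
  rw [← Pb_pull p (tr a) (measurableSet_sep x y)]
  congr 1
  ext ω
  simp [Sep, inf_pull (isAut_tr a), conn_pull (isAut_tr a), Set.image_univ, (tr a).range_eq_univ]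

lemma Pb_inf (p : I) (x : Zd d) : Pb p {ω | Inf ω x} = Pb p {ω | Inf ω (0 : Zd d)} := by
  rw [← Pb_pull p (tr x) (measurableSet_inf 0)]
  congr 1
  ext ω
  simp [inf_pull (isAut_tr x)]

lemma Inf.CT_ball {ω : Config d} {x : Zd d} (h : Inf ω x) {c : Zd d} {n : ℤ} (hx : x ∈ ball c n) :
    CT ω (ball c n) x (sph c n) := by
  rw [inf_iff] at h
  obtain ⟨y, hy, hyn⟩ := h.exists_notMem_finite (ball_finite c n)
  exact Conn.CT_sph hy hx (far_anti c (by linarith) (not_mem_ball.1 hyn))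

lemma sep_sum (p : I) (i : Fin d) (m : ℕ) :
    (2 * m + 1 : ℝ) ^ d * Pb p {ω : Config d | Sep ω 0 (ee i)} ≤
      ∑ e ∈ boxE d (m + 1), Pb p {ω | sepE (m + 1) e ω} := by
  set B := (ball_finite (0 : Zd d) m).toFinset with hB
  have hinj : Set.InjOn (fun x : Zd d => s(x, x + ee i)) B := by
    intro x _ y _ h
    rcases Sym2.eq_iff.1 h with ⟨h, -⟩ | ⟨h1, h2⟩
    · exact h
    · exfalso
      have h1 := congrFun h1 i
      have h2 := congrFun h2 i
      simp [ee] at h1 h2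
      omega
  have hb : ∀ x ∈ B, x ∈ ball (0 : Zd d) m := fun x hx => by simpa [hB] using hx
  have hm1 : ∀ x ∈ B, x ∈ ball (0 : Zd d) (m + 1 : ℕ) ∧ x + ee i ∈ ball (0 : Zd d) (m + 1 : ℕ) := by
    intro x hx
    have := hb x hx
    refine ⟨ball_mono _ (by push_cast; linarith) this, ?_⟩
    refine ball_subset_ball this (by push_cast; linarith : (1 : ℤ) + m ≤ (m + 1 : ℕ)) ?_
    intro j
    have := (latAdj_add x i).abs_le j
    rwa [abs_sub_comm] at this
  calc _ = ∑ x ∈ B, Pb p {ω : Config d | Sep ω 0 (ee i)} := by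
        rw [Finset.sum_const, hB, card_ball, nsmul_eq_mul]; push_cast; ring
    _ ≤ ∑ x ∈ B, Pb p {ω | sepE (m + 1) s(x, x + ee i) ω} := by
        refine Finset.sum_le_sum fun x hx => ?_
        rw [← Pb_sep_tr p x]
        refine Pr_mono _ fun ω h => ?_
        obtain ⟨h1, h2, h3⟩ := h
        rw [zero_add] at h1 h3
        rw [add_comm] at h2 h3
        exact ⟨x, x + ee i, rfl, h1.CT_ball (hm1 x hx).1, h2.CT_ball (hm1 x hx).2,
          fun h => h3 (h.mono (Set.subset_univ _))⟩
    _ = ∑ e ∈ B.image fun x => s(x, x + ee i), Pb p {ω | sepE (m + 1) e ω} := by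
        rw [Finset.sum_image hinj]
    _ ≤ _ := by
        refine Finset.sum_le_sum_of_subset_of_nonneg ?_ fun _ _ _ => Pr_nonneg _ _
        intro e he
        obtain ⟨x, hx, rfl⟩ := Finset.mem_image.1 he
        exact mem_boxE.2 ⟨latAdj_add x i, hm1 x hx⟩

lemma card_sph (d m : ℕ) : (((ball_finite (0 : Zd d) (m + 1 : ℕ)).toFinset.filter
      fun x => x ∈ sph 0 (m + 1 : ℕ)).card : ℝ) ≤ (2 * m + 3) ^ d - (2 * m + 1) ^ d := by
  have h : ((ball_finite (0 : Zd d) (m + 1 : ℕ)).toFinset.filter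
      fun x => x ∈ sph 0 (m + 1 : ℕ)).card + (ball_finite (0 : Zd d) m).toFinset.card ≤
      (ball_finite (0 : Zd d) (m + 1 : ℕ)).toFinset.card := by
    rw [← Finset.card_union_of_disjoint]
    · refine Finset.card_le_card (Finset.union_subset (Finset.filter_subset _ _) ?_)
      intro x; simp only [Set.Finite.mem_toFinset]
      exact fun h => ball_mono _ (by push_cast; linarith) h
    · rw [Finset.disjoint_left]
      intro x hx hx'
      rw [Set.Finite.mem_toFinset] at hx'
      have := (Finset.mem_filter.1 hx).2.2
      exact not_mem_ball.2 (by push_cast at this; exact this) hx'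
  rw [card_ball, card_ball] at h
  generalize ((ball_finite (0 : Zd d) (m + 1 : ℕ)).toFinset.filter
      fun x => x ∈ sph 0 (m + 1 : ℕ)).card = k at h ⊢
  have h' : ((k + (2 * m + 1) ^ d : ℕ) : ℝ) ≤
      ((2 * (m + 1) + 1) ^ d : ℕ) := by exact_mod_cast h
  push_cast at h'
  rw [show (2 * ((m : ℝ) + 1) + 1) = 2 * m + 3 by ring] at h'
  linarith

lemma Pb_sep_edge {p : I} (hp : 0 < (p : ℝ)) (i : Fin d) :
    Pb p {ω : Config d | Sep ω 0 (ee i)} = 0 := by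
  set q := Pb p {ω : Config d | Sep ω 0 (ee i)} with hq
  have hq0 : 0 ≤ q := Pr_nonneg _ _
  have key : ∀ lam : ℝ, 0 < lam → lam ≤ 1 → ∀ m : ℕ,
      p * q ≤ 2 * lam * d * ((2 * m + 3) / (2 * m + 1)) ^ d +
        lam⁻¹ * (((2 * m + 3) / (2 * m + 1)) ^ d - 1) := by
    intro lam hl hl1 m
    have h1 := (mul_le_mul_of_nonneg_left (sep_sum p i m) hp.le).trans (akn_sum p (m + 1) hl hl1)
    have h2 : ((boxE d (m + 1)).card : ℝ) ≤ d * (2 * m + 3) ^ d := by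
      have : ((boxE d (m + 1)).card : ℝ) ≤ (d * (2 * (m + 1) + 1) ^ d : ℕ) := by
        exact_mod_cast card_boxE d (m + 1)
      push_cast at this
      rwa [show (2 * ((m : ℝ) + 1) + 1) = 2 * m + 3 by ring] at this
    have h3 := mul_le_mul_of_nonneg_left (card_sph d m) (inv_pos.2 hl).le
    have h4 := mul_le_mul_of_nonneg_left h2 (by positivity : 0 ≤ 2 * lam)
    have hD : (0 : ℝ) < (2 * m + 1) ^ d := by positivity
    rw [← mul_le_mul_iff_right₀ hD]
    calc (2 * (m : ℝ) + 1) ^ d * (p * q) = p * ((2 * m + 1) ^ d * q) := by ring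
      _ ≤ 2 * lam * (d * (2 * m + 3) ^ d) + lam⁻¹ * ((2 * m + 3) ^ d - (2 * m + 1) ^ d) := by
        linarith
      _ = _ := by rw [div_pow]; field_simp
  have hlim : Filter.Tendsto (fun m : ℕ => ((2 * m + 3 : ℝ) / (2 * m + 1)) ^ d) Filter.atTop
      (nhds 1) := by
    have h1 : Filter.Tendsto (fun m : ℕ => 1 + 2 / (2 * (m : ℝ) + 1)) Filter.atTop
        (nhds (1 + 0)) := by
      refine tendsto_const_nhds.add (tendsto_const_nhds.div_atTop ?_)
      refine Filter.tendsto_atTop_add_const_right _ _ ?_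
      exact tendsto_natCast_atTop_atTop.const_mul_atTop (by norm_num)
    have h2 := h1.pow d
    simp only [add_zero, one_pow] at h2
    refine h2.congr fun m => ?_
    congr 1
    field_simp
    ring
  have key2 : ∀ lam : ℝ, 0 < lam → lam ≤ 1 → p * q ≤ 2 * lam * d := by
    intro lam hl hl1
    have h1 : Filter.Tendsto (fun m : ℕ => 2 * lam * d * ((2 * m + 3 : ℝ) / (2 * m + 1)) ^ d +
        lam⁻¹ * (((2 * m + 3 : ℝ) / (2 * m + 1)) ^ d - 1)) Filter.atTop
        (nhds (2 * lam * d * 1 + lam⁻¹ * (1 - 1))) :=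
      (hlim.const_mul _).add ((hlim.sub_const 1).const_mul _)
    simp only [sub_self, mul_zero, add_zero, mul_one] at h1
    exact ge_of_tendsto' h1 (key lam hl hl1)
  have key3 : p * q ≤ 0 := by
    have h1 : Filter.Tendsto (fun lam : ℝ => 2 * lam * d) (nhdsWithin 0 (Set.Ioi 0))
        (nhds (2 * 0 * d)) := by
      have : Continuous fun lam : ℝ => 2 * lam * d := by fun_prop
      exact (this.tendsto 0).mono_left nhdsWithin_le_nhds
    simp only [mul_zero, zero_mul] at h1
    refine ge_of_tendsto h1 ?_
    filter_upwards [Ioc_mem_nhdsGT (show (0 : ℝ) < 1 by norm_num)] with lam hlam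
    exact key2 lam hlam.1 hlam.2
  nlinarith

end Uniqueness

section Insertion
variable {ι : Type*} [DecidableEq ι]

lemma map_update (q : ι → I) (e : ι) (b : Bool) :
    Measurable (fun ω : ι → Bool => Function.update ω e b) ∧
      (PM q).map (fun ω => Function.update ω e b) =
        PM (Function.update q e (if b then 1 else 0)) := by
  refine map_PM (fun k => if k = e then ∅ else {k}) (fun k => ?_) (fun k => ?_) (fun k l hkl => ?_)
    fun k => ?_
  · split_ifs <;> simp
  · by_cases h : k = e
    · subst h; simp only [Function.update_self, if_true]; exact detBy_const _ _
    · simp only [h, if_false, Function.update_of_ne h]; exact detBy_eval k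
  · by_cases h : k = e <;> by_cases h' : l = e <;> simp [h, h']
    exact hkl
  · by_cases h : k = e
    · subst h; cases b
      · simp [Pr_empty]
      · simpa using Pr_univ q
    · simp [Function.update_of_ne h, Pr_true]

lemma PM_update (q : ι → I) (e : ι) :
    PM q = ENNReal.ofReal (q e) • PM (Function.update q e 1) +
      ENNReal.ofReal (1 - q e) • PM (Function.update q e 0) := by
  symm
  apply eq_PM
  intro s f
  rw [Measure.add_apply, Measure.smul_apply, Measure.smul_apply, PM_cylinder, PM_cylinder]
  have h0 : ∀ (b : I), ∏ k ∈ s.erase e, (if f k then ENNReal.ofReal (Function.update q e b k)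
      else ENNReal.ofReal (1 - Function.update q e b k)) = ∏ k ∈ s.erase e,
        (if f k then ENNReal.ofReal (q k) else ENNReal.ofReal (1 - q k)) := fun b =>
    Finset.prod_congr rfl fun k hk => by rw [Function.update_of_ne (Finset.ne_of_mem_erase hk)]
  by_cases he : e ∈ s
  · rw [← Finset.mul_prod_erase s _ he, ← Finset.mul_prod_erase s _ he,
      ← Finset.mul_prod_erase s _ he, h0, h0]
    cases f e <;> simp
  · rw [← Finset.erase_eq_of_notMem he, h0, h0]
    rw [smul_eq_mul, smul_eq_mul, ← add_mul, ← ENNReal.ofReal_add (q e).2.1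
      (sub_nonneg.2 (q e).2.2)]
    simp

lemma Pr_insert (q : ι → I) (e : ι) {B : Set (ι → Bool)} (hB : MeasurableSet B) :
    q e * Pr q {ω | Function.update ω e true ∈ B} ≤ Pr q B := by
  have h1 := map_update q e true
  have h2 : Pr (Function.update q e 1) B = Pr q {ω | Function.update ω e true ∈ B} :=
    Pr_map h1.1 (by simpa using h1.2) hB
  rw [← h2]
  have h3 : ENNReal.ofReal (q e) * PM (Function.update q e 1) B ≤ PM q B := by
    conv_rhs => rw [PM_update q e]
    exact le_self_add
  have h4 := ENNReal.toReal_mono (measure_ne_top _ _) h3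
  rwa [ENNReal.toReal_mul, ENNReal.toReal_ofReal (q e).2.1] at h4

end Insertion

section Uniqueness
variable {d : ℕ}

lemma Sep.symm {ω : Config d} {x y : Zd d} (h : Sep ω x y) : Sep ω y x :=
  ⟨h.2.1, h.1, fun h' => h.2.2 h'.symm⟩

lemma Pb_sep_adj {p : I} (hp : 0 < (p : ℝ)) {x y : Zd d} (h : latAdj x y) :
    Pb p {ω : Config d | Sep ω x y} = 0 := by
  have h1 : ∀ (x : Zd d) i, Pb p {ω : Config d | Sep ω x (x + ee i)} = 0 := by
    intro x i
    have := Pb_sep_tr p x 0 (ee i)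
    rw [zero_add, add_comm, Pb_sep_edge hp] at this
    exact this
  obtain ⟨i, rfl | rfl⟩ := latAdj_iff.1 h
  · exact h1 x i
  · rw [← h1 y i]
    congr 1; ext ω
    exact ⟨Sep.symm, Sep.symm⟩

lemma exists_closer {x y : Zd d} (h : x ≠ y) : ∃ z, latAdj x z ∧
    ∑ i, (z i - y i).natAbs < ∑ i, (x i - y i).natAbs := by
  obtain ⟨i, hi⟩ := Function.ne_iff.1 h
  have key : ∀ a : ℤ, (a = 1 ∨ a = -1) → (x i + a - y i).natAbs < (x i - y i).natAbs →
      ∑ j, ((x + a • ee i) j - y j).natAbs < ∑ j, (x j - y j).natAbs := by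
    intro a _ h
    refine Finset.sum_lt_sum (fun j _ => ?_) ⟨i, Finset.mem_univ _, ?_⟩
    · by_cases hj : j = i
      · subst hj; simpa [ee] using h.le
      · simp [ee, hj]
    · simpa [ee] using h
  rcases lt_or_gt_of_ne hi with h1 | h1
  · refine ⟨x + ee i, latAdj_add x i, ?_⟩
    have := key 1 (.inl rfl) (by omega)
    simpa using this
  · refine ⟨x + (-1 : ℤ) • ee i, latAdj_iff.2 ⟨i, .inr (by simp)⟩, key (-1) (.inr rfl) (by omega)⟩

lemma sep_update {ω : Config d} {x x' y : Zd d} (h : Sep ω x y) (hx' : ¬ Inf ω x')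
    (hadj : latAdj x x') : Sep (Function.update ω s(x, x') true) x' y := by
  set ω' := Function.update ω s(x, x') true with hω'
  have hle : ω ≤ ω' := by
    intro e
    by_cases he : e = s(x, x')
    · subst he; simp [hω']
    · simp [hω', Function.update_of_ne he]
  have hxx : Conn ω' Set.univ x x' := .of_adj ⟨hadj, by simp [hω']⟩ trivial trivial
  have hinf : ∀ z, Inf ω z → Inf ω' z := fun z hz => by
    rw [inf_iff] at *
    exact hz.mono fun w hw => hw.mono_config hle
  refine ⟨(hinf x h.1).of_conn hxx, hinf y h.2.1, fun hc => ?_⟩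
  have : Conn ω Set.univ x y ∨ Conn ω Set.univ x' y := by
    refine hc.induct (P := fun y => Conn ω Set.univ x y ∨ Conn ω Set.univ x' y)
      (.inr (.refl trivial)) ?_
    intro a b _ hab _ hP
    by_cases he : s(a, b) = s(x, x')
    · rcases Sym2.eq_iff.1 he with ⟨-, rfl⟩ | ⟨-, rfl⟩
      · exact .inr (.refl trivial)
      · exact .inl (.refl trivial)
    · have : Conn ω Set.univ a b := .of_adj ⟨hab.1, by
        have := hab.2; rwa [hω', Function.update_of_ne he] at this⟩ trivial trivial
      exact hP.imp (·.trans this) (·.trans this)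
  rcases this with h1 | h1
  · exact h.2.2 h1
  · exact hx' (h.2.1.of_conn h1.symm)

/-- Uniqueness of the infinite cluster. -/
theorem Pb_sep {p : I} (hp : 0 < (p : ℝ)) (x y : Zd d) :
    Pb p {ω : Config d | Sep ω x y} = 0 := by
  induction hn : ∑ i, (x i - y i).natAbs using Nat.strong_induction_on generalizing x with
  | _ n ih =>
  by_cases hxy : x = y
  · subst hxy
    rw [← Pr_empty fun _ : Sym2 (Zd d) => p]
    congr 1; ext ω
    simp only [Set.mem_ofPred_eq, Set.mem_empty_iff_false, iff_false]
    exact fun h => h.2.2 (.refl trivial)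
  · obtain ⟨z, hz, hlt⟩ := exists_closer hxy
    have h1 := ih _ (hn ▸ hlt) z rfl
    have h2 := Pr_insert (fun _ => p) s(x, z) (measurableSet_sep z y)
    have h3 : {ω : Config d | Sep ω x y} ⊆ ({ω | Sep ω x z} ∪ {ω | Sep ω z y}) ∪
        {ω | Function.update ω s(x, z) true ∈ {ω | Sep ω z y}} := by
      intro ω h
      by_cases hi : Inf ω z
      · left
        by_cases hc : Conn ω Set.univ x z
        · exact .inr ⟨hi, h.2.1, fun h' => h.2.2 (hc.trans h')⟩
        · exact .inl ⟨h.1, hi, hc⟩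
      · right
        have := sep_update h hi hz
        exact this
    have h4 := (Pr_mono (fun _ => p) h3).trans (Pr_union_le _ _ _)
    have h5 := Pr_union_le (fun _ => p) {ω : Config d | Sep ω x z} {ω | Sep ω z y}
    have h6 := Pr_nonneg (fun _ => p) {ω : Config d |
      Function.update ω s(x, z) true ∈ {ω | Sep ω z y}}
    have h7 := Pb_sep_adj hp hz
    have h8 := Pr_nonneg (fun _ => p) {ω : Config d | Sep ω x y}
    simp only [Pb] at h1 h7 ⊢
    rw [h1] at h2
    have h9 := nonpos_of_mul_nonpos_right h2 hp
    exact le_antisymm (h4.trans (add_nonpos (h5.trans (by rw [h7, h1, add_zero])) h9)) h8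

end Uniqueness

section Limits
variable {ι : Type*}

lemma Pr_tendsto_iInter (q : ι → I) {A : ℕ → Set (ι → Bool)} (hA : Antitone A)
    (hm : ∀ n, MeasurableSet (A n)) :
    Filter.Tendsto (fun n => Pr q (A n)) Filter.atTop (nhds (Pr q (⋂ n, A n))) := by
  have := tendsto_measure_iInter_atTop (μ := PM q) (fun n => (hm n).nullMeasurableSet) hA
    ⟨0, measure_ne_top _ _⟩
  exact (ENNReal.tendsto_toReal (measure_ne_top _ _)).comp this

lemma harris_not (q : ι → I) {s : Set ι} (hs : s.Finite) {A B : (ι → Bool) → Prop}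
    (hA : DetBy s A) (hB : DetBy s B) (iA : Incr A) (iB : Incr B) :
    Pr q {ω | ¬ A ω} * Pr q {ω | ¬ B ω} ≤ Pr q {ω | ¬ A ω ∧ ¬ B ω} := by
  have h := harris q hs hA hB iA iB
  have mA := hA.measurableSet hs
  have mB := hB.measurableSet hs
  have h1 : Pr q {ω | ¬ A ω} = 1 - Pr q {ω | A ω} := Pr_compl q mA
  have h2 : Pr q {ω | ¬ B ω} = 1 - Pr q {ω | B ω} := Pr_compl q mB
  have h3 : Pr q {ω | ¬ A ω ∧ ¬ B ω} = 1 - Pr q ({ω | A ω} ∪ {ω | B ω}) := by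
    rw [← Pr_compl q (mA.union mB), Set.compl_union]; rfl
  have h4 : Pr q ({ω | A ω} ∪ {ω | B ω}) + Pr q {ω | A ω ∧ B ω} =
      Pr q {ω | A ω} + Pr q {ω | B ω} := measureReal_union_add_inter mB
  rw [h1, h2, h3]
  nlinarith

lemma harris_forall_not {α : Type*} (q : ι → I) {s : Set ι} (hs : s.Finite) (T : Finset α)
    (A : α → (ι → Bool) → Prop) (hA : ∀ a, DetBy s (A a)) (iA : ∀ a, Incr (A a)) :
    ∏ a ∈ T, Pr q {ω | ¬ A a ω} ≤ Pr q {ω | ∀ a ∈ T, ¬ A a ω} := by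
  classical
  induction T using Finset.induction_on with
  | empty => simpa using (Pr_univ q).ge
  | insert a T ha ih =>
    rw [Finset.prod_insert ha]
    have h := harris_not q hs (hA a) (B := fun ω => ∃ b ∈ T, A b ω)
      (.exists fun b => (detBy_const _ _).and (hA b)) (iA a)
      (fun ω ω' hle ⟨b, hb, h⟩ => ⟨b, hb, iA b _ _ hle h⟩)
    have h1 : {ω | ¬ ∃ b ∈ T, A b ω} = {ω | ∀ b ∈ T, ¬ A b ω} := by ext; simp
    rw [h1] at h
    refine (mul_le_mul_of_nonneg_left ih (Pr_nonneg _ _)).trans (h.trans (Pr_mono q ?_))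
    rintro ω ⟨h2, h3⟩
    simp only [not_exists, not_and] at h3
    simpa using ⟨h2, h3⟩

end Limits

section Connect
variable {d : ℕ}

/-- A pointed orthant piece of a face of a box. -/
def Fc (c : Zd d) (i : Fin d) (ε : Fin d → ℤˣ) (L : ℤ) : Set (Zd d) :=
  {y | y ∈ ball c L ∧ y i - c i = ε i * L ∧ ∀ k, 0 ≤ (ε k : ℤ) * (y k - c k)}

lemma sph_subset_Fc {c : Zd d} {L : ℤ} {y : Zd d} (hy : y ∈ sph c L) :
    ∃ i ε, y ∈ Fc c i ε L := by
  obtain ⟨hb, i, hi⟩ := hy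
  refine ⟨i, fun k => if 0 ≤ y k - c k then 1 else -1, hb, ?_, fun k => ?_⟩
  · have h1 := le_antisymm (hb i) hi
    dsimp only
    split_ifs with h
    · rw [abs_of_nonneg h] at h1; simp [h1]
    · rw [abs_of_neg (not_le.1 h)] at h1; simp [← h1]
  · dsimp only
    split_ifs with h
    · simpa using h
    · push_cast; linarith

lemma mem_Fc_sgnPerm (i j : Fin d) (ε τ : Fin d → ℤˣ) (L : ℤ) (x : Zd d) :
    sgnPerm (Equiv.swap i j) (fun k => τ k * ε (Equiv.swap i j k)) x ∈ Fc 0 j τ L ↔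
      x ∈ Fc 0 i ε L := by
  set φ := sgnPerm (Equiv.swap i j) (fun k => τ k * ε (Equiv.swap i j k)) with hφ
  have h0 : φ x ∈ ball 0 L ↔ x ∈ ball 0 L := by
    have := sgnPerm_image_ball (Equiv.swap i j) (fun k => τ k * ε (Equiv.swap i j k)) L
    conv_lhs => rw [← this, ← hφ]
    exact φ.injective.mem_set_image
  have hv : ∀ k, φ x k = (τ k : ℤ) * (ε (Equiv.swap i j k)) * x (Equiv.swap i j k) := fun k => by
    simp [hφ, sgnPerm]
  have hu : ∀ u : ℤˣ, (u : ℤ) * u = 1 := fun u => by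
    rw [← Units.val_mul, Int.units_mul_self, Units.val_one]
  simp only [Fc, Set.mem_ofPred_eq, h0, Pi.zero_apply, sub_zero]
  refine and_congr_right fun _ => and_congr ?_ ?_
  · rw [hv, Equiv.swap_apply_right]
    constructor
    · intro h
      have := congrArg (fun z => (ε i : ℤ) * τ j * z) h
      calc x i = ((τ j : ℤ) * τ j) * ((ε i : ℤ) * ε i) * x i := by rw [hu, hu]; ring
        _ = (τ j * τ j) * (ε i * L) := by linarith
        _ = _ := by rw [hu]; ring
    · intro h
      rw [h]
      calc _ = (τ j : ℤ) * ((ε i : ℤ) * ε i) * L := by ring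
        _ = _ := by rw [hu]; ring
  · rw [← (Equiv.swap i j).forall_congr_right]
    refine forall_congr' fun k => ?_
    rw [hv, Equiv.swap_apply_self]
    have : (τ (Equiv.swap i j k) : ℤ) * ((τ (Equiv.swap i j k) : ℤ) * (ε k) * x k) =
      (τ (Equiv.swap i j k) * τ (Equiv.swap i j k)) * (ε k * x k) := by ring
    rw [this, hu, one_mul]

lemma detBy_nc (V : Set (Zd d)) (S F : Set (Zd d)) :
    DetBy (edgesIn V) fun ω => ∃ u ∈ S, CT ω V u F :=
  .exists fun u => (detBy_const _ _).and (detBy_CT V u F)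

lemma Pb_nc_facet (p : I) (m L : ℤ) (i j : Fin d) (ε τ : Fin d → ℤˣ) :
    Pb p {ω : Config d | ¬ ∃ u ∈ ball 0 m, CT ω (ball 0 L) u (Fc 0 i ε L)} =
      Pb p {ω : Config d | ¬ ∃ u ∈ ball 0 m, CT ω (ball 0 L) u (Fc 0 j τ L)} := by
  set φ := sgnPerm (Equiv.swap i j) (fun k => τ k * ε (Equiv.swap i j k)) with hφ
  have hF : φ '' Fc 0 i ε L = Fc 0 j τ L := by
    ext y
    obtain ⟨x, rfl⟩ := φ.surjective y
    rw [φ.injective.mem_set_image, hφ, mem_Fc_sgnPerm]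
  have hb : ∀ n, φ '' ball 0 n = ball 0 n := sgnPerm_image_ball _ _
  refine (Pb_pull p φ ((detBy_nc (ball 0 L) (ball 0 m) (Fc 0 i ε L)).measurableSet
    (edgesIn_finite (ball_finite _ _))).compl).symm.trans ?_
  congr 1
  ext ω
  simp only [Set.mem_compl_iff, Set.mem_ofPred_eq]
  refine not_congr ⟨?_, ?_⟩
  · rintro ⟨u, hu, h⟩
    have h2 := (CT_pull (isAut_sgnPerm _ _)).1 h
    rw [← hφ, hb, hF] at h2
    exact ⟨φ u, hb m ▸ Set.mem_image_of_mem φ hu, h2⟩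
  · rintro ⟨u, hu, h⟩
    rw [← hb m] at hu
    obtain ⟨u, hu, rfl⟩ := hu
    refine ⟨u, hu, (CT_pull (isAut_sgnPerm _ _)).2 ?_⟩
    rwa [← hφ, hb, hF]

lemma Pb_nc_pow (p : I) (m L : ℤ) (i : Fin d) (ε : Fin d → ℤˣ) :
    (Pb p {ω : Config d | ¬ ∃ u ∈ ball 0 m, CT ω (ball 0 L) u (Fc 0 i ε L)}) ^ (d * 2 ^ d) ≤
      Pb p {ω : Config d | ¬ ∃ u ∈ ball 0 m, CT ω (ball 0 L) u (sph 0 L)} := by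
  have h := harris_forall_not (fun _ => p) (edgesIn_finite (ball_finite (0 : Zd d) L))
    (Finset.univ : Finset (Fin d × (Fin d → ℤˣ)))
    (fun a ω => ∃ u ∈ ball 0 m, CT ω (ball 0 L) u (Fc 0 a.1 a.2 L))
    (fun a => detBy_nc _ _ _) (fun a ω ω' hle ⟨u, hu, h⟩ => ⟨u, hu, incr_CT _ _ _ _ _ hle h⟩)
  rw [Finset.prod_congr rfl fun a _ => Pb_nc_facet p m L a.1 i a.2 ε] at h
  rw [Finset.prod_const, Finset.card_univ, Fintype.card_prod, Fintype.card_fin, Fintype.card_fun,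
    Fintype.card_fin, Fintype.card_units_int] at h
  refine h.trans (Pr_mono _ ?_)
  rintro ω h ⟨u, hu, y, hy, hc⟩
  obtain ⟨j, τ, hy'⟩ := sph_subset_Fc hy
  exact h (j, τ) (Finset.mem_univ _) ⟨u, hu, y, hy', hc⟩

/-- Two vertices both reach the boundary of the box but are not connected inside it. -/
def Fail (L : ℤ) (u v : Zd d) (ω : Config d) : Prop :=
  CT ω (ball 0 L) u (sph 0 L) ∧ CT ω (ball 0 L) v (sph 0 L) ∧ ¬ Conn ω (ball 0 L) u v

lemma detBy_fail (L : ℤ) (u v : Zd d) : DetBy (edgesIn (ball 0 L)) (Fail L u v) :=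
  (detBy_CT _ _ _).and ((detBy_CT _ _ _).and (detBy_conn _ _ _).not)

lemma CT_sph_shrink {ω : Config d} {L L' : ℤ} {u : Zd d} (hu : u ∈ ball 0 L) (h : L ≤ L')
    (hc : CT ω (ball 0 L') u (sph 0 L')) : CT ω (ball 0 L) u (sph 0 L) := by
  obtain ⟨y, hy, hc⟩ := hc
  exact hc.CT_sph hu (far_anti _ h hy.2)

lemma exists_mem_ball (u : Zd d) : ∃ n : ℕ, u ∈ ball (0 : Zd d) n :=
  ⟨∑ i, (u i).natAbs, fun i => by
    have h2 := Finset.single_le_sum (f := fun i => (u i).natAbs) (fun i _ => Nat.zero_le _)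
      (Finset.mem_univ i)
    simp only [Pi.zero_apply, sub_zero]
    rw [Int.abs_eq_natAbs]
    exact_mod_cast h2⟩

lemma inf_iff_CT {ω : Config d} {u : Zd d} {m : ℕ} (hu : u ∈ ball (0 : Zd d) m) :
    Inf ω u ↔ ∀ n : ℕ, CT ω (ball 0 (m + n : ℕ)) u (sph 0 (m + n : ℕ)) := by
  constructor
  · intro h n
    exact h.CT_ball (ball_mono _ (by push_cast; linarith) hu)
  · intro h
    rw [inf_iff]
    intro hfin
    obtain ⟨b, hb⟩ : ∃ b : ℕ, {y | Conn ω Set.univ u y} ⊆ ball 0 b := by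
      obtain ⟨b, hb⟩ := (hfin.image fun y => (exists_mem_ball y).choose).bddAbove
      refine ⟨b, fun y hy => ?_⟩
      have := (exists_mem_ball y).choose_spec
      exact ball_mono _ (by exact_mod_cast hb ⟨y, hy, rfl⟩) this
    obtain ⟨y, hy, hc⟩ := h (b + 1)
    have h1 := hb (hc.mono (Set.subset_univ _))
    exact not_mem_ball.2 (far_anti _ (by push_cast; linarith) hy.2) h1

lemma tendsto_fail {p : I} (hp : 0 < (p : ℝ)) (u v : Zd d) :
    Filter.Tendsto (fun L : ℕ => Pb p {ω : Config d | Fail L u v ω}) Filter.atTop (nhds 0) := by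
  obtain ⟨a, ha⟩ := exists_mem_ball u
  obtain ⟨b, hb⟩ := exists_mem_ball v
  set m := max a b
  have hu : u ∈ ball (0 : Zd d) m := ball_mono _ (by exact_mod_cast le_max_left a b) ha
  have hv : v ∈ ball (0 : Zd d) m := ball_mono _ (by exact_mod_cast le_max_right a b) hb
  rw [← Filter.tendsto_add_atTop_iff_nat m]
  have key := Pr_tendsto_iInter (fun _ => p) (A := fun n => {ω : Config d | Fail (m + n : ℕ) u v ω})
    ?_ fun n => (detBy_fail _ u v).measurableSet (edgesIn_finite (ball_finite _ _))
  · have h0 : Pr (fun _ => p) (⋂ n, {ω : Config d | Fail (m + n : ℕ) u v ω}) = 0 := by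
      refine le_antisymm ?_ (Pr_nonneg _ _)
      rw [← Pb_sep hp u v]
      refine Pr_mono _ fun ω h => ?_
      simp only [Set.mem_iInter, Set.mem_ofPred_eq] at h
      refine ⟨(inf_iff_CT hu).2 fun n => (h n).1, (inf_iff_CT hv).2 fun n => (h n).2.1, ?_⟩
      intro hc
      obtain ⟨n, hn⟩ := conn_univ_iff.1 hc
      exact (h n).2.2 (hn.mono (ball_mono _ (by push_cast; linarith)))
    rw [h0] at key
    simpa [add_comm m] using key
  · intro n n' hn ω h
    have hle : ((m + n : ℕ) : ℤ) ≤ (m + n' : ℕ) := by push_cast; exact_mod_cast Nat.add_le_add_left hn m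
    have hm : (m : ℤ) ≤ (m + n : ℕ) := by push_cast; linarith
    exact ⟨CT_sph_shrink (ball_mono _ hm hu) hle h.1, CT_sph_shrink (ball_mono _ hm hv) hle h.2.1,
      fun hc => h.2.2 (hc.mono (ball_mono _ hle))⟩

lemma tendsto_not_inf (p : I) :
    Filter.Tendsto (fun r : ℕ => Pb p {ω : Config d | CT ω (ball 0 r) 0 (sph 0 r) ∧ ¬ Inf ω 0})
      Filter.atTop (nhds 0) := by
  have hm : ∀ r : ℕ, MeasurableSet {ω : Config d | CT ω (ball 0 r) 0 (sph 0 r)} := fun r =>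
    (detBy_CT _ _ _).measurableSet (edgesIn_finite (ball_finite _ _))
  have key := Pr_tendsto_iInter (fun _ => p)
    (A := fun r : ℕ => {ω : Config d | CT ω (ball 0 r) 0 (sph 0 r) ∧ ¬ Inf ω 0})
    (fun r r' hr ω h => ⟨CT_sph_shrink (self_mem_ball _ (by positivity)) (by exact_mod_cast hr) h.1,
      h.2⟩) fun r => (hm r).inter (measurableSet_inf 0).compl
  have h0 : (⋂ r : ℕ, {ω : Config d | CT ω (ball 0 r) 0 (sph 0 r) ∧ ¬ Inf ω 0}) = ∅ := by
    ext ω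
    simp only [Set.mem_iInter, Set.mem_ofPred_eq, Set.mem_empty_iff_false, iff_false]
    exact fun h => (h 0).2 fun n => (h n).1
  rwa [h0, Pr_empty] at key

lemma Pb_none_inf_le (p : I) (M r : ℕ) (x : ℕ → Zd d)
    (hx : ∀ j < M, ∀ k < M, j ≠ k → Disjoint (ball (x j) r) (ball (x k) r)) :
    Pb p {ω : Config d | ∀ j < M, ¬ Inf ω (x j)} ≤ (1 - Pb p {ω : Config d | Inf ω 0}) ^ M +
      M * Pb p {ω : Config d | CT ω (ball 0 r) 0 (sph 0 r) ∧ ¬ Inf ω 0} := by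
  have hm : ∀ x, MeasurableSet {ω : Config d | CT ω (ball x r) x (sph x r)} := fun x =>
    (detBy_CT _ _ _).measurableSet (edgesIn_finite (ball_finite _ _))
  have h1 : Pb p {ω : Config d | ∀ j ∈ Finset.range M, ¬ CT ω (ball (x j) r) (x j) (sph (x j) r)} ≤
      (1 - Pb p {ω : Config d | Inf ω 0}) ^ M := by
    rw [Pb, Pr_forall (Finset.range M) (fun j => edgesIn (ball (x j) r))
      (fun j ω => ¬ CT ω (ball (x j) r) (x j) (sph (x j) r))
      (fun j _ => edgesIn_finite (ball_finite _ _)) (fun j _ => (detBy_CT _ _ _).not)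
      (fun j hj k hk hne => edgesIn_disjoint (hx j (Finset.mem_range.1 hj) k
        (Finset.mem_range.1 hk) hne))]
    calc _ ≤ ∏ j ∈ Finset.range M, (1 - Pb p {ω : Config d | Inf ω 0}) := by
          refine Finset.prod_le_prod (fun _ _ => Pr_nonneg _ _) fun j _ => ?_
          have : Pb p {ω : Config d | ¬ CT ω (ball (x j) r) (x j) (sph (x j) r)} =
            1 - Pb p {ω : Config d | CT ω (ball (x j) r) (x j) (sph (x j) r)} := Pr_compl _ (hm _)
          rw [← Pb_inf p (x j)]
          refine this.le.trans (sub_le_sub_left (Pr_mono _ ?_) _)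
          exact fun ω h => h r
      _ = _ := by simp
  have h2 : ∀ j, Pb p {ω : Config d | CT ω (ball (x j) r) (x j) (sph (x j) r) ∧ ¬ Inf ω (x j)} =
      Pb p {ω : Config d | CT ω (ball 0 r) 0 (sph 0 r) ∧ ¬ Inf ω 0} := by
    intro j
    refine Eq.trans ?_ (Pb_pull p (tr (x j)) ((hm 0).inter (measurableSet_inf 0).compl))
    congr 1; ext ω
    simp [CT_pull (isAut_tr _), inf_pull (isAut_tr _), tr_image_ball, tr_image_sph]
  have h3 := Pr_exists_le (fun _ => p) (Finset.range M)
    (fun j (ω : Config d) => CT ω (ball (x j) r) (x j) (sph (x j) r) ∧ ¬ Inf ω (x j))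
  rw [Finset.sum_congr rfl fun j _ => h2 j] at h3
  simp only [Finset.sum_const, Finset.card_range, nsmul_eq_mul] at h3
  refine le_trans ?_ (add_le_add h1 h3)
  refine le_trans (Pr_mono _ ?_) (Pr_union_le _ _ _)
  intro ω h
  by_cases hc : ∀ j ∈ Finset.range M, ¬ CT ω (ball (x j) r) (x j) (sph (x j) r)
  · exact .inl hc
  · push Not at hc
    obtain ⟨j, hj, hc⟩ := hc
    exact .inr ⟨j, hj, hc, h j (Finset.mem_range.1 hj)⟩

lemma disjoint_ball_of_sph {x y : Zd d} {r a b : ℤ} (hx : x ∈ sph 0 a) (hy : y ∈ sph 0 b)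
    (h : a + 2 * r + 1 ≤ b) : Disjoint (ball x r) (ball y r) := by
  rw [Set.disjoint_left]
  intro z hz hz'
  obtain ⟨i, hi⟩ := hy.2
  have h1 := hx.1 i
  have h2 := hz i
  have h3 := hz' i
  simp only [Pi.zero_apply, sub_zero] at hi h1
  rw [abs_le] at h1 h2 h3
  rcases le_abs.1 hi with h4 | h4 <;> linarith [h1.1, h1.2, h2.1, h2.2, h3.1, h3.2]

/-- The infinite cluster is hit by sufficiently many well separated points. -/
lemma exists_hit {p : I} (hp : pc d < p) {η : ℝ} (hη : 0 < η) : ∃ M r : ℕ, ∀ x : ℕ → Zd d,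
    (∀ j < M, x j ∈ sph 0 ((2 * r + 1) * (j + 1))) →
    Pb p {ω : Config d | ∀ j < M, ¬ Inf ω (x j)} ≤ η := by
  have hθ := theta_pos hp
  set θ := Pb p {ω : Config d | Inf ω 0}
  have hθ1 : θ ≤ 1 := Pr_le_one _ _
  obtain ⟨M, hM⟩ := exists_pow_lt_of_lt_one (half_pos hη) (show 1 - θ < 1 by linarith)
  have h1 := ((tendsto_not_inf (d := d) p).const_mul (M : ℝ)).eventually
    (gt_mem_nhds (show (M : ℝ) * 0 < η / 2 by simpa using half_pos hη))
  obtain ⟨r, hr⟩ := h1.exists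
  refine ⟨M, r, fun x hx => (Pb_none_inf_le p M r x ?_).trans (by linarith)⟩
  have key : ∀ j < M, ∀ k < M, j < k → Disjoint (ball (x j) r) (ball (x k) r) := by
    intro j hj k hk hjk
    refine disjoint_ball_of_sph (hx j hj) (hx k hk) ?_
    have : (j : ℤ) + 1 ≤ k := by exact_mod_cast hjk
    nlinarith
  intro j hj k hk hne
  rcases lt_or_gt_of_ne hne with h | h
  · exact key j hj k hk h
  · exact (key k hk j hj h).symm

end Connect

section Reach
variable {d : ℕ}

lemma Fc_subset_sph {c : Zd d} {i : Fin d} {ε : Fin d → ℤˣ} {L : ℤ} : Fc c i ε L ⊆ sph c L := by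
  intro y hy
  refine ⟨hy.1, i, ?_⟩
  rcases Int.units_eq_one_or (ε i) with h | h <;> rw [hy.2.1, h] <;> simp
  all_goals exact le_abs_self L

lemma tr_image_Fc (a c : Zd d) (i : Fin d) (ε : Fin d → ℤˣ) (L : ℤ) :
    tr a '' Fc c i ε L = Fc (c + a) i ε L := by
  ext y
  obtain ⟨x, rfl⟩ := (tr a).surjective y
  rw [(tr a).injective.mem_set_image]
  simp [Fc, mem_ball]

/-- The central box is likely to be joined to each piece of the boundary by a single vertex. -/
lemma exists_uniform {p : I} (hp : pc d < p) (i₀ : Fin d) {η : ℝ} (hη : 0 < η) :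
    ∃ M r L₀ : ℕ, ∀ L : ℕ, L₀ ≤ L → (2 * r + 1) * M ≤ L ∧
      (∀ x : ℕ → Zd d, (∀ j < M, x j ∈ sph 0 ((2 * r + 1) * (j + 1))) →
        Pb p {ω : Config d | ∀ j < M, ¬ Inf ω (x j)} ≤ η) ∧
      (∀ i ε, Pb p {ω : Config d | ¬ ∃ u ∈ ball 0 ((2 * r + 1) * M), CT ω (ball 0 L) u (Fc 0 i ε L)}
        ≤ η) ∧
      Pb p {ω : Config d | ∃ u ∈ ball 0 ((2 * r + 1) * M), ∃ v ∈ ball 0 ((2 * r + 1) * M),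
        Fail L u v ω} ≤ η := by
  have hp0 : 0 < (p : ℝ) := (pc_nonneg d).trans_lt hp
  set N := d * 2 ^ d with hN
  have hN0 : N ≠ 0 := by
    have : 0 < d := i₀.pos
    positivity
  have hη' : 0 < min η (η ^ N) := lt_min hη (by positivity)
  obtain ⟨M, r, hMr⟩ := exists_hit hp hη'
  set m : ℤ := (2 * r + 1) * M with hm
  set B := (ball_finite (0 : Zd d) m).toFinset with hB
  have hlim : Filter.Tendsto (fun L : ℕ => ∑ w ∈ B ×ˢ B, Pb p {ω : Config d | Fail L w.1 w.2 ω})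
      Filter.atTop (nhds 0) := by
    simpa using tendsto_finsetSum (B ×ˢ B) fun w _ => tendsto_fail hp0 w.1 w.2
  obtain ⟨L₁, hL₁⟩ := Filter.eventually_atTop.1 (hlim.eventually (gt_mem_nhds hη))
  refine ⟨M, r, max L₁ ((2 * r + 1) * M), fun L hL => ⟨(le_max_right _ _).trans hL, fun x hx =>
    (hMr x hx).trans (min_le_left _ _), fun i ε => ?_, ?_⟩⟩
  · have hLm : m ≤ L := by
      have := (le_max_right _ _).trans hL
      rw [hm]; exact_mod_cast this
    have h1 := Pb_nc_pow p m L i ε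
    refine le_of_pow_le_pow_left₀ hN0 hη.le (h1.trans ?_)
    refine le_trans ?_ (min_le_right η _)
    have hx : ∀ j < M, (fun k => if k = i₀ then (2 * r + 1) * (j + 1) else 0 : Zd d) ∈
        sph (0 : Zd d) ((2 * r + 1) * (j + 1)) := by
      intro j _
      have h0 : (0 : ℤ) ≤ (2 * r + 1) * (j + 1) := by positivity
      refine ⟨fun k => ?_, i₀, ?_⟩
      · simp only [Pi.zero_apply, sub_zero]
        split_ifs
        · rw [abs_of_nonneg h0]
        · simpa using h0
      · simp [abs_of_nonneg h0]
    refine le_trans (Pr_mono _ ?_) (hMr (fun j k => if k = i₀ then (2 * r + 1) * (j + 1) else 0) hx)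
    intro ω h j hj hinf
    have hjm : ((2 * r + 1) * (j + 1) : ℤ) ≤ m := by
      rw [hm]
      exact mul_le_mul_of_nonneg_left (by exact_mod_cast hj) (by positivity)
    have h2 := ball_mono _ hjm (hx j hj).1
    exact h ⟨_, h2, hinf.CT_ball (ball_mono _ hLm h2)⟩
  · refine le_trans ?_ (hL₁ L ((le_max_left _ _).trans hL)).le
    refine le_trans (Pr_mono _ ?_) (Pr_exists_le _ (B ×ˢ B) fun w ω => Fail L w.1 w.2 ω)
    rintro ω ⟨u, hu, v, hv, h⟩
    exact ⟨(u, v), by simpa [hB] using ⟨hu, hv⟩, h⟩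

/-- Well separated points are likely to be joined to a given piece of the boundary of a box. -/
lemma exists_reach {p : I} (hp : pc d < p) (i₀ : Fin d) {η : ℝ} (hη : 0 < η) :
    ∃ M r L₀ : ℕ, ∀ L : ℕ, L₀ ≤ L → (2 * r + 1) * M ≤ L ∧ ∀ (c : Zd d) (x : ℕ → Zd d),
      (∀ j < M, x j ∈ sph c ((2 * r + 1) * (j + 1))) → ∀ i ε,
      Pb p {ω : Config d | ¬ ∃ j < M, CT ω (ball c L) (x j) (Fc c i ε L)} ≤ η := by
  obtain ⟨M, r, L₀, h⟩ := exists_uniform hp i₀ (show 0 < η / 3 by positivity)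
  refine ⟨M, r, L₀, fun L hL => ?_⟩
  obtain ⟨hML, h1, h2, h3⟩ := h L hL
  have key : ∀ x : ℕ → Zd d,
      (∀ j < M, x j ∈ sph 0 ((2 * r + 1) * (j + 1))) → ∀ i ε,
      Pb p {ω : Config d | ¬ ∃ j < M, CT ω (ball 0 L) (x j) (Fc 0 i ε L)} ≤ η := by
    intro x hx i ε
    have h4 := add_le_add (add_le_add (h1 x hx) (h2 i ε)) h3
    refine le_trans ?_ (h4.trans (by linarith))
    refine le_trans (Pr_mono _ ?_) ((Pr_union_le _ _ _).trans (add_le_add (Pr_union_le _ _ _) le_rfl))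
    intro ω hω
    by_contra hc
    simp only [Set.mem_union, Set.mem_ofPred_eq, not_or, not_not, not_forall] at hc
    obtain ⟨⟨⟨j, hj, hinf⟩, u, hu, hcu⟩, hF⟩ := hc
    have hjm : ((2 * r + 1) * (j + 1) : ℤ) ≤ (2 * r + 1) * M :=
      mul_le_mul_of_nonneg_left (by exact_mod_cast hj) (by positivity)
    have hxm := ball_mono _ hjm (hx j hj).1
    have hxL : x j ∈ ball 0 (L : ℤ) := ball_mono _ (by exact_mod_cast hML) hxm
    have hxu : Conn ω (ball 0 L) (x j) u := by
      by_contra hne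
      refine hF ⟨x j, hxm, u, hu, hinf.CT_ball hxL, ?_, hne⟩
      obtain ⟨y, hy, hc⟩ := hcu
      exact ⟨y, Fc_subset_sph hy, hc⟩
    obtain ⟨y, hy, hc⟩ := hcu
    exact hω ⟨j, hj, y, hy, hxu.trans hc⟩
  refine ⟨hML, fun c x hx i ε => ?_⟩
  have hx' : ∀ j < M, x j - c ∈ sph 0 ((2 * r + 1) * (j + 1)) := by
    intro j hj
    have := hx j hj
    refine ⟨fun k => by simpa using this.1 k, ?_⟩
    obtain ⟨k, hk⟩ := this.2
    exact ⟨k, by simpa using hk⟩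
  refine le_trans (le_of_eq ?_) (key (fun j => x j - c) hx' i ε)
  refine (Pb_pull p (tr c) (A := {ω : Config d |
    ¬ ∃ j < M, CT ω (ball 0 L) (x j - c) (Fc 0 i ε L)}) ?_).symm.trans ?_ |>.symm
  · exact (DetBy.not (.exists fun j => (detBy_const _ _).and (detBy_CT _ _ _))).measurableSet
      (edgesIn_finite (ball_finite 0 L))
  · congr 1; ext ω
    simp [CT_pull (isAut_tr _), tr_image_ball, tr_image_Fc]

/-- Some vertex near the origin is likely to be joined to all pieces of the boundary. -/
lemma exists_ref {p : I} (hp : pc d < p) (i₀ : Fin d) {η : ℝ} (hη : 0 < η) :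
    ∃ m L₀ : ℕ, ∀ L : ℕ, L₀ ≤ L → m ≤ L ∧
      Pb p {ω : Config d | ¬ ∃ u ∈ ball 0 m, ∀ i ε, CT ω (ball 0 L) u (Fc 0 i ε L)} ≤ η := by
  set N : ℝ := (Fintype.card (Fin d × (Fin d → ℤˣ)) : ℝ) with hN
  have hN0 : 0 ≤ N := by positivity
  obtain ⟨M, r, L₀, h⟩ := exists_uniform hp i₀ (show 0 < η / (N + 1) by positivity)
  refine ⟨(2 * r + 1) * M, L₀, fun L hL => ?_⟩
  obtain ⟨hML, -, h2, h3⟩ := h L hL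
  refine ⟨hML, ?_⟩
  have h4 := Pr_exists_le (fun _ => p) Finset.univ (fun (a : Fin d × (Fin d → ℤˣ)) (ω : Config d) =>
    ¬ ∃ u ∈ ball 0 ((2 * r + 1) * M), CT ω (ball 0 L) u (Fc 0 a.1 a.2 L))
  have h5 := h4.trans (Finset.sum_le_sum fun a _ => h2 a.1 a.2)
  rw [Finset.sum_const, nsmul_eq_mul, Finset.card_univ, ← hN] at h5
  refine le_trans ?_ ((add_le_add h5 h3).trans (le_of_eq (by field_simp)))
  refine le_trans (Pr_mono _ ?_) (Pr_union_le _ _ _)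
  intro ω hω
  by_contra hc
  simp only [Set.mem_union, Set.mem_ofPred_eq, not_or, Finset.mem_univ,
    true_and] at hc
  obtain ⟨hc, hF⟩ := hc
  replace hc := fun a => not_not.1 (not_exists.1 hc a)
  obtain ⟨u, hu, hcu⟩ := hc (i₀, fun _ => 1)
  refine hω ⟨u, by push_cast; exact hu, fun i ε => ?_⟩
  obtain ⟨v, hv, y, hy, hcv⟩ := hc (i, ε)
  have huv : Conn ω (ball 0 L) u v := by
    by_contra hne
    refine hF ⟨u, hu, v, hv, ?_, ⟨y, Fc_subset_sph hy, hcv⟩, hne⟩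
    obtain ⟨y', hy', hc'⟩ := hcu
    exact ⟨y', Fc_subset_sph hy', hc'⟩
  exact ⟨y, hy, huv.trans hcv⟩

end Reach

section ClosedFamily
variable {ι : Type*}

lemma Pr_closed_family (q : ι → I) {s : Set ι} (hs : s.Finite) {α : Type*} (E : Finset α)
    {P : (ι → Bool) → Finset α} (hP : DetBy s P) (hPE : ∀ ω, P ω ⊆ E) (g : α → ι)
    (hg : g.Injective) (hgs : ∀ ω, ∀ e ∈ P ω, g e ∉ s) (δ : ℝ) (hq : ∀ e, (q (g e) : ℝ) = δ) :
    Pr q {ω | ∀ e ∈ P ω, ω (g e) = false} =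
      ∑ π ∈ E.powerset, Pr q {ω | P ω = π} * (1 - δ) ^ π.card := by
  classical
  rw [Pr_partition hs hP E.powerset fun ω => Finset.mem_powerset.2 (hPE ω)]
  refine Finset.sum_congr rfl fun π _ => ?_
  by_cases hπ : ∃ ω, P ω = π
  · obtain ⟨ω₀, hω₀⟩ := hπ
    have h1 := Pr_and hs (π.image g).finite_toSet (A := fun ω => P ω = π)
      (B := fun ω => ∀ e ∈ π, ω (g e) = false) (hP.comp (· = π))
      (.forall fun e ω ω' H => by
        by_cases he : e ∈ π
        · simp only [he, H (g e) (by simpa using ⟨e, he, rfl⟩)]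
        · simp [he])
      (by
        rw [Set.disjoint_right]
        intro i hi
        obtain ⟨e, he, rfl⟩ := Finset.mem_image.1 (Finset.mem_coe.1 hi)
        exact hgs ω₀ e (hω₀ ▸ he)) q
    have h2 : Pr q {ω : ι → Bool | ∀ e ∈ π, ω (g e) = false} = (1 - δ) ^ π.card := by
      have := Pr_all_false q (π.image g)
      rw [Finset.prod_image (fun _ _ _ _ h => hg h)] at this
      simp only [hq, Finset.prod_const, Finset.forall_mem_image] at this
      exact this
    rw [← h2, ← h1]
    congr 1; ext ω
    simp only [Set.mem_ofPred_eq]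
    constructor
    · rintro ⟨h, rfl⟩; exact ⟨rfl, h⟩
    · rintro ⟨rfl, h⟩; exact ⟨h, rfl⟩
  · have h1 : {ω | P ω = π} = ∅ := by ext ω; simpa using fun h => hπ ⟨ω, h⟩
    have h2 : {ω | ω ∈ {ω | ∀ e ∈ P ω, ω (g e) = false} ∧ P ω = π} = ∅ := by
      ext ω; simpa using fun _ h => hπ ⟨ω, h⟩
    rw [h1, h2, Pr_empty, zero_mul]

/-- Comparing two ways to sprinkle a random family of edges. -/
lemma Pr_sprinkle (q : ι → I) {s : Set ι} (hs : s.Finite) {α : Type*} (E : Finset α)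
    {P : (ι → Bool) → Finset α} (hP : DetBy s P) (hPE : ∀ ω, P ω ⊆ E) (g g' : α → ι)
    (hg : g.Injective) (hgs : ∀ ω, ∀ e ∈ P ω, g e ∉ s)
    (hg' : g'.Injective) (hgs' : ∀ ω, ∀ e ∈ P ω, g' e ∉ s) {δ p : ℝ} (hδ : δ ≤ 1) {k : ℕ}
    (hk : (1 - δ) ^ k = 1 - p)
    (hq : ∀ e, (q (g e) : ℝ) = δ) (hq' : ∀ e, (q (g' e) : ℝ) = p) :
    (Pr q {ω | ∀ e ∈ P ω, ω (g e) = false}) ^ k ≤ Pr q {ω | ∀ e ∈ P ω, ω (g' e) = false} := by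
  rw [Pr_closed_family q hs E hP hPE g hg hgs δ hq,
    Pr_closed_family q hs E hP hPE g' hg' hgs' p hq']
  refine (Real.pow_arith_mean_le_arith_mean_pow E.powerset _ _ (fun _ _ => Pr_nonneg _ _) ?_
    (fun _ _ => pow_nonneg (sub_nonneg.2 hδ) _) k).trans (le_of_eq ?_)
  · have := Pr_partition (q := q) hs hP E.powerset (fun ω => Finset.mem_powerset.2 (hPE ω)) Set.univ
    rw [Pr_univ] at this
    simpa using this.symm
  · refine Finset.sum_congr rfl fun π _ => ?_
    rw [← hk, ← pow_mul, ← pow_mul, mul_comm k]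

end ClosedFamily

section Explore
variable {d : ℕ}

/-- A sprinkling attempt between two neighbouring sites. -/
abbrev Att (d : ℕ) := Zd d × Fin d

/-- Coordinates of the layered configuration: the base layer `none`, the final sprinkling
`some none`, and one layer for each attempt. -/
abbrev Ix (d : ℕ) := Sym2 (Zd d) × Option (Option (Att d))

/-- The base layer of a layered configuration. -/
def base (ω : Ix d → Bool) : Config d := fun e => ω (e, none)

variable (V S : Set (Zd d)) (X : Zd d → Set (Zd d)) (D : Att d → Set (Zd d))

/-- The set explored from `S` in `V` when the attempts in `U` are allowed. -/
inductive Cl (U : Finset (Att d)) (ω : Ix d → Bool) : Zd d → Prop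
  | seed {x} : x ∈ S → Cl U ω x
  | base {x y} : Cl U ω x → latAdj x y → y ∈ V → ω (s(x, y), none) = true → Cl U ω y
  | spr {f t x y} : f ∈ U → t ∈ X f.1 ∪ X (f.1 + ee f.2) → Cl U ω t → Cl U ω x → latAdj x y →
      x ∈ D f → y ∈ D f → y ∈ V → ω (s(x, y), some (some f)) = true → Cl U ω y

/-- The explored set as a set. -/
def Cls (U : Finset (Att d)) (ω : Ix d → Bool) : Set (Zd d) := {x | Cl V S X D U ω x}

/-- Coordinates examined when the explored set is `K`. -/
def crd (U : Finset (Att d)) (K : Set (Zd d)) : Set (Ix d) :=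
  {i | i.1 ∈ edgesIn V ∧ (∃ v ∈ K, v ∈ i.1) ∧ (i.2 = none ∨ ∃ f ∈ U, i.2 = some (some f))}

/-- Exactly one of the two sites of an attempt is met. -/
def Xo (f : Att d) (K : Set (Zd d)) : Prop :=
  ((X f.1 ∩ K).Nonempty ∧ ¬ (X (f.1 + ee f.2) ∩ K).Nonempty) ∨
    (¬ (X f.1 ∩ K).Nonempty ∧ (X (f.1 + ee f.2) ∩ K).Nonempty)

variable {V S X D} {U U' : Finset (Att d)} {K K' : Set (Zd d)} {ω : Ix d → Bool}

lemma Cls_mono (h : U ⊆ U') : Cls V S X D U ω ⊆ Cls V S X D U' ω := by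
  intro x hx
  induction hx with
  | seed h => exact .seed h
  | base _ h1 h2 h3 ih => exact .base ih h1 h2 h3
  | spr hf ht _ _ h1 h2 h3 h4 h5 ih1 ih2 => exact .spr (h hf) ht ih1 ih2 h1 h2 h3 h4 h5

lemma seed_subset_Cls : S ⊆ Cls V S X D U ω := fun _ h => .seed h

lemma Cls_subset (hS : S ⊆ V) : Cls V S X D U ω ⊆ V := by
  intro x hx
  cases hx with
  | seed h => exact hS h
  | base _ _ h _ => exact h
  | spr _ _ _ _ _ _ _ h _ => exact h

lemma detBy_Cls (hS : S ⊆ V) (K : Set (Zd d)) :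
    DetBy (crd V U K) fun ω => Cls V S X D U ω = K := by
  rw [detBy_iff]
  intro ω ω' H hK
  have hKV : K ⊆ V := hK ▸ Cls_subset hS
  have e1 : ∀ {x y}, x ∈ K → y ∈ V → ω (s(x, y), none) = ω' (s(x, y), none) := fun hx hy =>
    H _ ⟨mk_mem_edgesIn.2 ⟨hKV hx, hy⟩, ⟨_, hx, by simp⟩, .inl rfl⟩
  have e2 : ∀ {f x y}, f ∈ U → x ∈ K → y ∈ V → ω (s(x, y), some (some f)) =
      ω' (s(x, y), some (some f)) := fun hf hx hy =>
    H _ ⟨mk_mem_edgesIn.2 ⟨hKV hx, hy⟩, ⟨_, hx, by simp⟩, .inr ⟨_, hf, rfl⟩⟩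
  apply Set.Subset.antisymm
  · intro x hx
    induction hx with
    | seed h => exact hK ▸ Cl.seed h
    | base _ h1 h2 h3 ih =>
      have h4 := ih
      rw [← e1 ih h2] at h3
      rw [← hK] at ih ⊢
      exact .base ih h1 h2 h3
    | spr hf ht _ _ h1 h2 h3 h4 h5 ih1 ih2 =>
      rw [← e2 hf ih2 h4] at h5
      rw [← hK] at ih1 ih2 ⊢
      exact .spr hf ht ih1 ih2 h1 h2 h3 h4 h5
  · intro x hx
    rw [← hK] at hx
    induction hx with
    | seed h => exact .seed h
    | base hx h1 h2 h3 ih =>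
      rw [e1 (hK ▸ hx) h2] at h3
      exact .base ih h1 h2 h3
    | spr hf ht _ hx h1 h2 h3 h4 h5 ih1 ih2 =>
      rw [e2 hf (hK ▸ hx) h4] at h5
      exact .spr hf ht ih1 ih2 h1 h2 h3 h4 h5

lemma crd_finite (hV : V.Finite) : (crd V U K).Finite := by
  refine ((edgesIn_finite hV).prod
    (((U.finite_toSet.image fun f => some (some f)).insert none))).subset ?_
  rintro ⟨e, l⟩ ⟨h1, -, h2⟩
  refine ⟨h1, ?_⟩
  rcases h2 with rfl | ⟨f, hf, rfl⟩
  · simp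
  · exact .inr ⟨f, hf, rfl⟩

lemma crd_mono (h : U ⊆ U') (hK : K ⊆ K') : crd V U K ⊆ crd V U' K' := by
  rintro i ⟨h1, ⟨v, hv, hvi⟩, h2⟩
  exact ⟨h1, ⟨v, hK hv, hvi⟩, h2.imp_right fun ⟨f, hf, hi⟩ => ⟨f, h hf, hi⟩⟩

lemma detBy_Cls_fun (hS : S ⊆ V) : DetBy (crd V U V) fun ω => Cls V S X D U ω := by
  intro ω ω' H
  exact (detBy_iff.1 (detBy_Cls hS (Cls V S X D U ω)) ω ω'
    (fun i hi => H i (crd_mono subset_rfl (Cls_subset hS) hi)) rfl).symm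

lemma Cls_union_eq (hK : Cls V S X D U ω = K)
    (h : ∀ f ∈ U', ¬ ((X f.1 ∪ X (f.1 + ee f.2)) ∩ K).Nonempty) :
    Cls V S X D (U ∪ U') ω = K := by
  apply Set.Subset.antisymm
  · intro x hx
    induction hx with
    | seed h => exact hK ▸ Cl.seed h
    | base _ h1 h2 h3 ih => rw [← hK] at ih ⊢; exact .base ih h1 h2 h3
    | spr hf ht _ _ h1 h2 h3 h4 h5 ih1 ih2 =>
      rcases Finset.mem_union.1 hf with hf | hf
      · rw [← hK] at ih1 ih2 ⊢
        exact .spr hf ht ih1 ih2 h1 h2 h3 h4 h5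
      · exact absurd ⟨_, ht, ih1⟩ (h _ hf)
  · rw [← hK]
    exact Cls_mono Finset.subset_union_left

lemma Xo.anti {f : Att d} (h : Xo X f K') (hK : K ⊆ K') (hT : ((X f.1 ∪ X (f.1 + ee f.2)) ∩ K).Nonempty) :
    Xo X f K := by
  rw [Set.union_inter_distrib_right, Set.union_nonempty] at hT
  have m : ∀ z, (X z ∩ K).Nonempty → (X z ∩ K').Nonempty := fun z h =>
    h.mono (Set.inter_subset_inter_right _ hK)
  have m1 := m f.1
  have m2 := m (f.1 + ee f.2)
  unfold Xo at *
  tauto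

lemma Xo.nonempty {f : Att d} (h : Xo X f K) : ((X f.1 ∪ X (f.1 + ee f.2)) ∩ K).Nonempty := by
  rw [Set.union_inter_distrib_right, Set.union_nonempty]
  exact h.imp (·.1) (·.2)

/-- If every single attempt fails with conditional probability at most `η`, the probability that all
attempts of a given family fail is exponentially small. -/
lemma stage (hV : V.Finite) (hS : S ⊆ V) {q : Ix d → I} {η : ℝ} (hη : 0 ≤ η) {G : Finset (Att d)}
    (hG : ∀ U f K A, f ∈ G → f ∉ U → DetBy (crd V U K) A → Xo X f K →
      (∃ ω, Cls V S X D U ω = K) →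
      Pr q {ω | A ω ∧ Cls V S X D U ω = K ∧ Xo X f (Cls V S X D (insert f U) ω)} ≤
        η * Pr q {ω | A ω ∧ Cls V S X D U ω = K})
    (n : ℕ) : ∀ (S' U : Finset (Att d)), S'.card = n → Disjoint U S' → S' ⊆ G →
      ∀ K A, DetBy (crd V U K) A →
      Pr q {ω | A ω ∧ Cls V S X D U ω = K ∧ ∀ f ∈ S', Xo X f (Cls V S X D (U ∪ S') ω)} ≤
        η ^ n * Pr q {ω | A ω ∧ Cls V S X D U ω = K} := by
  induction n with
  | zero =>
    intro S' U hn _ _ K A _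
    rw [pow_zero, one_mul]
    exact Pr_mono _ fun ω h => ⟨h.1, h.2.1⟩
  | succ n ih =>
    intro S' U hn hUS hSG K A hA
    have hnn : 0 ≤ η ^ (n + 1) * Pr q {ω | A ω ∧ Cls V S X D U ω = K} :=
      mul_nonneg (pow_nonneg hη _) (Pr_nonneg _ _)
    have hemp : (∀ ω, Cls V S X D U ω = K → (∀ f ∈ S', Xo X f (Cls V S X D (U ∪ S') ω)) → False) →
        Pr q {ω | A ω ∧ Cls V S X D U ω = K ∧ ∀ f ∈ S', Xo X f (Cls V S X D (U ∪ S') ω)} ≤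
        η ^ (n + 1) * Pr q {ω | A ω ∧ Cls V S X D U ω = K} := by
      intro h
      have : {ω | A ω ∧ Cls V S X D U ω = K ∧ ∀ f ∈ S', Xo X f (Cls V S X D (U ∪ S') ω)} = ∅ := by
        ext ω
        simp only [Set.mem_ofPred_eq, Set.mem_empty_iff_false, iff_false]
        exact fun h' => h ω h'.2.1 h'.2.2
      rw [this, Pr_empty]; exact hnn
    by_cases htr : ∃ f ∈ S', ((X f.1 ∪ X (f.1 + ee f.2)) ∩ K).Nonempty
    · obtain ⟨f, hf, hT⟩ := htr
      by_cases hX : Xo X f K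
      · by_cases hex : ∃ ω, Cls V S X D U ω = K
        swap
        · exact hemp fun ω h _ => hex ⟨ω, h⟩
        have hfU : f ∉ U := Finset.disjoint_right.1 hUS hf
        have hUS' : insert f U ∪ S'.erase f = U ∪ S' := by
          rw [Finset.insert_union, ← Finset.union_insert, Finset.insert_erase hf]
        have hsub : ∀ ω, Cls V S X D U ω ⊆ Cls V S X D (insert f U) ω := fun ω =>
          Cls_mono (Finset.subset_insert _ _)
        set T := hV.powerset.toFinset
        have hT' : ∀ ω, Cls V S X D (insert f U) ω ∈ T := fun ω => by
          simpa [T] using Cls_subset hS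
        rw [Pr_partition (crd_finite hV) (detBy_Cls_fun (U := insert f U) hS) T hT']
        have h1 : ∀ K' ∈ T, Pr q {ω | ω ∈ {ω | A ω ∧ Cls V S X D U ω = K ∧
            ∀ f ∈ S', Xo X f (Cls V S X D (U ∪ S') ω)} ∧ Cls V S X D (insert f U) ω = K'} ≤
            η ^ n * Pr q {ω | ω ∈ {ω | A ω ∧ Cls V S X D U ω = K ∧
              Xo X f (Cls V S X D (insert f U) ω)} ∧ Cls V S X D (insert f U) ω = K'} := by
          intro K' _
          by_cases hKK : K ⊆ K'
          · have h2 := ih (S'.erase f) (insert f U) (by rw [Finset.card_erase_of_mem hf, hn]; rfl)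
              (by
                rw [Finset.disjoint_insert_left]
                exact ⟨by simp, hUS.mono_right (Finset.erase_subset _ _)⟩)
              ((Finset.erase_subset _ _).trans hSG) K'
              (fun ω => (A ω ∧ Cls V S X D U ω = K) ∧ Xo X f K')
              (((hA.and (detBy_Cls hS K)).mono (crd_mono (Finset.subset_insert _ _) hKK)).and
                (detBy_const _ _))
            rw [hUS'] at h2
            refine le_trans (Pr_mono _ ?_) (h2.trans (mul_le_mul_of_nonneg_left (Pr_mono _ ?_)
              (pow_nonneg hη _)))
            · rintro ω ⟨⟨h3, h4, h5⟩, h6⟩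
              refine ⟨⟨⟨h3, h4⟩, ?_⟩, h6, fun g hg => h5 g (Finset.mem_of_mem_erase hg)⟩
              refine (h5 f hf).anti ?_ (hX.nonempty.mono (Set.inter_subset_inter_right _ hKK))
              rw [← h6, ← hUS']
              exact Cls_mono Finset.subset_union_left
            · rintro ω ⟨⟨⟨h3, h4⟩, h5⟩, h6⟩
              exact ⟨⟨h3, h4, h6 ▸ h5⟩, h6⟩
          · have : {ω | ω ∈ {ω | A ω ∧ Cls V S X D U ω = K ∧
              ∀ f ∈ S', Xo X f (Cls V S X D (U ∪ S') ω)} ∧ Cls V S X D (insert f U) ω = K'} = ∅ := by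
              ext ω
              simp only [Set.mem_ofPred_eq, Set.mem_empty_iff_false, iff_false]
              rintro ⟨⟨_, h4, _⟩, h6⟩
              exact hKK (h4 ▸ h6 ▸ hsub ω)
            rw [this, Pr_empty]
            exact mul_nonneg (pow_nonneg hη _) (Pr_nonneg _ _)
        refine (Finset.sum_le_sum h1).trans ?_
        rw [← Finset.mul_sum, ← Pr_partition (crd_finite hV)
          (detBy_Cls_fun (U := insert f U) hS) T hT', pow_succ, mul_assoc]
        exact mul_le_mul_of_nonneg_left (hG U f K A (hSG hf) hfU hA hX hex) (pow_nonneg hη _)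
      · exact hemp fun ω h1 h2 => hX ((h2 f hf).anti (h1 ▸ Cls_mono Finset.subset_union_left) hT)
    · push Not at htr
      refine hemp fun ω h1 h2 => ?_
      obtain ⟨f, hf⟩ := Finset.card_pos.1 (by omega : 0 < S'.card)
      have h3 := Cls_union_eq h1 (U' := S') fun f hf => Set.not_nonempty_iff_eq_empty.2 (htr f hf)
      have h4 := (h2 f hf).nonempty
      rw [h3] at h4
      exact h4.ne_empty (htr f hf)

/-- The probability that all attempts in `S'` fail, everything being explored. -/
lemma Pr_all_fail (hV : V.Finite) (hS : S ⊆ V) {q : Ix d → I} {η : ℝ} (hη : 0 ≤ η)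
    {G : Finset (Att d)}
    (hG : ∀ U f K A, f ∈ G → f ∉ U → DetBy (crd V U K) A → Xo X f K →
      (∃ ω, Cls V S X D U ω = K) →
      Pr q {ω | A ω ∧ Cls V S X D U ω = K ∧ Xo X f (Cls V S X D (insert f U) ω)} ≤
        η * Pr q {ω | A ω ∧ Cls V S X D U ω = K})
    (S' : Finset (Att d)) (hS' : S' ⊆ G) :
    Pr q {ω | ∀ f ∈ S', Xo X f (Cls V S X D G ω)} ≤ η ^ S'.card := by
  set T := hV.powerset.toFinset
  set U := G \ S'
  have hT' : ∀ ω, Cls V S X D U ω ∈ T := fun ω => by simpa [T] using Cls_subset hS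
  rw [Pr_partition (crd_finite hV) (detBy_Cls_fun (U := U) hS) T hT']
  have hU : U ∪ S' = G := Finset.sdiff_union_of_subset hS'
  have h1 : ∀ K ∈ T, Pr q {ω | ω ∈ {ω | ∀ f ∈ S', Xo X f (Cls V S X D G ω)} ∧
      Cls V S X D U ω = K} ≤ η ^ S'.card * Pr q {ω | ω ∈ Set.univ ∧ Cls V S X D U ω = K} := by
    intro K _
    have := stage hV hS hη hG S'.card S' U rfl Finset.sdiff_disjoint hS' K (fun _ => True)
      (detBy_const _ _)
    rw [hU] at this
    refine le_trans (Pr_mono _ ?_) this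
    exact fun ω h => ⟨trivial, h.2, h.1⟩
  refine (Finset.sum_le_sum h1).trans ?_
  rw [← Finset.mul_sum, ← Pr_partition (crd_finite hV) (detBy_Cls_fun (U := U) hS) T hT', Pr_univ,
    mul_one]

end Explore

section Attempt
variable {d : ℕ}

open Classical in
/-- Edges leaving `K` from which `F` can be reached by base-open edges in `B \ K`. -/
noncomputable def exitEdges {B : Set (Zd d)} (hB : B.Finite) (K F : Set (Zd d)) (ω : Ix d → Bool) :
    Finset (Sym2 (Zd d)) :=
  (edgesIn_finite hB).toFinset.filter fun e => ∃ u ∈ K, ∃ v, v ∉ K ∧ e = s(u, v) ∧ latAdj u v ∧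
    CT (base ω) (B \ K) v F

lemma mem_exitEdges {B : Set (Zd d)} (hB : B.Finite) {K F : Set (Zd d)} {ω : Ix d → Bool}
    {e : Sym2 (Zd d)} : e ∈ exitEdges hB K F ω ↔ e ∈ edgesIn B ∧ ∃ u ∈ K, ∃ v, v ∉ K ∧ e = s(u, v) ∧
      latAdj u v ∧ CT (base ω) (B \ K) v F := by
  simp [exitEdges]

lemma detBy_base {β : Type*} {s : Set (Sym2 (Zd d))} {A : Config d → β} (h : DetBy s A) :
    DetBy (s ×ˢ {none}) fun ω : Ix d → Bool => A (base ω) :=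
  h.precomp fun e he _ _ H => H (e, none) ⟨he, rfl⟩

lemma detBy_exitEdges {B : Set (Zd d)} (hB : B.Finite) (K F : Set (Zd d)) :
    DetBy (edgesIn (B \ K) ×ˢ {none}) (exitEdges hB K F) := by
  intro ω ω' H
  ext e
  have : ∀ v, CT (base ω) (B \ K) v F = CT (base ω') (B \ K) v F := fun v =>
    detBy_base (detBy_CT (B \ K) v F) ω ω' H
  simp only [mem_exitEdges, this]

lemma Pb_base {q : Ix d → I} {p : I} (hq : ∀ e, q (e, none) = p) {A : Set (Config d)}
    (hA : MeasurableSet A) : Pb p A = Pr q {ω | base ω ∈ A} := by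
  obtain ⟨h1, h2⟩ := map_PM_inj (q := q) (q' := fun _ : Sym2 (Zd d) => p) (fun e => (e, none))
    (fun _ _ h => (Prod.ext_iff.1 h).1) hq
  exact Pr_map h1 h2 hA

lemma exitEdges_fail {q : Ix d → I} {p : I} (hq : ∀ e, q (e, none) = p) {δ : I} {f : Att d}
    (hf : ∀ e, q (e, some (some f)) = δ) {k : ℕ} (hk : (1 - (δ : ℝ)) ^ k = 1 - p)
    {B : Set (Zd d)} (hB : B.Finite) {K F : Set (Zd d)} (hKF : Disjoint K F) :
    (Pr q {ω | ∀ e ∈ exitEdges hB K F ω, ω (e, some (some f)) = false}) ^ k ≤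
      Pb p {ω : Config d | ¬ ∃ x ∈ K, CT ω B x F} := by
  have hs : (edgesIn (B \ K) ×ˢ {none} : Set (Ix d)).Finite :=
    (edgesIn_finite (hB.subset Set.sdiff_subset)).prod (Set.finite_singleton _)
  have h := Pr_sprinkle q hs (edgesIn_finite hB).toFinset (detBy_exitEdges hB K F)
    (fun ω e he => by simpa using ((mem_exitEdges hB).1 he).1) (fun e => (e, some (some f))) (fun e => (e, none))
    (fun _ _ h => (Prod.ext_iff.1 h).1) (fun ω e _ h => by simp at h)
    (fun _ _ h => (Prod.ext_iff.1 h).1) (fun ω e he h => by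
      obtain ⟨-, u, hu, v, -, rfl, -⟩ := (mem_exitEdges hB).1 he
      exact (mk_mem_edgesIn.1 h.1).1.2 hu)
    (unitInterval.le_one δ) hk (fun e => by rw [hf]) (fun e => by rw [hq])
  refine h.trans ?_
  rw [Pb_base hq]
  · refine Pr_mono _ ?_
    rintro ω hω ⟨x, hx, y, hy, hc⟩
    obtain ⟨u, v, huB, hu, huv, hvy⟩ := hc.last_exit hx (Set.disjoint_right.1 hKF hy)
    have := hω s(u, v) ((mem_exitEdges hB).2 ⟨mk_mem_edgesIn.2 ⟨huB, hvy.left.1⟩, u, hu, v, hvy.left.2,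
      rfl, huv.1, y, hy, hvy⟩)
    have h2 := huv.2
    simp only [base] at h2
    rw [h2] at this
    cases this
  · exact (DetBy.not (.exists fun x => (detBy_const _ _).and (detBy_CT B x F))).measurableSet
      (edgesIn_finite hB)

variable {V S : Set (Zd d)} {X : Zd d → Set (Zd d)} {D : Att d → Set (Zd d)}

lemma attempt (hV : V.Finite) (hS : S ⊆ V) {q : Ix d → I} {p : I} (hq : ∀ e, q (e, none) = p) {δ : I}
    {f : Att d} (hf : ∀ e, q (e, some (some f)) = δ) {k : ℕ} (hk0 : k ≠ 0)
    (hk : (1 - (δ : ℝ)) ^ k = 1 - p)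
    {η : ℝ} (hη0 : 0 ≤ η) {U : Finset (Att d)} (hfU : f ∉ U) {K : Set (Zd d)} {A : (Ix d → Bool) → Prop}
    (hA : DetBy (crd V U K) A) {B F : Set (Zd d)} (hBV : B ⊆ V) (hBD : B ⊆ D f)
    (ht : ((X f.1 ∪ X (f.1 + ee f.2)) ∩ K).Nonempty) (hKF : Disjoint K F)
    (hη : Pb p {ω : Config d | ¬ ∃ x ∈ K, CT ω B x F} ≤ η ^ k) :
    Pr q {ω | A ω ∧ Cls V S X D U ω = K ∧ ¬ (F ∩ Cls V S X D (insert f U) ω).Nonempty} ≤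
      η * Pr q {ω | A ω ∧ Cls V S X D U ω = K} := by
  have hB := hV.subset hBV
  have h1 := le_of_pow_le_pow_left₀ hk0 hη0 ((exitEdges_fail hq hf hk hB hKF).trans hη)
  have hdet : DetBy (edgesIn (B \ K) ×ˢ {none} ∪ edgesIn B ×ˢ {some (some f)})
      fun ω : Ix d → Bool => ∀ e ∈ exitEdges hB K F ω, ω (e, some (some f)) = false := by
    intro ω ω' H
    have h2 := detBy_exitEdges hB K F ω ω' fun i hi => H i (.inl hi)
    simp only [← h2]
    refine propext (forall₂_congr fun e he => ?_)
    rw [H (e, some (some f)) (.inr ⟨((mem_exitEdges hB).1 he).1, rfl⟩)]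
  have h2 := Pr_and (crd_finite hV)
    (((edgesIn_finite (hB.subset Set.sdiff_subset)).prod (Set.finite_singleton _)).union
      ((edgesIn_finite hB).prod (Set.finite_singleton _)))
    (hA.and (detBy_Cls (X := X) (D := D) hS K)) hdet (by
      rw [Set.disjoint_left]
      rintro ⟨e, l⟩ ⟨-, ⟨v, hvK, hve⟩, hl⟩ hh
      rcases hh with ⟨h3, -⟩ | ⟨-, h4⟩
      · exact (h3 v hve).2 hvK
      · cases h4
        rcases hl with hl | ⟨g, hg, hl⟩
        · cases hl
        · cases hl; exact hfU hg) q
  rw [mul_comm]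
  refine le_trans (Pr_mono _ ?_) (h2.le.trans (mul_le_mul_of_nonneg_left h1 (Pr_nonneg _ _)))
  rintro ω ⟨hAω, hK, hn⟩
  refine ⟨⟨hAω, hK⟩, fun e he => ?_⟩
  by_contra hopen
  rw [Bool.not_eq_false] at hopen
  obtain ⟨heB, u, hu, v, hv, rfl, huv, y, hy, hc⟩ := (mem_exitEdges hB).1 he
  have hsub : K ⊆ Cls V S X D (insert f U) ω := hK ▸ Cls_mono (Finset.subset_insert _ _)
  have huB := (mk_mem_edgesIn.1 heB).1
  have hvB := (mk_mem_edgesIn.1 heB).2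
  obtain ⟨t, htX, htK⟩ := ht
  have hvC : Cl V S X D (insert f U) ω v := .spr (Finset.mem_insert_self _ _) htX (hsub htK) (hsub hu)
    huv (hBD huB) (hBD hvB) (hBV hvB) hopen
  refine hn ⟨y, hy, ?_⟩
  exact hc.induct (P := fun y => Cl V S X D (insert f U) ω y) hvC
    fun a b _ hab hb ha => .base ha hab.1 (hBV hb.1) hab.2

end Attempt

section Geometry
variable {d : ℕ}

/-- The fully open configuration. -/
def allOpen : Config d := fun _ => true

lemma openAdj_allOpen {x y : Zd d} : openAdj allOpen x y ↔ latAdj x y := by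
  simp [openAdj, allOpen]

lemma ee_apply (i k : Fin d) : (ee i : Zd d) k = if k = i then 1 else 0 := by
  simp [ee, Pi.single_apply]

lemma conn_Icc {a b x y : Zd d} (hx : x ∈ Set.Icc a b) (hy : y ∈ Set.Icc a b) :
    Conn allOpen (Set.Icc a b) x y := by
  generalize hn : ∑ i, (x i - y i).natAbs = n
  induction n generalizing x with
  | zero =>
    have : x = y := by
      ext i
      have := (Finset.sum_eq_zero_iff.1 hn) i (Finset.mem_univ i)
      omega
    exact this ▸ .refl hx
  | succ n ih =>
    obtain ⟨i, hi⟩ : ∃ i, x i ≠ y i := by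
      by_contra! h
      simp [h] at hn
    have key : ∀ z : Zd d, latAdj x z → (∀ k, k ≠ i → z k = x k) →
        (z i - y i).natAbs + 1 = (x i - y i).natAbs → a i ≤ z i → z i ≤ b i →
        Conn allOpen (Set.Icc a b) x y := by
      intro z hxz hz hzi h1 h2
      have hzI : z ∈ Set.Icc a b := by
        refine ⟨fun k => ?_, fun k => ?_⟩ <;> by_cases hk : k = i
        · exact hk ▸ h1
        · rw [hz k hk]; exact hx.1 k
        · exact hk ▸ h2
        · rw [hz k hk]; exact hx.2 k
      refine (Conn.of_adj (openAdj_allOpen.2 hxz) hx hzI).trans (ih hzI ?_)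
      rw [← Finset.add_sum_erase _ _ (Finset.mem_univ i)] at hn ⊢
      rw [Finset.sum_congr rfl fun k hk => by rw [hz k (Finset.ne_of_mem_erase hk)]]
      omega
    have hxa : a i ≤ x i := hx.1 i
    have hxb : x i ≤ b i := hx.2 i
    have hya : a i ≤ y i := hy.1 i
    have hyb : y i ≤ b i := hy.2 i
    have hee : (ee i : Zd d) i = 1 := by simp
    rcases lt_or_gt_of_ne hi with h | h
    · refine key (x + ee i) (latAdj_add x i) (fun k hk => by simp [hk]) ?_ ?_ ?_ <;>
      rw [Pi.add_apply, hee] <;> omega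
    · refine key (x - ee i) ?_ (fun k hk => by simp [hk]) ?_ ?_ ?_
      · have := latAdj_add (x - ee i) i
        rw [sub_add_cancel] at this
        exact latAdj_comm.1 this
      all_goals rw [Pi.sub_apply, hee]; omega

lemma conn_ball {c x y : Zd d} {n : ℤ} (hx : x ∈ ball c n) (hy : y ∈ ball c n) :
    Conn allOpen (ball c n) x y := by
  rw [ball_eq_Icc] at *
  exact conn_Icc hx hy

lemma exists_Fc_subset {c y : Zd d} {L : ℤ} (hy : y ∈ ball c L) (τ : ℤˣ) (i : Fin d) :
    ∃ ε, Fc y i ε L ⊆ ball (c + (τ * L : ℤ) • ee i) L := by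
  refine ⟨fun k => if k = i then τ else if y k ≤ c k then 1 else -1, ?_⟩
  intro w ⟨hw1, hw2, hw3⟩ k
  have h1 := hw1 k
  have h3 := hw3 k
  have h4 := hy k
  simp only [Pi.add_apply, Pi.smul_apply, ee_apply, smul_eq_mul]
  by_cases hk : k = i
  · subst hk
    simp only [if_true] at hw2 ⊢
    rw [show w k - (c k + τ * L * 1) = y k - c k by linarith]
    exact h4
  · simp only [hk, if_false] at h3 ⊢
    rw [abs_le] at *
    split_ifs at h3 with h5
    · simp only [Units.val_one, one_mul] at h3
      constructor <;> linarith [h1.1, h1.2, h4.1, h4.2]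
    · push Not at h5
      simp only [Units.val_neg, Units.val_one] at h3
      constructor <;> linarith [h1.1, h1.2, h4.1, h4.2]

/-- The box attached to a site. -/
def site (L : ℤ) (z : Zd d) : Set (Zd d) := ball (L • z) L

/-- The region used by an attempt. -/
def dom (L : ℤ) (f : Att d) : Set (Zd d) := ball (L • f.1) (3 * L)

variable {V S : Set (Zd d)} {X : Zd d → Set (Zd d)} {D : Att d → Set (Zd d)}

lemma Cls_conn {U : Finset (Att d)} {ω : Ix d → Bool} {x : Zd d} (h : Cl V S X D U ω x) :
    ∃ s ∈ S, Conn allOpen (Cls V S X D U ω) s x := by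
  induction h with
  | seed h => exact ⟨_, h, .refl (.seed h)⟩
  | base hx h1 h2 h3 ih =>
    obtain ⟨s, hs, hc⟩ := ih
    exact ⟨s, hs, hc.trans (.of_adj (openAdj_allOpen.2 h1) hx (.base hx h1 h2 h3))⟩
  | spr hf ht hCt hx h1 h2 h3 h4 h5 ih1 ih2 =>
    obtain ⟨s, hs, hc⟩ := ih2
    exact ⟨s, hs, hc.trans (.of_adj (openAdj_allOpen.2 h1) hx (.spr hf ht hCt hx h1 h2 h3 h4 h5))⟩

lemma Cls_meets_sph {U : Finset (Att d)} {ω : Ix d → Bool} {y c : Zd d} (i₀ : Fin d) {N n : ℤ}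
    (hS : ball c N ⊆ S) (hSc : S ⊆ ball c N)
    (h : y ∈ Cls V S X D U ω) (hn0 : 0 ≤ n) (hnN : n ≤ N) :
    ∃ x ∈ Cls V S X D U ω, x ∈ sph y n := by
  obtain ⟨s, hs, hc⟩ := Cls_conn h
  obtain ⟨t, ht, htf⟩ : ∃ t ∈ ball c N, t ∈ far y n := by
    have hb : ∀ τ : ℤ, |τ| ≤ 1 → c + (τ * N) • ee i₀ ∈ ball c N := by
      intro τ hτ k
      simp only [Pi.add_apply, Pi.smul_apply, ee_apply, smul_eq_mul, add_sub_cancel_left]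
      split_ifs
      · rw [mul_one, abs_mul, abs_of_nonneg (hn0.trans hnN)]
        nlinarith
      · simp; omega
    by_cases hy : y i₀ ≤ c i₀
    · refine ⟨_, hb 1 (by simp), i₀, ?_⟩
      simp only [Pi.add_apply, Pi.smul_apply, ee_apply, smul_eq_mul, if_true]
      exact le_trans (by linarith) (le_abs_self _)
    · refine ⟨_, hb (-1) (by simp), i₀, ?_⟩
      simp only [Pi.add_apply, Pi.smul_apply, ee_apply, smul_eq_mul, if_true]
      exact le_trans (by linarith) (neg_le_abs _)
  have h1 := hc.symm.trans ((conn_ball (hSc hs) ht).mono (hS.trans seed_subset_Cls))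
  obtain ⟨u, hu, hc'⟩ := h1.to_sph (self_mem_ball y hn0) htf
  exact ⟨u, hc'.right.1, hu⟩

/-- The renormalised attempts fail with small conditional probability. -/
lemma attempt_site (i₀ : Fin d) {M r L : ℕ} (hML : (2 * r + 1) * M ≤ L) {p : I} {k : ℕ} (hk0 : k ≠ 0)
    {η : ℝ} (hη0 : 0 ≤ η)
    (hT : ∀ (c : Zd d) (x : ℕ → Zd d),
      (∀ j < M, x j ∈ sph c ((2 * r + 1) * (j + 1))) → ∀ i ε,
      Pb p {ω : Config d | ¬ ∃ j < M, CT ω (ball c L) (x j) (Fc c i ε L)} ≤ η ^ k)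
    {δ : I} (hk : (1 - (δ : ℝ)) ^ k = 1 - p) (hV : V.Finite) {c : Zd d} (hS : ball c (3 * L) ⊆ V)
    {q : Ix d → I} (hq : ∀ e, q (e, none) = p) {f : Att d} (hf : ∀ e, q (e, some (some f)) = δ)
    (hfV : dom L f ⊆ V)
    {U : Finset (Att d)} (hfU : f ∉ U) {K : Set (Zd d)} {A : (Ix d → Bool) → Prop}
    (hA : DetBy (crd V U K) A) (hX : Xo (site L) f K)
    (hK : ∃ ω, Cls V (ball c (3 * L)) (site L) (dom L) U ω = K) :
    Pr q {ω | A ω ∧ Cls V (ball c (3 * L)) (site L) (dom L) U ω = K ∧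
        Xo (site L) f (Cls V (ball c (3 * L)) (site L) (dom L) (insert f U) ω)} ≤
      η * Pr q {ω | A ω ∧ Cls V (ball c (3 * L)) (site L) (dom L) U ω = K} := by
  have key : ∀ (z : Zd d) (τ : ℤˣ), (∀ y ∈ site L z, ball y L ⊆ dom L f) →
      z ∈ ({f.1, f.1 + ee f.2} : Set (Zd d)) → (site L z ∩ K).Nonempty →
      ¬ (site L (z + (τ : ℤ) • ee f.2) ∩ K).Nonempty →
      Pr q {ω | A ω ∧ Cls V (ball c (3 * L)) (site L) (dom L) U ω = K ∧
        ¬ (site L (z + (τ : ℤ) • ee f.2) ∩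
          Cls V (ball c (3 * L)) (site L) (dom L) (insert f U) ω).Nonempty} ≤
      η * Pr q {ω | A ω ∧ Cls V (ball c (3 * L)) (site L) (dom L) U ω = K} := by
    intro z τ hz hzf ⟨y, hyz, hyK⟩ hne
    obtain ⟨ω₀, hω₀⟩ := hK
    obtain ⟨ε, hε⟩ := exists_Fc_subset hyz τ f.2
    have hε' : Fc y f.2 ε L ⊆ site L (z + (τ : ℤ) • ee f.2) := by
      refine hε.trans (le_of_eq ?_)
      rw [site, smul_add, smul_smul, mul_comm]
    have hx : ∀ j : ℕ, ∃ x : Zd d, j < M → x ∈ K ∧ x ∈ sph y ((2 * r + 1) * (j + 1)) := by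
      intro j
      by_cases hj : j < M
      · have h1 : (2 * r + 1) * (j + 1) ≤ 3 * L := by
          have : (2 * r + 1) * (j + 1) ≤ (2 * r + 1) * M := Nat.mul_le_mul_left _ hj
          omega
        obtain ⟨x, hx1, hx2⟩ := Cls_meets_sph (V := V) (X := site L) (D := dom L) (U := U) (ω := ω₀)
          (y := y) i₀ (subset_refl (ball c (3 * L))) subset_rfl (hω₀ ▸ hyK)
          (n := (2 * r + 1) * (j + 1)) (by positivity) (by exact_mod_cast h1)
        exact ⟨x, fun _ => ⟨hω₀ ▸ hx1, hx2⟩⟩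
      · exact ⟨0, fun h => absurd h hj⟩
    choose x hx using hx
    refine le_trans (Pr_mono _ ?_) (attempt hV hS hq hf hk0 hk hη0 hfU hA (B := ball y L)
      (F := Fc y f.2 ε L) ((hz y hyz).trans hfV) (hz y hyz) ?_ ?_ ?_)
    · rintro ω ⟨h1, h2, h3⟩
      exact ⟨h1, h2, fun h => h3 (h.mono (Set.inter_subset_inter_left _ hε'))⟩
    · refine ⟨y, ?_, hyK⟩
      rcases hzf with rfl | rfl
      · exact .inl hyz
      · exact .inr hyz
    · rw [Set.disjoint_right]
      exact fun w hw hwK => hne ⟨w, hε' hw, hwK⟩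
    · refine le_trans (Pr_mono _ ?_) (hT y x (fun j hj => (hx j hj).2) f.2 ε)
      rintro ω h ⟨j, hj, hc⟩
      exact h ⟨x j, (hx j hj).1, hc⟩
  have hb : ∀ z ∈ ({f.1, f.1 + ee f.2} : Set (Zd d)), ∀ y ∈ site L z, ball y L ⊆ dom L f := by
    intro z hz y hy w hw k
    have h1 := hy k
    have h2 := hw k
    have h3 : |(L : ℤ) * z k - L * f.1 k| ≤ L := by
      rcases hz with rfl | rfl
      · simp
      · simp only [Pi.add_apply, ee_apply]
        split_ifs
        · rw [show (L : ℤ) * (f.1 k + 1) - L * f.1 k = L by ring]; simp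
        · simp
    simp only [Pi.smul_apply, smul_eq_mul] at h1 ⊢
    rw [abs_le] at *
    constructor <;> linarith [h1.1, h1.2, h2.1, h2.2, h3.1, h3.2]
  rcases hX with ⟨h1, h2⟩ | ⟨h1, h2⟩
  · have h3 := key f.1 1 (hb _ (by simp)) (by simp) h1 (by simpa using h2)
    refine le_trans (Pr_mono _ ?_) h3
    rintro ω ⟨hA', hK', hX'⟩
    refine ⟨hA', hK', ?_⟩
    have h4 : K ⊆ Cls V (ball c (3 * L)) (site L) (dom L) (insert f U) ω :=
      hK' ▸ Cls_mono (Finset.subset_insert _ _)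
    rcases hX' with h5 | h5
    · simpa using h5.2
    · exact absurd (h1.mono (Set.inter_subset_inter_right _ h4)) h5.1
  · have h3 := key (f.1 + ee f.2) (-1) (hb _ (by simp)) (by simp) h2 (by simpa using h1)
    refine le_trans (Pr_mono _ ?_) h3
    rintro ω ⟨hA', hK', hX'⟩
    refine ⟨hA', hK', ?_⟩
    have h4 : K ⊆ Cls V (ball c (3 * L)) (site L) (dom L) (insert f U) ω :=
      hK' ▸ Cls_mono (Finset.subset_insert _ _)
    rcases hX' with h5 | h5
    · exact absurd (h2.mono (Set.inter_subset_inter_right _ h4)) h5.2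
    · simpa using h5.1

end Geometry

section Layers
variable {d : ℕ}

open Classical in
/-- The attempts of `G` which may use the edge `e`. -/
noncomputable def atts (L : ℕ) (G : Finset (Att d)) (e : Sym2 (Zd d)) : Finset (Att d) :=
  G.filter fun f => e ∈ edgesIn (dom L f)

open Classical in
/-- The coordinates contributing to the edge `e`. -/
noncomputable def lay (L : ℕ) (G : Finset (Att d)) (e : Sym2 (Zd d)) : Finset (Ix d) :=
  insert (e, none) (insert (e, some none) ((atts L G e).image fun f => (e, some (some f))))

lemma fst_of_mem_lay {L : ℕ} {G : Finset (Att d)} {e : Sym2 (Zd d)} {i : Ix d} (h : i ∈ lay L G e) :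
    i.1 = e := by
  simp only [lay, Finset.mem_insert, Finset.mem_image] at h
  rcases h with rfl | rfl | ⟨f, -, rfl⟩ <;> rfl

open Classical in
/-- The union of all layers. -/
noncomputable def tot (L : ℕ) (G : Finset (Att d)) (ω : Ix d → Bool) : Config d :=
  fun e => decide (∃ i ∈ lay L G e, ω i = true)

lemma tot_eq_true {L : ℕ} {G : Finset (Att d)} {ω : Ix d → Bool} {e : Sym2 (Zd d)} :
    tot L G ω e = true ↔ ∃ i ∈ lay L G e, ω i = true := by simp [tot]

lemma tot_base {L : ℕ} {G : Finset (Att d)} {ω : Ix d → Bool} {e : Sym2 (Zd d)}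
    (h : ω (e, none) = true) : tot L G ω e = true :=
  tot_eq_true.2 ⟨_, by simp [lay], h⟩

lemma tot_tau {L : ℕ} {G : Finset (Att d)} {ω : Ix d → Bool} {e : Sym2 (Zd d)}
    (h : ω (e, some none) = true) : tot L G ω e = true :=
  tot_eq_true.2 ⟨_, by simp [lay], h⟩

lemma tot_att {L : ℕ} {G : Finset (Att d)} {ω : Ix d → Bool} {e : Sym2 (Zd d)} {f : Att d}
    (hf : f ∈ G) (he : e ∈ edgesIn (dom L f)) (h : ω (e, some (some f)) = true) :
    tot L G ω e = true :=
  tot_eq_true.2 ⟨_, by simp [lay, atts, hf, he], h⟩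

lemma detBy_tot (L : ℕ) (G : Finset (Att d)) (e : Sym2 (Zd d)) :
    DetBy (lay L G e : Set (Ix d)) fun ω => tot L G ω e := by
  intro ω ω' H
  rw [Bool.eq_iff_iff, tot_eq_true, tot_eq_true]
  exact exists_congr fun i => and_congr_right fun hi => by rw [H i hi]

lemma card_atts_le {L : ℕ} (hL : 0 < L) (G : Finset (Att d)) (e : Sym2 (Zd d)) :
    (atts L G e).card ≤ 7 ^ d * d := by
  classical
  induction e using Sym2.ind with | h v w => ?_
  have hc : ((ball_finite (0 : Zd d) 3).toFinset ×ˢ (Finset.univ : Finset (Fin d))).card = 7 ^ d * d := by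
    rw [Finset.card_product, Finset.card_univ, Fintype.card_fin]
    have := card_ball d 3
    norm_num at this
    rw [this]
  rw [← hc]
  refine Finset.card_le_card_of_injOn (fun f => (f.1 - fun k => v k / L, f.2)) ?_ ?_
  · intro f hf
    simp only [atts, Finset.coe_filter, Set.mem_ofPred_eq] at hf
    have h1 := (mk_mem_edgesIn.1 hf.2).1
    simp only [Finset.coe_product, Set.mem_prod, Finset.mem_coe, Set.Finite.mem_toFinset,
      Finset.mem_univ, and_true]
    intro k
    have h2 := h1 k
    simp only [Pi.smul_apply, Pi.sub_apply, smul_eq_mul, Pi.zero_apply, sub_zero] at h2 ⊢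
    have hL' : (0 : ℤ) < L := by exact_mod_cast hL
    have h3 := Int.emod_add_mul_ediv (v k) L
    have h4 := Int.emod_nonneg (v k) hL'.ne'
    have h5 := Int.emod_lt_of_pos (v k) hL'
    rw [abs_le] at h2 ⊢
    constructor
    · by_contra! h
      nlinarith [mul_le_mul_of_nonneg_left (show f.1 k - v k / L ≤ -4 by omega) hL'.le]
    · by_contra! h
      nlinarith [mul_le_mul_of_nonneg_left (show 4 ≤ f.1 k - v k / L by omega) hL'.le]
  · intro f _ g _ h
    simp only [Prod.mk.injEq, sub_left_inj] at h
    exact Prod.ext h.1 h.2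

/-- Decomposition of a percolation of parameter `p` into independent layers. -/
lemma exists_layers {L : ℕ} (hL : 0 < L) (G : Finset (Att d)) {p₀ p δ : I} (hp₀ : (p₀ : ℝ) < 1)
    (hδ : (δ : ℝ) < 1) (h : 1 - (p : ℝ) ≤ (1 - p₀) * (1 - (δ : ℝ)) ^ (7 ^ d * d + 1)) :
    ∃ q : Ix d → I, (∀ e, q (e, none) = p₀) ∧ (∀ e f, q (e, some (some f)) = δ) ∧
      (∀ e, δ ≤ q (e, some none)) ∧
      ∀ A, MeasurableSet A → Pb p A = Pr q {ω | tot L G ω ∈ A} := by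
  classical
  have h1 : (0 : ℝ) < 1 - p₀ := by linarith
  have h2 : (0 : ℝ) < 1 - δ := by linarith
  have h2' : (1 - δ : ℝ) ≤ 1 := by linarith [δ.2.1]
  have hD : ∀ e, 0 < (1 - (p₀ : ℝ)) * (1 - (δ : ℝ)) ^ (atts L G e).card := fun e => by positivity
  have hr : ∀ e, (1 - (p : ℝ)) / ((1 - (p₀ : ℝ)) * (1 - (δ : ℝ)) ^ (atts L G e).card) ≤ 1 - δ := by
    intro e
    rw [div_le_iff₀ (hD e)]
    refine h.trans ?_
    rw [mul_left_comm, ← pow_succ']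
    exact mul_le_mul_of_nonneg_left (pow_le_pow_of_le_one h2.le h2' (by
      have := card_atts_le hL G e; omega)) h1.le
  have hr0 : ∀ e, 0 ≤ (1 - (p : ℝ)) / ((1 - (p₀ : ℝ)) * (1 - (δ : ℝ)) ^ (atts L G e).card) :=
    fun e => div_nonneg (by linarith [p.2.2]) (hD e).le
  let r : Sym2 (Zd d) → I := fun e => ⟨1 - (1 - (p : ℝ)) /
    ((1 - (p₀ : ℝ)) * (1 - (δ : ℝ)) ^ (atts L G e).card), by linarith [hr e, δ.2.1], by linarith [hr0 e]⟩
  let q : Ix d → I := fun i => match i.2 with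
    | none => p₀
    | some none => r i.1
    | some (some _) => δ
  refine ⟨q, fun _ => rfl, fun _ _ => rfl, fun e => ?_, fun A hA => ?_⟩
  · change (δ : ℝ) ≤ r e
    simp only [r]
    linarith [hr e]
  · obtain ⟨h3, h4⟩ := map_PM (q := q) (q' := fun _ => p) (φ := tot L G)
      (fun e => (lay L G e : Set (Ix d))) (fun e => Finset.finite_toSet _) (detBy_tot L G)
      (fun k l hkl => by
        rw [Set.disjoint_left]
        intro i hi hi'
        exact hkl ((fst_of_mem_lay hi).symm.trans (fst_of_mem_lay hi'))) (fun e => by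
        have h5 : {ω | tot L G ω e = true} = {ω : Ix d → Bool | ∀ i ∈ lay L G e, ω i = false}ᶜ := by
          ext ω
          simp [tot_eq_true]
        have h6 : MeasurableSet {ω : Ix d → Bool | ∀ i ∈ lay L G e, ω i = false} := by
          refine DetBy.measurableSet (s := (lay L G e : Set (Ix d))) (Finset.finite_toSet _) ?_
          intro ω ω' H
          exact propext (forall₂_congr fun i hi => by rw [H i hi])
        rw [h5, Pr_compl _ h6, Pr_all_false, lay, Finset.prod_insert (by simp),
          Finset.prod_insert (by simp), Finset.prod_image (by simp)]
        simp only [q, r, Finset.prod_const]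
        have := hD e
        field_simp
        ring)
    exact Pr_map h3 h4 hA

lemma exists_delta {p₀ p : I} (h0 : 0 < (p₀ : ℝ)) (h : (p₀ : ℝ) < p) (J : ℕ) :
    ∃ (δ : I) (k : ℕ), k ≠ 0 ∧ 0 < (δ : ℝ) ∧ (δ : ℝ) < 1 ∧ (1 - (δ : ℝ)) ^ k = 1 - p₀ ∧
      1 - (p : ℝ) ≤ (1 - p₀) * (1 - (δ : ℝ)) ^ J := by
  have hp1 : (p₀ : ℝ) < 1 := h.trans_le p.2.2
  have h1 : (0 : ℝ) < 1 - p₀ := by linarith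
  have ht : Filter.Tendsto (fun k : ℕ => (1 - (p₀ : ℝ)) * (1 - (p₀ : ℝ)) ^ ((J : ℝ) / k)) Filter.atTop
      (nhds (1 - p₀)) := by
    have h2 : Filter.Tendsto (fun k : ℕ => (J : ℝ) / k) Filter.atTop (nhds 0) :=
      tendsto_const_div_atTop_nhds_zero_nat _
    have h3 := (Real.continuousAt_const_rpow (b := 0) h1.ne').tendsto.comp h2
    simpa using h3.const_mul (1 - (p₀ : ℝ))
  obtain ⟨k, hk, hk0⟩ := ((ht.eventually (lt_mem_nhds (show 1 - (p : ℝ) < 1 - p₀ by linarith))).and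
    (Filter.eventually_gt_atTop 0)).exists
  have hk' : (k : ℝ) ≠ 0 := by positivity
  have hx0 : 0 < (1 - (p₀ : ℝ)) ^ ((1 : ℝ) / k) := Real.rpow_pos_of_pos h1 _
  have hx1 : (1 - (p₀ : ℝ)) ^ ((1 : ℝ) / k) < 1 :=
    Real.rpow_lt_one h1.le (by linarith) (by positivity)
  refine ⟨⟨1 - (1 - (p₀ : ℝ)) ^ ((1 : ℝ) / k), by linarith, by linarith⟩, k, hk0.ne',
    by simpa using hx1, by simpa using hx0,
    ?_, ?_⟩
  · simp only [sub_sub_cancel]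
    rw [← Real.rpow_natCast, ← Real.rpow_mul h1.le, one_div_mul_cancel hk', Real.rpow_one]
  · simp only [sub_sub_cancel]
    rw [← Real.rpow_natCast, ← Real.rpow_mul h1.le, one_div_mul_eq_div]
    exact hk.le

end Layers

section Total
variable {d : ℕ} {V S : Set (Zd d)} {X : Zd d → Set (Zd d)} {L : ℕ}

lemma Conn_of_Cl {G : Finset (Att d)} {ω : Ix d → Bool} (hS : S ⊆ V) {x : Zd d}
    (h : Cl V S X (dom L) G ω x) : ∃ s ∈ S, Conn (tot L G ω) V s x := by
  induction h with
  | seed h => exact ⟨_, h, .refl (hS h)⟩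
  | base _ h1 h2 h3 ih =>
    obtain ⟨s, hs, hc⟩ := ih
    exact ⟨s, hs, hc.trans (.of_adj ⟨h1, tot_base h3⟩ hc.right h2)⟩
  | spr hf _ _ _ h1 h2 h3 h4 h5 _ ih =>
    obtain ⟨s, hs, hc⟩ := ih
    exact ⟨s, hs, hc.trans (.of_adj ⟨h1, tot_att hf (mk_mem_edgesIn.2 ⟨h2, h3⟩) h5⟩ hc.right h4)⟩

end Total

section Animals
variable {α : Type*} [DecidableEq α] (N : α → Finset α)

/-- Walks of length `n` from `v` with steps in the neighbourhoods `N`. -/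
def walks : ℕ → α → Finset (List α)
  | 0, v => {[v]}
  | n + 1, v => (N v).biUnion fun u => (walks n u).image (List.cons v)

lemma card_walks_le {Δ : ℕ} (h : ∀ v, (N v).card ≤ Δ) (n : ℕ) (v : α) :
    (walks N n v).card ≤ Δ ^ n := by
  induction n generalizing v with
  | zero => simp [walks]
  | succ n ih =>
    rw [walks, pow_succ']
    refine Finset.card_biUnion_le.trans ((Finset.sum_le_card_nsmul _ _ (Δ ^ n) fun u _ =>
      Finset.card_image_le.trans (ih u)).trans ?_)
    rw [smul_eq_mul]
    exact Nat.mul_le_mul_right _ (h v)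

variable {N} in
lemma mem_walks {n : ℕ} {v : α} {l : List α} (hl : List.IsChain (fun a b => b ∈ N a) (v :: l))
    (hn : l.length = n) : v :: l ∈ walks N n v := by
  induction l generalizing v n with
  | nil => subst hn; simp [walks]
  | cons u l ih =>
    subst hn
    rw [List.isChain_cons_cons] at hl
    simp only [List.length_cons, walks, Finset.mem_biUnion, Finset.mem_image, List.cons.injEq, true_and]
    exact ⟨u, hl.1, _, ih hl.2 rfl, rfl⟩

/-- `T` is connected for the relation `R`. -/
def RConn (R : α → α → Prop) (T : Finset α) : Prop :=
  ∀ x ∈ T, ∀ y ∈ T, Relation.ReflTransGen (fun a b => R a b ∧ a ∈ T ∧ b ∈ T) x y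

variable {N} in
lemma exists_walk {T : Finset α} (hs : ∀ a b, b ∈ N a → a ∈ N b)
    (hT : RConn (fun a b => b ∈ N a) T) {v : α} (hv : v ∈ T) :
    ∃ l ∈ walks N (2 * (T.card - 1)) v, l.toFinset = T := by
  have key : ∀ m, m + 1 ≤ T.card → ∃ l : List α, List.IsChain (fun a b => b ∈ N a) (v :: l) ∧
      l.length = 2 * m ∧ (v :: l).toFinset ⊆ T ∧ (v :: l).toFinset.card = m + 1 := by
    intro m
    induction m with
    | zero => exact fun _ => ⟨[], by simp, by simp, by simpa using hv, by simp⟩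
    | succ m ih =>
      intro hm
      obtain ⟨l, h1, h2, h3, h4⟩ := ih (by omega)
      obtain ⟨y, hyT, hy⟩ : ∃ y ∈ T, y ∉ (v :: l).toFinset := by
        by_contra! h
        have := Finset.card_le_card h
        omega
      obtain ⟨t, u, ht, hu, huT, htu⟩ : ∃ t u, t ∈ (v :: l).toFinset ∧ u ∉ (v :: l).toFinset ∧ u ∈ T ∧
          u ∈ N t := by
        by_contra! h
        refine hy ?_
        have hh := hT v hv y hyT
        clear hy
        induction hh with
        | refl => simp
        | tail _ hbc ih' =>
          by_contra hc
          exact h _ _ (ih' hbc.2.1) hc hbc.2.2 hbc.1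
      obtain ⟨l₁, l₂, hl⟩ := List.append_of_mem (List.mem_toFinset.1 ht)
      have h5 : List.IsChain (fun a b => b ∈ N a) (l₁ ++ t :: u :: t :: l₂) := by
        rw [hl, List.isChain_split] at h1
        rw [List.isChain_split]
        refine ⟨h1.1, ?_⟩
        rw [List.isChain_cons_cons, List.isChain_cons_cons]
        exact ⟨htu, hs _ _ htu, h1.2⟩
      obtain ⟨l', hl'⟩ : ∃ l', l₁ ++ t :: u :: t :: l₂ = v :: l' := by
        cases l₁ with
        | nil => simp only [List.nil_append, List.cons.injEq] at hl; exact ⟨_, by rw [hl.1]; rfl⟩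
        | cons a l₁ => simp only [List.cons_append, List.cons.injEq] at hl; exact ⟨_, by rw [hl.1]; rfl⟩
      have h6 : (v :: l').toFinset = insert u (v :: l).toFinset := by
        rw [← hl', hl]
        ext x
        simp only [List.mem_toFinset, List.mem_append, List.mem_cons, Finset.mem_insert]
        tauto
      refine ⟨l', hl' ▸ h5, ?_, ?_, ?_⟩
      · have e1 := congrArg List.length hl
        have e2 := congrArg List.length hl'
        simp only [List.length_append, List.length_cons] at e1 e2
        omega
      · rw [h6]; exact Finset.insert_subset huT h3
      · rw [h6, Finset.card_insert_of_notMem hu, h4]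
  have hpos := Finset.card_pos.2 ⟨v, hv⟩
  obtain ⟨l, h1, h2, h3, h4⟩ := key (T.card - 1) (by omega)
  exact ⟨_, mem_walks h1 h2, Finset.eq_of_subset_of_card_le h3 (by omega)⟩

/-- Union bound over connected sets containing a given point. -/
lemma Pr_exists_animal {ι : Type*} (q : ι → I) {Δ : ℕ} (hΔ1 : 1 ≤ Δ) (hΔ : ∀ v, (N v).card ≤ Δ)
    (hs : ∀ a b, b ∈ N a → a ∈ N b) (s : ℕ) {b : ℝ} (hb : 0 ≤ b) (A : Finset α → (ι → Bool) → Prop)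
    (hA : ∀ T : Finset α, T.card = s → Pr q {ω | A T ω} ≤ b) (v : α) :
    Pr q {ω | ∃ T : Finset α, v ∈ T ∧ T.card = s ∧ RConn (fun a b => b ∈ N a) T ∧ A T ω} ≤
      (Δ ^ 2 : ℝ) ^ s * b := by
  classical
  set F := ((walks N (2 * (s - 1)) v).image List.toFinset).filter (fun T => T.card = s)
  have h1 : Pr q {ω | ∃ T ∈ F, A T ω} ≤ (F.card : ℝ) * b := by
    refine (Pr_exists_le q F A).trans ((Finset.sum_le_card_nsmul _ _ b fun T hT =>
      hA T (Finset.mem_filter.1 hT).2).trans (by rw [nsmul_eq_mul]))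
  have h2 : F.card ≤ (Δ ^ 2) ^ s := by
    refine (Finset.card_filter_le _ _).trans (Finset.card_image_le.trans
      ((card_walks_le N hΔ _ v).trans ?_))
    rw [← pow_mul]
    exact Nat.pow_le_pow_right hΔ1 (by omega)
  refine (Pr_mono q ?_).trans (h1.trans (mul_le_mul_of_nonneg_right (by exact_mod_cast h2) hb))
  rintro ω ⟨T, hv, hT, hc, hAT⟩
  obtain ⟨l, hl, rfl⟩ := exists_walk hs hc hv
  exact ⟨_, Finset.mem_filter.2 ⟨Finset.mem_image.2 ⟨l, hT ▸ hl, rfl⟩, hT⟩, hAT⟩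

end Animals

section Topology
variable {d : ℕ}

lemma exists_primitive (a b : Zd d) (c : Zd d → Fin d → ZMod 2)
    (hc : ∀ x i j, i ≠ j → x ∈ Set.Icc a b → x + ee i + ee j ∈ Set.Icc a b →
      c x i + c (x + ee i) j = c x j + c (x + ee j) i) :
    ∃ h : Zd d → ZMod 2, ∀ x i, x ∈ Set.Icc a b → x + ee i ∈ Set.Icc a b →
      h (x + ee i) = h x + c x i := by
  classical
  suffices H : ∀ S : Finset (Fin d), ∃ h : Zd d → ZMod 2, ∀ x i, i ∈ S → (∀ k ∉ S, x k = a k) →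
      x ∈ Set.Icc a b → x + ee i ∈ Set.Icc a b → h (x + ee i) = h x + c x i by
    obtain ⟨h, hh⟩ := H Finset.univ
    exact ⟨h, fun x i => hh x i (Finset.mem_univ i) (by simp)⟩
  intro S
  induction S using Finset.induction_on with
  | empty => exact ⟨0, by simp⟩
  | insert m S hm ih =>
    obtain ⟨h, hh⟩ := ih
    let u : Zd d → ℤ → Zd d := fun x t => Function.update x m t
    refine ⟨fun x => h (u x (a m)) + ∑ t ∈ Finset.range (x m - a m).toNat, c (u x (a m + t)) m, ?_⟩
    intro x i hi hx hxI hxI'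
    have hxa : ∀ k, a k ≤ x k := hxI.1
    have hxb : ∀ k, x k ≤ b k := hxI.2
    have hxb' : ∀ k, (x + ee i : Zd d) k ≤ b k := hxI'.2
    by_cases him : i = m
    · subst him
      have h1 : ∀ t, u (x + ee i) t = u x t := by
        intro t; ext k
        by_cases hk : k = i
        · subst hk; simp [u]
        · simp [u, hk]
      have h2 : ((x + ee i : Zd d) i - a i).toNat = (x i - a i).toNat + 1 := by
        have := hxa i
        simp only [Pi.add_apply, Pi.single_eq_same]
        omega
      have h3 : u x (a i + ((x i - a i).toNat : ℤ)) = x := by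
        have := hxa i
        rw [Int.toNat_of_nonneg (by omega), add_sub_cancel]
        exact Function.update_eq_self i x
      simp only [h1, h2, Finset.sum_range_succ, h3, add_assoc]
    · have hiS : i ∈ S := (Finset.mem_insert.1 hi).resolve_left him
      have h1 : ∀ t, u (x + ee i) t = u x t + ee i := by
        intro t; ext k
        by_cases hk : k = m
        · subst hk; simp [u, Ne.symm him]
        · simp [u, hk]
      have h2 : (x + ee i : Zd d) m = x m := by simp [Ne.symm him]
      have hu : ∀ t, a m ≤ t → t ≤ b m → u x t ∈ Set.Icc a b ∧ u x t + ee i ∈ Set.Icc a b := by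
        intro t ht1 ht2
        rw [← h1]
        refine ⟨⟨fun k => ?_, fun k => ?_⟩, ⟨fun k => ?_, fun k => ?_⟩⟩ <;> by_cases hk : k = m
        all_goals first
          | (subst hk; simpa [u] using ht1)
          | (subst hk; simpa [u] using ht2)
          | (simp only [u, Function.update_of_ne hk]
             first | exact hxI.1 k | exact hxI.2 k | exact hxI'.1 k | exact hxI'.2 k)
      have key : ∀ n : ℕ, a m + n ≤ b m →
          h (u x (a m) + ee i) + ∑ t ∈ Finset.range n, c (u x (a m + t) + ee i) m =
          h (u x (a m)) + ∑ t ∈ Finset.range n, c (u x (a m + t)) m + c (u x (a m + n)) i := by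
        intro n
        induction n with
        | zero =>
          intro hn
          obtain ⟨h3, h4⟩ := hu (a m) le_rfl (by simpa using hn)
          have := hh (u x (a m)) i hiS (fun k hk => by
            by_cases hkm : k = m
            · subst hkm; simp [u]
            · simp only [u, Function.update_of_ne hkm]
              exact hx k (by simp [hkm, hk])) h3 h4
          simpa using this
        | succ n ih =>
          intro hn
          push_cast at hn
          have h5 := ih (by omega)
          have h6 : u x (a m + ((n + 1 : ℕ) : ℤ)) = u x (a m + n) + ee m := by
            ext k
            by_cases hk : k = m
            · subst hk; simp [u]; ring
            · simp [u, hk]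
          have h7 := hc (u x (a m + n)) i m him (hu _ (by omega) (by omega)).1 (by
            rw [add_right_comm, ← h6]
            exact (hu _ (by push_cast; omega) (by push_cast; omega)).2)
          rw [Finset.sum_range_succ, Finset.sum_range_succ, ← add_assoc, h5, h6]
          linear_combination h7
      have h8 := key (x m - a m).toNat (by have := hxa m; have := hxb m; omega)
      have h9 : u x (a m + ((x m - a m).toNat : ℤ)) = x := by
        have := hxa m
        rw [Int.toNat_of_nonneg (by omega), add_sub_cancel]
        exact Function.update_eq_self m x
      simp only [h1, h2]
      rw [h8, h9]

open Classical in
/-- Site edges of the box `B` separating `W` from its complement. -/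
noncomputable def cut (a b : Zd d) (W : Set (Zd d)) : Finset (Att d) :=
  (Finset.Icc a b ×ˢ Finset.univ).filter fun f =>
    f.1 + ee f.2 ∈ Set.Icc a b ∧ (f.1 ∈ W ↔ f.1 + ee f.2 ∉ W)

lemma mem_cut {a b : Zd d} {W : Set (Zd d)} {f : Att d} : f ∈ cut a b W ↔
    f.1 ∈ Set.Icc a b ∧ f.1 + ee f.2 ∈ Set.Icc a b ∧ (f.1 ∈ W ↔ f.1 + ee f.2 ∉ W) := by
  simp [cut, and_assoc]

/-- Edges with neighbouring base points. -/
noncomputable def nbr (f : Att d) : Finset (Att d) :=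
  (ball_finite f.1 1).toFinset ×ˢ Finset.univ

lemma mem_nbr {f g : Att d} : g ∈ nbr f ↔ g.1 ∈ ball f.1 1 := by simp [nbr]

lemma nbr_comm {f g : Att d} (h : g ∈ nbr f) : f ∈ nbr g := by
  rw [mem_nbr] at *; exact mem_ball_comm.1 h

lemma card_nbr (f : Att d) : (nbr f).card = 3 ^ d * d := by
  rw [nbr, Finset.card_product, Finset.card_univ, Fintype.card_fin]
  have h1 : (ball_finite f.1 1).toFinset = Finset.Icc (fun i => f.1 i - 1) (fun i => f.1 i + 1) := by
    ext y
    rw [Set.Finite.mem_toFinset, ball_eq_Icc]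
    simp [Pi.le_def]
  rw [h1, Pi.card_Icc]
  congr 1
  rw [Finset.prod_congr rfl (g := fun _ => 3) (fun i _ => by rw [Int.card_Icc]; omega)]
  simp

lemma rconn_cut {a b : Zd d} {W : Set (Zd d)}
    (h1 : ∀ x ∈ W, ∀ y ∈ W, Conn allOpen W x y)
    (h2 : ∀ x ∈ Set.Icc a b \ W, ∀ y ∈ Set.Icc a b \ W, Conn allOpen (Set.Icc a b \ W) x y)
    (hW : W ⊆ Set.Icc a b) : RConn (fun f g => g ∈ nbr f) (cut a b W) := by
  classical
  intro f hf g hg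
  by_contra hfg
  set P : Att d → Prop := fun g => Relation.ReflTransGen
    (fun f g => g ∈ nbr f ∧ f ∈ cut a b W ∧ g ∈ cut a b W) f g
  have hPc : ∀ e, P e → e ∈ cut a b W := by
    intro e he
    rcases Relation.ReflTransGen.cases_tail he with h | ⟨e', -, h⟩
    · exact h ▸ hf
    · exact h.2.2
  have hP : ∀ e e', P e → e' ∈ cut a b W → e' ∈ nbr e → P e' := fun e e' he he' hn =>
    he.tail ⟨hn, hPc e he, he'⟩
  let w : Zd d → ZMod 2 := fun x => if x ∈ W then 1 else 0
  have hcut : ∀ x i, x ∈ Set.Icc a b → x + ee i ∈ Set.Icc a b →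
      (if (x, i) ∈ cut a b W then (1 : ZMod 2) else 0) = w x + w (x + ee i) := by
    intro x i hx hx'
    simp only [mem_cut, hx, hx', true_and, w]
    by_cases h1 : x ∈ W <;> by_cases h2 : x + ee i ∈ W <;> simp [h1, h2]
    decide
  obtain ⟨h, hh⟩ := exists_primitive a b (fun x i => if P (x, i) then 1 else 0) (by
    intro x i j hij hx hx'
    have hm : ∀ k : Fin d, k = i ∨ k = j → x + ee k ∈ Set.Icc a b := by
      intro k hk
      have e1 : ∀ k l : Fin d, (0 : ℤ) ≤ (ee k : Zd d) l := by
        intro k l; by_cases h : l = k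
        · subst h; simp
        · simp [h]
      refine ⟨fun l => ?_, fun l => ?_⟩
      · have := e1 k l
        have h3 : a l ≤ x l := hx.1 l
        simp only [Pi.add_apply]; linarith
      · have := e1 i l
        have := e1 j l
        have h3 : (x + ee i + ee j : Zd d) l ≤ b l := hx'.2 l
        simp only [Pi.add_apply] at h3 ⊢
        rcases hk with rfl | rfl <;> linarith
    have hxi := hm i (.inl rfl)
    have hxj := hm j (.inr rfl)
    have hx'' : x + ee j + ee i ∈ Set.Icc a b := by rwa [add_right_comm]
    have hb : ∀ e e' : Att d, (e.1 = x ∨ e.1 = x + ee i ∨ e.1 = x + ee j) →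
        (e'.1 = x ∨ e'.1 = x + ee i ∨ e'.1 = x + ee j) → e' ∈ nbr e := by
      intro e e' h1 h2
      rw [mem_nbr]
      have e2 : ∀ k l : Fin d, 0 ≤ (ee k : Zd d) l ∧ (ee k : Zd d) l ≤ 1 := by
        intro k l; by_cases h : l = k
        · subst h; simp
        · simp [h]
      intro l
      have := e2 i l
      have := e2 j l
      rw [abs_le]
      rcases h1 with h1 | h1 | h1 <;> rcases h2 with h2 | h2 | h2 <;> rw [h1, h2] <;>
        simp only [Pi.add_apply, sub_self] <;> constructor <;> linarith
    by_cases hex : P (x, i) ∨ P (x + ee i, j) ∨ P (x, j) ∨ P (x + ee j, i)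
    · have h3 : ∀ e : Att d, (e.1 = x ∨ e.1 = x + ee i ∨ e.1 = x + ee j) →
          (P e ↔ e ∈ cut a b W) := by
        intro e he
        refine ⟨hPc e, fun h => ?_⟩
        rcases hex with h' | h' | h' | h' <;> exact hP _ _ h' h (hb _ _ (by simp) he)
      have e3 := h3 (x, i) (by simp)
      have e4 := h3 (x + ee i, j) (by simp)
      have e5 := h3 (x, j) (by simp)
      have e6 := h3 (x + ee j, i) (by simp)
      simp only [e3, e4, e5, e6, hcut x i hx hxi, hcut _ j hxi hx', hcut x j hx hxj,
        hcut _ i hxj hx'', add_right_comm x (ee j) (ee i)]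
      have h4 : ∀ t : ZMod 2, t + t = 0 := by decide
      linear_combination h4 (w (x + ee i)) - h4 (w (x + ee j))
    · push Not at hex
      simp [hex])
  have hconst : ∀ U ⊆ Set.Icc a b, (∀ f ∈ cut a b W, ¬ (f.1 ∈ U ∧ f.1 + ee f.2 ∈ U)) →
      ∀ x y, Conn allOpen U x y → h x = h y := by
    intro U hU hUc x y hxy
    refine hxy.induct (P := fun y => h x = h y) rfl fun u v hxu huv hv hu => hu.trans ?_
    have huU := hxu.right
    obtain ⟨i, rfl | rfl⟩ := latAdj_iff.1 huv.1
    · have h3 := hh u i (hU huU) (hU hv)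
      rw [if_neg (fun hp => hUc _ (hPc _ hp) ⟨huU, hv⟩), add_zero] at h3
      exact h3.symm
    · have h3 := hh v i (hU hv) (hU huU)
      rw [if_neg (fun hp => hUc _ (hPc _ hp) ⟨hv, huU⟩), add_zero] at h3
      exact h3
  have c1 : ∀ x ∈ W, ∀ y ∈ W, h x = h y := fun x hx y hy =>
    hconst W hW (fun e he => by have := (mem_cut.1 he).2.2; tauto) x y (h1 x hx y hy)
  have c2 : ∀ x ∈ Set.Icc a b \ W, ∀ y ∈ Set.Icc a b \ W, h x = h y := fun x hx y hy =>
    hconst _ Set.sdiff_subset (fun e he => by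
      have := (mem_cut.1 he).2.2
      simp only [Set.mem_sdiff]
      tauto) x y (h2 x hx y hy)
  have e1 := hh f.1 f.2 (mem_cut.1 hf).1 (mem_cut.1 hf).2.1
  have e2 := hh g.1 g.2 (mem_cut.1 hg).1 (mem_cut.1 hg).2.1
  rw [if_pos (show P (f.1, f.2) from .refl)] at e1
  rw [if_neg (show ¬ P (g.1, g.2) from hfg), add_zero] at e2
  have hne : ∀ t : ZMod 2, t ≠ t + 1 := by decide
  have hf' := mem_cut.1 hf
  have hg' := mem_cut.1 hg
  have key : ∀ x ∈ W, ∀ y ∈ Set.Icc a b \ W, h x = h y := by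
    intro x hx y hy
    by_cases h3 : g.1 ∈ W
    · rw [c1 x hx _ h3, ← e2]
      exact c2 _ ⟨hg'.2.1, hg'.2.2.1 h3⟩ y hy
    · have h4 : g.1 + ee g.2 ∈ W := by have := hg'.2.2; tauto
      rw [c1 x hx _ h4, e2]
      exact c2 _ ⟨hg'.1, h3⟩ y hy
  by_cases h3 : f.1 ∈ W
  · have := key _ h3 _ ⟨hf'.2.1, hf'.2.2.1 h3⟩
    rw [e1] at this
    exact hne _ this
  · have h4 : f.1 + ee f.2 ∈ W := by have := hf'.2.2; tauto
    have := key _ h4 _ ⟨hf'.1, h3⟩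
    rw [e1] at this
    exact hne _ this.symm

/-- The component of `z` in `B \ W`. -/
def comp (B W : Set (Zd d)) (z : Zd d) : Set (Zd d) := {y | Conn allOpen (B \ W) z y}

lemma comp_subset {B W : Set (Zd d)} {z : Zd d} : comp B W z ⊆ B \ W := fun _ h => h.right

lemma comp_conn {B W : Set (Zd d)} {z x y : Zd d} (hx : x ∈ comp B W z) (hy : y ∈ comp B W z) :
    Conn allOpen (comp B W z) x y := by
  have key : ∀ x, x ∈ comp B W z → Conn allOpen (comp B W z) z x := by
    intro x hx
    refine hx.induct (P := fun x => Conn allOpen (comp B W z) z x) (.refl (.refl hx.1)) ?_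
    intro u v hu huv hv ih
    exact ih.trans (.of_adj huv hu (hu.trans (.of_adj huv hu.right hv)))
  exact (key x hx).symm.trans (key y hy)

lemma comp_compl_conn {B W : Set (Zd d)} {z : Zd d} (hB : ∀ x ∈ B, ∀ y ∈ B, Conn allOpen B x y)
    (hWB : W ⊆ B) (hW : ∀ x ∈ W, ∀ y ∈ W, Conn allOpen W x y) {w₀ : Zd d} (hw₀ : w₀ ∈ W) :
    ∀ x ∈ B \ comp B W z, ∀ y ∈ B \ comp B W z, Conn allOpen (B \ comp B W z) x y := by
  have hsub : W ⊆ B \ comp B W z := fun x hx => ⟨hWB hx, fun h => (comp_subset h).2 hx⟩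
  have key : ∀ x ∈ B \ comp B W z, Conn allOpen (B \ comp B W z) w₀ x := by
    intro x hx
    refine (hB w₀ (hWB hw₀) x hx.1).induct
      (P := fun x => x ∉ comp B W z → Conn allOpen (B \ comp B W z) w₀ x)
      (fun _ => .refl (hsub hw₀)) ?_ hx.2
    intro u v _ huv hv ih hvc
    by_cases hvW : v ∈ W
    · exact (hW _ hw₀ _ hvW).mono hsub
    · have huc : u ∉ comp B W z := fun h => hvc (h.trans (.of_adj huv h.right ⟨hv, hvW⟩))
      exact (ih huc).trans (.of_adj huv (ih huc).right ⟨hv, hvc⟩)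
  exact fun x hx y hy => (key x hx).symm.trans (key y hy)

/-- Edges leaving the component end in the removed set. -/
lemma cut_comp {a b : Zd d} {W : Set (Zd d)} {z : Zd d} {f : Att d}
    (hf : f ∈ cut a b (comp (Set.Icc a b) W z)) :
    (f.1 ∈ W ∧ f.1 + ee f.2 ∈ comp (Set.Icc a b) W z) ∨
      (f.1 ∈ comp (Set.Icc a b) W z ∧ f.1 + ee f.2 ∈ W) := by
  obtain ⟨h1, h2, h3⟩ := mem_cut.1 hf
  have hadj : openAdj allOpen f.1 (f.1 + ee f.2) := openAdj_allOpen.2 (latAdj_add _ _)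
  by_cases h4 : f.1 ∈ comp (Set.Icc a b) W z
  · refine .inr ⟨h4, ?_⟩
    by_contra h5
    exact h3.1 h4 (h4.trans (.of_adj hadj h4.right ⟨h2, h5⟩))
  · have h6 : f.1 + ee f.2 ∈ comp (Set.Icc a b) W z := by tauto
    refine .inl ⟨?_, h6⟩
    by_contra h5
    exact h4 (h6.trans (.of_adj (openAdj_comm.1 hadj) h6.right ⟨h1, h5⟩))

end Topology

section Anchor
variable {d : ℕ}

/-- The box of points with `i₀`-coordinate in `[α, β]` and the others in `[-w, w]`. -/
def slab (i₀ : Fin d) (α β w : ℤ) : Set (Zd d) := {x | (α ≤ x i₀ ∧ x i₀ ≤ β) ∧ ∀ k, k ≠ i₀ → |x k| ≤ w}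

lemma slab_eq_Icc (i₀ : Fin d) (α β w : ℤ) : slab i₀ α β w =
    Set.Icc (fun k => if k = i₀ then α else -w) (fun k => if k = i₀ then β else w) := by
  ext x
  simp only [slab, Set.mem_ofPred_eq, Set.mem_Icc, Pi.le_def]
  constructor
  · rintro ⟨⟨h1, h2⟩, h3⟩
    refine ⟨fun k => ?_, fun k => ?_⟩ <;> by_cases hk : k = i₀
    · subst hk; simpa using h1
    · simpa [hk] using (abs_le.1 (h3 k hk)).1
    · subst hk; simpa using h2
    · simpa [hk] using (abs_le.1 (h3 k hk)).2
  · rintro ⟨h1, h2⟩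
    refine ⟨⟨by simpa using h1 i₀, by simpa using h2 i₀⟩, fun k hk => ?_⟩
    rw [abs_le]
    exact ⟨by simpa [hk] using h1 k, by simpa [hk] using h2 k⟩

lemma slab_finite (i₀ : Fin d) (α β w : ℤ) : (slab i₀ α β w).Finite := by
  rw [slab_eq_Icc]; exact Set.finite_Icc _ _

lemma conn_slab {i₀ : Fin d} {α β w : ℤ} {x y : Zd d} (hx : x ∈ slab i₀ α β w)
    (hy : y ∈ slab i₀ α β w) : Conn allOpen (slab i₀ α β w) x y := by
  rw [slab_eq_Icc] at *; exact conn_Icc hx hy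

lemma slab_mono {i₀ : Fin d} {α β w α' β' w' : ℤ} (h1 : α' ≤ α) (h2 : β ≤ β') (h3 : w ≤ w') :
    slab i₀ α β w ⊆ slab i₀ α' β' w' :=
  fun _ ⟨⟨a, b⟩, c⟩ => ⟨⟨h1.trans a, b.trans h2⟩, fun k hk => (c k hk).trans h3⟩

/-- Cut of a slab. -/
noncomputable def cutS (i₀ : Fin d) (α β w : ℤ) (W : Set (Zd d)) : Finset (Att d) :=
  cut (fun k => if k = i₀ then α else -w) (fun k => if k = i₀ then β else w) W

lemma mem_cutS {i₀ : Fin d} {α β w : ℤ} {W : Set (Zd d)} {f : Att d} : f ∈ cutS i₀ α β w W ↔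
    f.1 ∈ slab i₀ α β w ∧ f.1 + ee f.2 ∈ slab i₀ α β w ∧ (f.1 ∈ W ↔ f.1 + ee f.2 ∉ W) := by
  rw [cutS, mem_cut, slab_eq_Icc]

lemma cut_path {i₀ : Fin d} {α β w : ℤ} {U W : Set (Zd d)} {x y : Zd d}
    (hU : U ⊆ slab i₀ α β w)
    (hc : ∀ f ∈ cutS i₀ α β w W, ¬ (f.1 ∈ U ∧ f.1 + ee f.2 ∈ U)) (h : Conn allOpen U x y) :
    x ∈ W ↔ y ∈ W := by
  refine h.induct (P := fun y => x ∈ W ↔ y ∈ W) Iff.rfl fun u v hxu huv hv ih => ih.trans ?_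
  have hu := hxu.right
  obtain ⟨i, rfl | rfl⟩ := latAdj_iff.1 huv.1
  · by_contra hne
    exact hc (u, i) (mem_cutS.2 ⟨hU hu, hU hv, by tauto⟩) ⟨hu, hv⟩
  · by_contra hne
    exact hc (v, i) (mem_cutS.2 ⟨hU hv, hU hu, by tauto⟩) ⟨hv, hu⟩

lemma exists_vertical {i₀ : Fin d} {α β w : ℤ} {W : Set (Zd d)} {z : Zd d}
    (hz : z ∈ slab i₀ α β w) (n : ℕ) (hn : z i₀ + n ≤ β)
    (h : ¬ (z ∈ W ↔ z + (n : ℤ) • ee i₀ ∈ W)) :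
    ∃ t < n, (z + (t : ℤ) • ee i₀, i₀) ∈ cutS i₀ α β w W := by
  induction n with
  | zero => simp at h
  | succ n ih =>
    push_cast at hn
    by_cases hzn : z ∈ W ↔ z + (n : ℤ) • ee i₀ ∈ W
    · refine ⟨n, by omega, mem_cutS.2 ?_⟩
      have e : z + ((n + 1 : ℕ) : ℤ) • ee i₀ = z + (n : ℤ) • ee i₀ + ee i₀ := by
        push_cast; rw [add_smul, one_smul, add_assoc]
      rw [e] at h
      have hm : ∀ t : ℤ, 0 ≤ t → z i₀ + t ≤ β → z + t • ee i₀ ∈ slab i₀ α β w := by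
        intro t h0 ht
        have h1 := hz.1.1
        refine ⟨?_, fun k hk => by simpa [hk] using hz.2 k hk⟩
        simp only [Pi.add_apply, Pi.smul_apply, Pi.single_eq_same, smul_eq_mul, mul_one]
        omega
      refine ⟨hm n (by omega) (by omega), ?_, by tauto⟩
      have := hm ((n + 1 : ℕ) : ℤ) (by omega) (by push_cast; omega)
      rwa [e] at this
    · obtain ⟨t, ht, h1⟩ := ih (by omega) hzn
      exact ⟨t, by omega, h1⟩

/-- A small cut separating two points of the bottom face meets a short vertical segment above
one of them. -/
lemma exists_anchor {i₀ : Fin d} {α w : ℤ} {n : ℕ} {W : Set (Zd d)} {z₁ z₂ : Zd d}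
    (h1 : z₁ ∈ slab i₀ α (α + n) w) (h2 : z₂ ∈ slab i₀ α (α + n) w) (hz1 : z₁ i₀ = α) (hz2 : z₂ i₀ = α)
    (hW1 : z₁ ∉ W) (hW2 : z₂ ∈ W) (hs : (cutS i₀ α (α + n) w W).card ≤ n) :
    ∃ t ≤ (cutS i₀ α (α + n) w W).card,
      (z₁ + (t : ℤ) • ee i₀, i₀) ∈ cutS i₀ α (α + n) w W ∨
      (z₂ + (t : ℤ) • ee i₀, i₀) ∈ cutS i₀ α (α + n) w W := by
  set T₀ := cutS i₀ α (α + n) w W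
  obtain ⟨t, ht, hfree⟩ : ∃ t ≤ T₀.card, ∀ f ∈ T₀, ¬ (f.1 i₀ = α + t ∧ f.2 ≠ i₀) := by
    by_contra! hne
    have : Nonempty (Att d) := ⟨(z₁, i₀)⟩
    choose! g hg using hne
    have : (Finset.range (T₀.card + 1)).card ≤ T₀.card := by
      refine Finset.card_le_card_of_injOn g (fun t ht => (hg t ?_).1) ?_
      · simpa [Nat.lt_succ_iff] using ht
      · intro t ht t' ht' h
        have e1 := (hg t (by simpa [Nat.lt_succ_iff] using ht)).2.1
        have e2 := (hg t' (by simpa [Nat.lt_succ_iff] using ht')).2.1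
        rw [h] at e1
        omega
    simp at this
  have htn : (t : ℤ) ≤ n := by exact_mod_cast ht.trans hs
  have hlev : ∀ z ∈ slab i₀ α (α + n) w, z i₀ = α → z + (t : ℤ) • ee i₀ ∈ slab i₀ (α + t) (α + t) w := by
    intro z hz hzα
    refine ⟨?_, fun k hk => by simpa [hk] using hz.2 k hk⟩
    simp only [Pi.add_apply, Pi.smul_apply, Pi.single_eq_same, smul_eq_mul, mul_one]
    omega
  have hiff := cut_path (W := W) (U := slab i₀ (α + t) (α + t) w) (α := α) (β := α + n) (w := w)
    (slab_mono (by omega) (by omega) le_rfl) (by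
      rintro f hf ⟨hf1, hf2⟩
      refine hfree f hf ⟨le_antisymm hf1.1.2 hf1.1.1, fun h => ?_⟩
      have e1 := hf1.1
      have e2 := hf2.1
      rw [h] at e2
      simp only [Pi.add_apply, Pi.single_eq_same] at e2
      omega) (conn_slab (hlev z₁ h1 hz1) (hlev z₂ h2 hz2))
  by_cases h3 : z₁ + (t : ℤ) • ee i₀ ∈ W
  · obtain ⟨t', ht', h4⟩ := exists_vertical h1 t (by omega) (by tauto : ¬ (z₁ ∈ W ↔ _))
    exact ⟨t', by omega, .inl h4⟩
  · obtain ⟨t', ht', h4⟩ := exists_vertical h2 t (by omega) (by tauto : ¬ (z₂ ∈ W ↔ _))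
    exact ⟨t', by omega, .inr h4⟩

end Anchor

section Reach
variable {d : ℕ}

/-- Attempts inside a slab of sites. -/
noncomputable def attS (i₀ : Fin d) (α β w : ℤ) : Finset (Att d) :=
  (slab_finite i₀ α β w).toFinset ×ˢ Finset.univ

/-- If the site `z₂` is not reached there is a connected family of failed attempts. -/
lemma exists_failed {i₀ : Fin d} {α w : ℤ} {n : ℕ} {X : Zd d → Set (Zd d)} {K : Set (Zd d)}
    {z₁ z₂ : Zd d} (h1 : z₁ ∈ slab i₀ α (α + n) w) (h2 : z₂ ∈ slab i₀ α (α + n) w)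
    (hz1 : z₁ i₀ = α) (hz2 : z₂ i₀ = α) (hK1 : (X z₁ ∩ K).Nonempty) (hK2 : ¬ (X z₂ ∩ K).Nonempty) :
    ∃ T₀ : Finset (Att d), T₀.Nonempty ∧ RConn (fun f g => g ∈ nbr f) T₀ ∧
      (∀ f ∈ T₀, f.1 ∈ slab i₀ α (α + n) w ∧ f.1 + ee f.2 ∈ slab i₀ α (α + n) w ∧ Xo X f K) ∧
      (T₀.card ≤ n → ∃ t ≤ T₀.card, (z₁ + (t : ℤ) • ee i₀, i₀) ∈ T₀ ∨ (z₂ + (t : ℤ) • ee i₀, i₀) ∈ T₀) := by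
  set B := slab i₀ α (α + n) w
  set R : Set (Zd d) := {z | (X z ∩ K).Nonempty}
  set W₁ := comp B Rᶜ z₁
  set W := comp B W₁ z₂
  have hz1W : z₁ ∈ W₁ := .refl ⟨h1, by simpa [R] using hK1⟩
  have hW₁ : W₁ ⊆ B := fun x hx => (comp_subset hx).1
  have hz2W : z₂ ∈ W := .refl ⟨h2, fun h => by have := (comp_subset h).2; simp [R] at this; exact hK2 this⟩
  have hz1W' : z₁ ∉ W := fun h => (comp_subset h).2 hz1W
  have hcut : ∀ f ∈ cutS i₀ α (α + n) w W, f.1 ∈ B ∧ f.1 + ee f.2 ∈ B ∧ Xo X f K := by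
    intro f hf
    refine ⟨(mem_cutS.1 hf).1, (mem_cutS.1 hf).2.1, ?_⟩
    have hR : ∀ x ∈ W₁, (X x ∩ K).Nonempty := fun x hx => by
      have := (comp_subset hx).2; simpa [R] using this
    have hR' : ∀ x ∈ W₁, ∀ y ∈ W, latAdj x y → ¬ (X y ∩ K).Nonempty := by
      intro x hx y hy hxy hne
      exact (comp_subset hy).2 (hx.trans (.of_adj (openAdj_allOpen.2 hxy) hx.right
        ⟨(comp_subset hy).1, by simpa [R] using hne⟩))
    have h3 := hf
    simp only [cutS, W, B, slab_eq_Icc] at h3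
    have h4 := cut_comp h3
    rw [← slab_eq_Icc] at h4
    rcases h4 with ⟨h5, h6⟩ | ⟨h5, h6⟩
    · exact .inl ⟨hR _ h5, hR' _ h5 _ h6 (latAdj_add _ _)⟩
    · exact .inr ⟨hR' _ h6 _ h5 (latAdj_comm.1 (latAdj_add _ _)), hR _ h6⟩
  refine ⟨cutS i₀ α (α + n) w W, ?_, ?_, hcut, fun h => ?_⟩
  · by_contra hne
    rw [Finset.not_nonempty_iff_eq_empty] at hne
    have := cut_path (W := W) (U := B) (i₀ := i₀) (α := α) (β := α + n) (w := w) subset_rfl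
      (by rw [hne]; simp) (conn_slab h1 h2)
    tauto
  · refine rconn_cut (fun x hx y hy => comp_conn hx hy) ?_ ?_
    · rw [← slab_eq_Icc]
      exact comp_compl_conn (fun x hx y hy => conn_slab hx hy) hW₁ (fun x hx y hy => comp_conn hx hy)
        hz1W
    · rw [← slab_eq_Icc]
      exact fun x hx => (comp_subset hx).1
  · exact exists_anchor h1 h2 hz1 hz2 hz1W' hz2W h

/-- With small failure rate, a given site of the bottom face is reached with probability `≥ 1/2`. -/
lemma reach_prob {i₀ : Fin d} {α w : ℤ} {n : ℕ} {V S : Set (Zd d)} {X : Zd d → Set (Zd d)}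
    {D : Att d → Set (Zd d)} (hV : V.Finite) (hS : S ⊆ V) {q : Ix d → I} {η : ℝ} (hη : 0 ≤ η)
    (hη' : ((3 ^ d * d : ℕ) ^ 2 : ℝ) * η ≤ 1 / 64)
    {G : Finset (Att d)}
    (hGm : ∀ f : Att d, f.1 ∈ slab i₀ α (α + n) w → f.1 + ee f.2 ∈ slab i₀ α (α + n) w → f ∈ G)
    (hGc : G.card ≤ 2 ^ n)
    (hG : ∀ U f K A, f ∈ G → f ∉ U → DetBy (crd V U K) A → Xo X f K →
      (∃ ω, Cls V S X D U ω = K) →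
      Pr q {ω | A ω ∧ Cls V S X D U ω = K ∧ Xo X f (Cls V S X D (insert f U) ω)} ≤
        η * Pr q {ω | A ω ∧ Cls V S X D U ω = K})
    {z₁ z₂ : Zd d} (h1 : z₁ ∈ slab i₀ α (α + n) w) (h2 : z₂ ∈ slab i₀ α (α + n) w)
    (hz1 : z₁ i₀ = α) (hz2 : z₂ i₀ = α) (hX : X z₁ ⊆ S) (hX' : (X z₁).Nonempty) :
    Pr q {ω | ¬ (X z₂ ∩ Cls V S X D G ω).Nonempty} ≤ 1 / 2 := by
  classical
  set E : Finset (Att d) → (Ix d → Bool) → Prop := fun T₀ ω =>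
    T₀ ⊆ G ∧ ∀ f ∈ T₀, Xo X f (Cls V S X D G ω)
  let anc : ℕ → Finset (Att d) := fun s => if s ≤ n then
    (Finset.range (s + 1)).image (fun t : ℕ => ((z₁ + (t : ℤ) • ee i₀, i₀) : Att d)) ∪
    (Finset.range (s + 1)).image (fun t : ℕ => ((z₂ + (t : ℤ) • ee i₀, i₀) : Att d)) else G
  have hanc : ∀ s, (anc s).card ≤ 2 * 2 ^ s := by
    intro s
    simp only [anc]
    split_ifs with h
    · refine (Finset.card_union_le _ _).trans ?_
      have e1 := Finset.card_image_le (s := Finset.range (s + 1))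
        (f := fun t : ℕ => ((z₁ + (t : ℤ) • ee i₀, i₀) : Att d))
      have e2 := Finset.card_image_le (s := Finset.range (s + 1))
        (f := fun t : ℕ => ((z₂ + (t : ℤ) • ee i₀, i₀) : Att d))
      rw [Finset.card_range] at e1 e2
      have e3 := Nat.lt_two_pow_self (n := s)
      omega
    · have e4 : 2 ^ n ≤ 2 ^ s := Nat.pow_le_pow_right (by norm_num) (by omega)
      omega
  have hsub : {ω | ¬ (X z₂ ∩ Cls V S X D G ω).Nonempty} ⊆ {ω | ∃ s ∈ Finset.Icc 1 G.card,
      ∃ v ∈ anc s, ∃ T : Finset (Att d), v ∈ T ∧ T.card = s ∧ RConn (fun a b => b ∈ nbr a) T ∧ E T ω} := by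
    intro ω hω
    obtain ⟨T₀, hT₀, hc, hf, ha⟩ := exists_failed (X := X) (K := Cls V S X D G ω) h1 h2 hz1 hz2
      (hX'.mono (Set.subset_inter subset_rfl (hX.trans seed_subset_Cls))) hω
    have hT₀G : T₀ ⊆ G := fun f h => hGm f (hf f h).1 (hf f h).2.1
    refine ⟨T₀.card, Finset.mem_Icc.2 ⟨Finset.card_pos.2 hT₀, Finset.card_le_card hT₀G⟩, ?_⟩
    obtain ⟨v, hv, hvT₀⟩ : ∃ v ∈ anc T₀.card, v ∈ T₀ := by
      by_cases h : T₀.card ≤ n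
      · obtain ⟨t, ht, h3 | h3⟩ := ha h
        · refine ⟨_, ?_, h3⟩
          simp only [anc, h, if_true]
          exact Finset.mem_union_left _ (Finset.mem_image_of_mem _ (by simpa [Nat.lt_succ_iff] using ht))
        · refine ⟨_, ?_, h3⟩
          simp only [anc, h, if_true]
          exact Finset.mem_union_right _ (Finset.mem_image_of_mem _ (by simpa [Nat.lt_succ_iff] using ht))
      · obtain ⟨v, hv⟩ := hT₀
        exact ⟨v, by simp only [anc, h, if_false]; exact hT₀G hv, hv⟩
    exact ⟨v, hv, T₀, hvT₀, rfl, hc, hT₀G, fun f h => (hf f h).2.2⟩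
  have hE : ∀ s (T : Finset (Att d)), T.card = s → Pr q {ω | E T ω} ≤ η ^ s := by
    intro s T hT
    by_cases hTG : T ⊆ G
    · simp only [E, hTG, true_and]
      exact hT ▸ Pr_all_fail hV hS hη hG T hTG
    · have : {ω | E T ω} = ∅ := by ext ω; simp [E, hTG]
      rw [this, Pr_empty]; positivity
  have hd : 1 ≤ 3 ^ d * d := Nat.mul_pos (by positivity) (Fin.pos i₀)
  calc Pr q {ω | ¬ (X z₂ ∩ Cls V S X D G ω).Nonempty}
      ≤ ∑ s ∈ Finset.Icc 1 G.card, 2 * (1 / 32 : ℝ) ^ s := by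
        refine (Pr_mono q hsub).trans ((Pr_exists_le q _ _).trans (Finset.sum_le_sum fun s _ => ?_))
        refine (Pr_exists_le q _ _).trans ((Finset.sum_le_card_nsmul _ _ ((1 / 64 : ℝ) ^ s)
          fun v _ => ?_).trans ?_)
        · refine (Pr_exists_animal nbr q hd (fun v => (card_nbr v).le) (fun a b => nbr_comm) s
            (pow_nonneg hη s) E (hE s) v).trans ?_
          rw [← mul_pow]
          exact pow_le_pow_left₀ (by positivity) hη' s
        · rw [nsmul_eq_mul]
          have : ((anc s).card : ℝ) ≤ 2 * 2 ^ s := by exact_mod_cast hanc s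
          refine (mul_le_mul_of_nonneg_right this (by positivity)).trans (le_of_eq ?_)
          rw [mul_assoc, ← mul_pow]; norm_num
    _ ≤ 1 / 2 := by
        rw [← Finset.mul_sum]
        have h5 : ∑ s ∈ Finset.Icc 1 G.card, (1 / 32 : ℝ) ^ s ≤ 1 / 31 := by
          have h6 := Summable.sum_le_tsum (insert 0 (Finset.Icc 1 G.card)) (fun s _ => by positivity)
            (summable_geometric_of_lt_one (r := (1 / 32 : ℝ)) (by norm_num) (by norm_num))
          rw [tsum_geometric_of_lt_one (by norm_num) (by norm_num), Finset.sum_insert (by simp)] at h6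
          norm_num at h6 ⊢
          linarith
        linarith

end Reach

section Crossing
variable {d : ℕ}

lemma card_ball_center (c : Zd d) (n : ℕ) : (ball_finite c n).toFinset.card = (2 * n + 1) ^ d := by
  classical
  rw [← card_ball d n, ← Finset.card_image_of_injective
    (ball_finite (0 : Zd d) n).toFinset (tr c).injective]
  congr 1
  ext y
  have h := tr_image_ball c (0 : Zd d) n
  rw [zero_add] at h
  have := Set.ext_iff.1 h y
  simp only [Set.Finite.mem_toFinset, Finset.mem_image, Set.mem_image] at this ⊢
  exact this.symm

lemma card_edgesIn_ball (c : Zd d) (n : ℕ) :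
    (edgesIn_finite (ball_finite c n)).toFinset.card ≤ ((2 * n + 1) ^ d) ^ 2 := by
  classical
  rw [← card_ball_center c n, sq, ← Finset.card_product]
  refine le_trans (Finset.card_le_card ?_)
    (Finset.card_image_le (f := fun p : Zd d × Zd d => s(p.1, p.2)))
  intro e he
  rw [Set.Finite.mem_toFinset] at he
  induction e using Sym2.ind with
  | _ x y =>
    rw [mk_mem_edgesIn] at he
    exact Finset.mem_image.2 ⟨(x, y), by simpa using he, rfl⟩

lemma slab_subset_ball (i₀ : Fin d) {α β w m : ℤ} (h1 : -m ≤ α) (h2 : β ≤ m) (h3 : w ≤ m) :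
    slab i₀ α β w ⊆ ball 0 m := by
  intro x ⟨⟨h4, h5⟩, h6⟩ i
  simp only [Pi.zero_apply, sub_zero]
  by_cases h : i = i₀
  · subst h; exact abs_le.2 ⟨h1.trans h4, h5.trans h2⟩
  · exact (h6 i h).trans h3

lemma card_attS_le (i₀ : Fin d) (w m : ℕ) {α β : ℤ} (h1 : -m ≤ α) (h2 : β ≤ m) (h3 : w ≤ m) :
    (attS i₀ α β w).card ≤ (2 * m + 1) ^ d * d := by
  rw [attS, Finset.card_product, ← card_ball d m]
  simp only [Finset.card_univ, Fintype.card_fin]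
  refine Nat.mul_le_mul_right _ (Finset.card_le_card ?_)
  rw [Set.Finite.toFinset_subset_toFinset]
  exact slab_subset_ball i₀ h1 h2 (by exact_mod_cast h3)

lemma open_of_all {L : ℕ} {G : Finset (Att d)} {ω : Ix d → Bool} {c x y : Zd d} {n : ℤ}
    (h : ∀ e ∈ edgesIn (ball c n), ω (e, some none) = true) (hx : x ∈ ball c n) (hy : y ∈ ball c n) :
    Conn (tot L G ω) (ball c n) x y := by
  obtain ⟨h1, h2⟩ := conn_ball hx hy
  refine ⟨h1, Relation.ReflTransGen.mono (fun a b ⟨hab, ha, hb⟩ => ⟨⟨hab.1, ?_⟩, ha, hb⟩) _ _ h2⟩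
  exact tot_tau (h _ (mk_mem_edgesIn.2 ⟨ha, hb⟩))

/-- Two points of the bottom face of a slab of logarithmic thickness are connected inside the slab
with probability bounded below. -/
lemma exists_slab_conn {p : I} (hp : pc d < p) (hd : 0 < d) :
    ∃ L : ℕ, 1 ≤ L ∧ ∃ c₁ : ℝ, 0 < c₁ ∧ ∀ (i₀ : Fin d) (n w : ℕ),
      (2 * (n + w + 3) + 1) ^ d * d ≤ 2 ^ n → ∀ u₁ u₂ : Zd d, u₁ i₀ = 0 → u₂ i₀ = 0 →
      (∀ k, k ≠ i₀ → |u₁ k| ≤ L * w) → (∀ k, k ≠ i₀ → |u₂ k| ≤ L * w) →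
      c₁ ≤ Pb p {ω : Config d | Conn ω (slab i₀ 0 ((n + 6) * L) ((w + 3) * L)) u₁ u₂} := by
  classical
  have hpc := pc_nonneg d
  have hp1 := p.2.2
  obtain ⟨p₀, hp₀⟩ : ∃ p₀ : I, (p₀ : ℝ) = (pc d + p) / 2 :=
    ⟨⟨(pc d + p) / 2, by constructor <;> linarith⟩, rfl⟩
  obtain ⟨δ, k, hk0, hδ0, hδ1, hk, hJ⟩ := exists_delta (p₀ := p₀) (p := p) (by linarith)
    (by linarith) (7 ^ d * d + 1)
  have hdd : 0 < 3 ^ d * d := Nat.mul_pos (by positivity) hd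
  have hdR : (0 : ℝ) < (3 ^ d * d : ℕ) := by exact_mod_cast hdd
  obtain ⟨η, hη⟩ : ∃ η : ℝ, η = 1 / 64 / ((3 ^ d * d : ℕ) ^ 2 : ℝ) := ⟨_, rfl⟩
  have hη0 : 0 < η := by rw [hη]; positivity
  obtain ⟨M, r, L₀, hL₀⟩ := exists_reach (p := p₀) (by linarith) ⟨0, hd⟩ (pow_pos hη0 k)
  set L := max L₀ 1
  obtain ⟨hML, hT⟩ := hL₀ L (le_max_left _ _)
  have hL : 1 ≤ L := le_max_right _ _
  have hL' : (1 : ℤ) ≤ L := by exact_mod_cast hL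
  set m := 2 * ((2 * (3 * L) + 1) ^ d) ^ 2
  refine ⟨L, hL, (δ : ℝ) ^ m * (1 / 2), by positivity, ?_⟩
  intro i₀ n w hnw u₁ u₂ hu₁ hu₂ hw₁ hw₂
  set V := slab i₀ 0 ((n + 6) * L) ((w + 3) * L)
  have hV : V.Finite := slab_finite _ _ _ _
  set zz : Zd d → Zd d := fun u k => if k = i₀ then 3 else u k / L
  have hz : ∀ u : Zd d, (∀ k, k ≠ i₀ → |u k| ≤ L * w) → zz u ∈ slab i₀ 3 (3 + n) w := by
    intro u hu
    refine ⟨by simp [zz], fun k hki => ?_⟩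
    have h1 := abs_le.1 (hu k hki)
    simp only [zz, if_neg hki]
    rw [abs_le]
    constructor
    · refine Int.le_ediv_of_mul_le (by omega) ?_
      linarith
    · have := Int.ediv_le_ediv (c := (L : ℤ)) (by omega) h1.2
      rwa [Int.mul_ediv_cancel_left _ (by omega)] at this
  have huz : ∀ u : Zd d, u i₀ = 0 → u ∈ ball ((L : ℤ) • zz u) (3 * L) := by
    intro u hu k
    by_cases hki : k = i₀
    · subst hki
      simp only [zz, Pi.smul_apply, smul_eq_mul, hu, if_true]
      rw [abs_le]; omega
    · simp only [zz, Pi.smul_apply, smul_eq_mul, if_neg hki]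
      have h1 := Int.emod_add_mul_ediv (u k) L
      have h2 := Int.emod_nonneg (u k) (b := L) (by omega)
      have h3 := Int.emod_lt_of_pos (u k) (b := L) (by omega)
      rw [abs_le]; constructor <;> linarith
  have hbV : ∀ z ∈ slab i₀ 3 (3 + n) w, ball ((L : ℤ) • z) (3 * L) ⊆ V := by
    intro z hz x hx
    refine ⟨?_, fun k hki => ?_⟩
    · have h1 := abs_le.1 (hx i₀)
      simp only [Pi.smul_apply, smul_eq_mul] at h1
      obtain ⟨h2, h3⟩ := hz.1
      constructor <;> nlinarith
    · have h1 := abs_le.1 (hx k)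
      simp only [Pi.smul_apply, smul_eq_mul] at h1
      have h2 := abs_le.1 (hz.2 k hki)
      rw [abs_le]
      constructor <;> nlinarith
  obtain ⟨z₁, hz₁⟩ : ∃ z, z = zz u₁ := ⟨_, rfl⟩
  obtain ⟨z₂, hz₂⟩ : ∃ z, z = zz u₂ := ⟨_, rfl⟩
  have h1 := hz₁ ▸ hz u₁ hw₁
  have h2 := hz₂ ▸ hz u₂ hw₂
  have hu1 := hz₁ ▸ huz u₁ hu₁
  have hu2 := hz₂ ▸ huz u₂ hu₂
  set G : Finset (Att d) := (attS i₀ 3 (3 + n) w).filter fun f => f.1 + ee f.2 ∈ slab i₀ 3 (3 + n) w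
  have hGmem : ∀ f : Att d, f ∈ G ↔ f.1 ∈ slab i₀ 3 (3 + n) w ∧ f.1 + ee f.2 ∈ slab i₀ 3 (3 + n) w := by
    intro f; simp [G, attS]
  have hGc : G.card ≤ 2 ^ n := by
    refine (Finset.card_filter_le _ _).trans ((card_attS_le i₀ w (n + w + 3) ?_ ?_ ?_).trans hnw)
    all_goals push_cast; omega
  obtain ⟨q, hq0, hqf, hqτ, hq⟩ := exists_layers (L := L) (by omega) G (p₀ := p₀) (p := p) (δ := δ)
    (by linarith) hδ1 hJ
  set S := ball ((L : ℤ) • z₁) (3 * L)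
  have hS : S ⊆ V := hbV z₁ h1
  have hdetV : DetBy (edgesIn V) fun ω : Config d => Conn ω V u₁ u₂ := detBy_conn V u₁ u₂
  rw [hq _ (hdetV.measurableSet (edgesIn_finite hV))]
  have hfail := reach_prob (X := site L) (D := dom L) (S := S) hV hS (q := q) hη0.le
    (by rw [hη]; field_simp; exact le_rfl) (G := G) (fun f a b => (hGmem f).2 ⟨a, b⟩) hGc
    (fun U f K A hfG hfU hA hX hK => attempt_site ⟨0, hd⟩ hML hk0 hη0.le hT hk hV hS hq0
      (fun e => hqf e f) (hbV _ ((hGmem f).1 hfG).1) hfU hA hX hK)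
    h1 h2 (by rw [hz₁]; simp [zz]) (by rw [hz₂]; simp [zz]) (ball_mono _ (by omega))
    ⟨_, self_mem_ball _ (by omega)⟩
  set EE : Finset (Sym2 (Zd d)) := (edgesIn_finite (ball_finite ((L : ℤ) • z₁) (3 * L))).toFinset ∪
    (edgesIn_finite (ball_finite ((L : ℤ) • z₂) (3 * L))).toFinset
  have hEE : EE.card ≤ m := by
    refine (Finset.card_union_le _ _).trans ?_
    have e1 := card_edgesIn_ball ((L : ℤ) • z₁) (3 * L)
    have e2 := card_edgesIn_ball ((L : ℤ) • z₂) (3 * L)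
    push_cast at e1 e2
    omega
  set T : Finset (Ix d) := EE.image fun e => (e, some none)
  have hT1 : (δ : ℝ) ^ m ≤ Pr q {ω | ∀ e ∈ T, ω e = true} := by
    rw [Pr_all_true]
    calc (δ : ℝ) ^ m ≤ (δ : ℝ) ^ EE.card := pow_le_pow_of_le_one hδ0.le hδ1.le hEE
      _ = ∏ e ∈ T, (δ : ℝ) := by
        rw [Finset.prod_const, Finset.card_image_of_injective]
        exact fun a b h => (Prod.ext_iff.1 h).1
      _ ≤ _ := by
        refine Finset.prod_le_prod (fun _ _ => hδ0.le) fun e he => ?_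
        obtain ⟨e', -, rfl⟩ := Finset.mem_image.1 he
        exact_mod_cast hqτ e'
  have hdT : DetBy (T : Set (Ix d)) fun ω : Ix d → Bool => ∀ e ∈ T, ω e = true := by
    intro ω ω' H
    refine propext (forall₂_congr fun e he => ?_)
    rw [H e he]
  have hdC : DetBy (crd V G V) fun ω : Ix d → Bool => (site L z₂ ∩ Cls V S (site L) (dom L) G ω).Nonempty :=
    (detBy_Cls_fun hS).comp fun K : Set (Zd d) => (site L z₂ ∩ K).Nonempty
  have hmC := hdC.measurableSet (crd_finite hV)
  have hreach : 1 / 2 ≤ Pr q {ω | (site L z₂ ∩ Cls V S (site L) (dom L) G ω).Nonempty} := by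
    have := Pr_compl q hmC
    change Pr q {ω | ¬ (site L z₂ ∩ Cls V S (site L) (dom L) G ω).Nonempty} = _ at this
    linarith
  calc (δ : ℝ) ^ m * (1 / 2) ≤ Pr q {ω | ∀ e ∈ T, ω e = true} *
        Pr q {ω | (site L z₂ ∩ Cls V S (site L) (dom L) G ω).Nonempty} :=
        mul_le_mul hT1 hreach (by norm_num) (Pr_nonneg _ _)
    _ = Pr q {ω | (∀ e ∈ T, ω e = true) ∧ (site L z₂ ∩ Cls V S (site L) (dom L) G ω).Nonempty} := by
        refine (Pr_and T.finite_toSet (crd_finite hV) hdT hdC ?_ q).symm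
        rw [Set.disjoint_left]
        rintro _ h ⟨-, -, h3⟩
        obtain ⟨e, -, rfl⟩ := Finset.mem_image.1 (Finset.mem_coe.1 h)
        simp at h3
    _ ≤ _ := by
        refine Pr_mono q ?_
        rintro ω ⟨hω1, x, hx1, hx2⟩
        have hτ : ∀ z, (z = z₁ ∨ z = z₂) → ∀ e ∈ edgesIn (ball ((L : ℤ) • z) (3 * L)),
            ω (e, some none) = true := by
          intro z hz e he
          refine hω1 _ (Finset.mem_image_of_mem _ ?_)
          rcases hz with rfl | rfl
          · exact Finset.mem_union_left _ (by simpa using he)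
          · exact Finset.mem_union_right _ (by simpa using he)
        obtain ⟨s, hs, hsx⟩ := Conn_of_Cl hS hx2
        have c1 := (open_of_all (G := G) (L := L) (hτ z₁ (.inl rfl)) hu1 hs).mono hS
        have c3 := (open_of_all (G := G) (L := L) (hτ z₂ (.inr rfl))
          (ball_mono _ (by omega) hx1) hu2).mono (hbV z₂ h2)
        exact (c1.trans hsx).trans c3

end Crossing

section Conditioning
variable {ι β : Type*}

lemma Pr_and_le {q : ι → I} {s : Set ι} (hs : s.Finite) {f : (ι → Bool) → β} (hf : DetBy s f)
    {A : (ι → Bool) → Prop} (hA : DetBy s A) {t : β → Set ι} (ht : ∀ b, (t b).Finite)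
    {B : β → (ι → Bool) → Prop} (hB : ∀ b, DetBy (t b) (B b))
    (hd : ∀ ω, A ω → Disjoint s (t (f ω))) {c : ℝ}
    (hc : ∀ ω, A ω → Pr q {ω' | B (f ω) ω'} ≤ c) :
    Pr q {ω | A ω ∧ B (f ω) ω} ≤ c * Pr q {ω | A ω} := by
  set T := (hf.finite_range hs).toFinset
  have hT : ∀ ω, f ω ∈ T := fun ω => by simp [T]
  rw [Pr_partition hs hf T hT, Pr_partition hs hf T hT {ω | A ω}, Finset.mul_sum]
  refine Finset.sum_le_sum fun b _ => ?_
  by_cases hb : ∃ ω, A ω ∧ f ω = b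
  · obtain ⟨ω₀, hω₀, rfl⟩ := hb
    have e : {ω | ω ∈ {ω | A ω ∧ B (f ω) ω} ∧ f ω = f ω₀} =
        {ω | (A ω ∧ f ω = f ω₀) ∧ B (f ω₀) ω} := by
      ext ω
      constructor
      · rintro ⟨⟨h1, h2⟩, h3⟩; exact ⟨⟨h1, h3⟩, h3 ▸ h2⟩
      · rintro ⟨⟨h1, h3⟩, h2⟩; exact ⟨⟨h1, h3 ▸ h2⟩, h3⟩
    rw [e, Pr_and hs (ht _) (hA.and (hf.comp (· = f ω₀))) (hB _) (hd _ hω₀), mul_comm]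
    exact mul_le_mul_of_nonneg_right (hc _ hω₀) (Pr_nonneg _ _)
  · have e : ∀ P : (ι → Bool) → Prop, (∀ ω, P ω → A ω) → Pr q {ω | P ω ∧ f ω = b} = 0 := by
      intro P hP
      have : {ω | P ω ∧ f ω = b} = ∅ := by
        ext ω
        simp only [Set.mem_ofPred_eq, Set.mem_empty_iff_false, iff_false, not_and]
        exact fun h1 h2 => hb ⟨ω, hP ω h1, h2⟩
      rw [this, Pr_empty]
    rw [show Pr q {ω | ω ∈ {ω | A ω ∧ B (f ω) ω} ∧ f ω = b} = 0 from e _ fun ω h => h.1,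
      show Pr q {ω | ω ∈ {ω | A ω} ∧ f ω = b} = 0 from e _ fun ω h => h, mul_zero]

end Conditioning

section Layers
variable {d : ℕ}

/-- The half-space of points with `i₀`-coordinate at most `h`. -/
def low (i₀ : Fin d) (h : ℤ) : Set (Zd d) := {x | x i₀ ≤ h}

/-- The level set of the `i₀`-coordinate. -/
def lev (i₀ : Fin d) (h : ℤ) : Set (Zd d) := {x | x i₀ = h}

/-- Both points reach level `h`, but they are not connected below it. -/
def Apart (i₀ : Fin d) (N M h : ℤ) (x y : Zd d) (ω : Config d) : Prop :=
  CT ω (ball 0 N ∩ low i₀ h) x (lev i₀ h) ∧ CT ω (ball 0 N ∩ low i₀ h) y (lev i₀ h) ∧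
    ¬ Conn ω (ball 0 M ∩ low i₀ h) x y

lemma CT_lower {i₀ : Fin d} {N h h' : ℤ} {x : Zd d} {ω : Config d} (hx : x i₀ ≤ h) (hh : h ≤ h')
    (hc : CT ω (ball 0 N) x (lev i₀ h')) : CT ω (ball 0 N ∩ low i₀ h) x (lev i₀ h) := by
  obtain ⟨z, hz, hxz⟩ := hc
  by_cases hf : ∃ u v, Conn ω (ball 0 N ∩ low i₀ h) x u ∧ openAdj ω u v ∧ v ∈ ball 0 N ∧ v ∉ low i₀ h
  · obtain ⟨u, v, h1, h2, h3, h4⟩ := hf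
    refine ⟨u, ?_, h1⟩
    have e1 : u i₀ ≤ h := h1.right.2
    have e2 : ¬ v i₀ ≤ h := h4
    have e3 := abs_le.1 (h2.1.abs_le i₀)
    change u i₀ = h
    omega
  · have hzl : z ∈ low i₀ h := by
      by_contra hz'
      exact hf (hxz.exit hx hz')
    refine ⟨z, ?_, ?_⟩
    · have e1 : z i₀ ≤ h := hzl
      have e2 : z i₀ = h' := hz
      change z i₀ = h
      omega
    · refine (hxz.induct (P := fun y => Conn ω (ball 0 N ∩ low i₀ h) x y) (.refl ⟨hxz.1, hx⟩) ?_)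
      intro a b _ hab hb ha
      refine ha.trans (.of_adj hab ha.right ⟨hb, ?_⟩)
      by_contra hbl
      exact hf ⟨a, b, ha, hab, hb, hbl⟩

open Classical in
/-- A point of a set (the origin if the set is empty). -/
noncomputable def pick (P : Set (Zd d)) : Zd d := if h : P.Nonempty then h.choose else 0

lemma pick_mem {P : Set (Zd d)} (h : P.Nonempty) : pick P ∈ P := by
  rw [pick, dif_pos h]; exact h.choose_spec

/-- The points of `F` reached from `x`. -/
def hits (ω : Config d) (V : Set (Zd d)) (x : Zd d) (F : Set (Zd d)) : Set (Zd d) :=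
  {z | z ∈ F ∧ Conn ω V x z}

lemma detBy_hits (V : Set (Zd d)) (x : Zd d) (F : Set (Zd d)) :
    DetBy (edgesIn V) fun ω => hits ω V x F := by
  intro ω ω' H
  ext z
  exact and_congr Iff.rfl (iff_of_eq (detBy_conn V x z ω ω' H))

lemma slab_shift (i₀ : Fin d) (α β w a : ℤ) :
    tr (a • ee i₀) '' slab i₀ α β w = slab i₀ (α + a) (β + a) w := by
  ext y
  rw [Equiv.image_eq_preimage_symm]
  have : ∀ k, (tr (a • ee i₀)).symm y k = y k - (a • ee i₀ : Zd d) k := fun k => by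
    simp [tr, sub_eq_add_neg]
  simp only [Set.mem_preimage, slab, Set.mem_ofPred_eq, this]
  refine and_congr ?_ (forall₂_congr fun k hk => ?_)
  · simp only [Pi.smul_apply, Pi.single_eq_same, smul_eq_mul, mul_one]
    constructor <;> rintro ⟨h1, h2⟩ <;> constructor <;> omega
  · simp [hk]

lemma Apart_step {p : I} {i₀ : Fin d} {N M h θ W : ℤ} {c₁ : ℝ} (hc₁ : 0 ≤ c₁)
    (hslab : ∀ u₁ u₂ : Zd d, u₁ i₀ = 0 → u₂ i₀ = 0 → (∀ k, k ≠ i₀ → |u₁ k| ≤ N) →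
      (∀ k, k ≠ i₀ → |u₂ k| ≤ N) → c₁ ≤ Pb p {ω : Config d | Conn ω (slab i₀ 0 θ W) u₁ u₂})
    (hNM : N ≤ M) (hWM : W ≤ M) (hθ : 0 ≤ θ) (hh : -M ≤ h) (hhM : h + (θ + 1) ≤ M) {x y : Zd d}
    (hx : x i₀ ≤ h) (hy : y i₀ ≤ h) :
    Pb p {ω | Apart i₀ N M (h + (θ + 1)) x y ω} ≤ (1 - p ^ 2 * c₁) * Pb p {ω | Apart i₀ N M h x y ω} := by
  classical
  set h' := h + (θ + 1) with hh'
  set V₀ := ball (0 : Zd d) N ∩ low i₀ h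
  set V₁ := ball (0 : Zd d) M ∩ low i₀ h
  have hV : V₀ ⊆ V₁ := Set.inter_subset_inter_left _ (ball_mono _ hNM)
  have hV₁ : V₁.Finite := (ball_finite _ _).subset Set.inter_subset_left
  set S := slab i₀ (h + 1) h' W
  have hS : S ⊆ ball 0 M ∩ low i₀ h' := fun z hz =>
    ⟨slab_subset_ball i₀ (by omega) hhM hWM hz, hz.1.2⟩
  let f : Config d → Zd d × Zd d := fun ω => (pick (hits ω V₀ x (lev i₀ h)), pick (hits ω V₀ y (lev i₀ h)))
  have hf : DetBy (edgesIn V₁) f :=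
    (((detBy_hits V₀ x (lev i₀ h)).comp pick).comp₂ ((detBy_hits V₀ y (lev i₀ h)).comp pick)
      Prod.mk).mono (edgesIn_mono hV)
  let E : Zd d × Zd d → Finset (Sym2 (Zd d)) := fun b => {s(b.1, b.1 + ee i₀), s(b.2, b.2 + ee i₀)}
  let B : Zd d × Zd d → Config d → Prop := fun b ω =>
    (∀ e ∈ E b, ω e = true) ∧ Conn ω S (b.1 + ee i₀) (b.2 + ee i₀)
  have hdE : ∀ b, DetBy (E b : Set (Sym2 (Zd d))) fun ω : Config d => ∀ e ∈ E b, ω e = true :=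
    fun b ω ω' H => propext (forall₂_congr fun e he => by rw [H e he])
  have hB : ∀ b, DetBy ((E b : Set (Sym2 (Zd d))) ∪ edgesIn S) (B b) := fun b =>
    ((hdE b).mono Set.subset_union_left).and ((detBy_conn _ _ _).mono Set.subset_union_right)
  have hfin : ∀ b, ((E b : Set (Sym2 (Zd d))) ∪ edgesIn S).Finite := fun b =>
    (E b).finite_toSet.union (edgesIn_finite (slab_finite _ _ _ _))
  have hA : DetBy (edgesIn V₁) (Apart i₀ N M h x y) :=
    ((detBy_CT _ _ _).mono (edgesIn_mono hV)).and
      (((detBy_CT _ _ _).mono (edgesIn_mono hV)).and (detBy_conn _ _ _).not)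
  have hpick : ∀ ω, Apart i₀ N M h x y ω → (f ω).1 ∈ hits ω V₀ x (lev i₀ h) ∧
      (f ω).2 ∈ hits ω V₀ y (lev i₀ h) := by
    rintro ω ⟨⟨z, hz, hz'⟩, ⟨z₂, hz₂, hz₂'⟩, -⟩
    exact ⟨pick_mem ⟨z, hz, hz'⟩, pick_mem ⟨z₂, hz₂, hz₂'⟩⟩
  have hup : ∀ z : Zd d, z i₀ = h → z + ee i₀ ∉ low i₀ h := by
    intro z hz hz'
    have : (z + ee i₀) i₀ ≤ h := hz'
    simp only [Pi.add_apply, Pi.single_eq_same] at this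
    omega
  have key := Pr_and_le (q := fun _ => p) (edgesIn_finite hV₁) hf hA hfin
    (B := fun b ω => ¬ B b ω) (fun b => (hB b).not) (c := 1 - p ^ 2 * c₁) ?_ ?_
  · refine (Pr_mono _ ?_).trans key
    rintro ω ⟨h1, h2, h3⟩
    have hap : Apart i₀ N M h x y ω :=
      ⟨CT_lower hx (by omega : h ≤ h') (h1.mono Set.inter_subset_left),
        CT_lower hy (by omega : h ≤ h') (h2.mono Set.inter_subset_left),
        fun hc => h3 (hc.mono (Set.inter_subset_inter_right _ fun z hz => by
          have hz' : z i₀ ≤ h := hz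
          change z i₀ ≤ h'
          omega))⟩
    refine ⟨hap, fun ⟨hE, hc⟩ => h3 ?_⟩
    obtain ⟨⟨hl1, hc1⟩, hl2, hc2⟩ := hpick ω hap
    have hVV : V₀ ⊆ ball 0 M ∩ low i₀ h' := fun z hz => ⟨(hV hz).1, by
      have hz' : z i₀ ≤ h := hz.2
      change z i₀ ≤ h'
      omega⟩
    have a1 : Conn ω (ball 0 M ∩ low i₀ h') (f ω).1 ((f ω).1 + ee i₀) :=
      .of_adj ⟨latAdj_add _ _, hE _ (by simp [E])⟩ (hVV hc1.right) (hS hc.left)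
    have a2 : Conn ω (ball 0 M ∩ low i₀ h') (f ω).2 ((f ω).2 + ee i₀) :=
      .of_adj ⟨latAdj_add _ _, hE _ (by simp [E])⟩ (hVV hc2.right) (hS hc.right)
    exact ((((hc1.mono hVV).trans a1).trans (hc.mono hS)).trans a2.symm).trans (hc2.mono hVV).symm
  · intro ω hω
    obtain ⟨⟨hl1, -⟩, hl2, -⟩ := hpick ω hω
    rw [Set.disjoint_left]
    rintro e he (he' | he')
    · simp only [E, Finset.coe_insert, Finset.coe_singleton, Set.mem_insert_iff,
        Set.mem_singleton_iff] at he'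
      rcases he' with rfl | rfl
      · exact hup _ hl1 (mk_mem_edgesIn.1 he).2.2
      · exact hup _ hl2 (mk_mem_edgesIn.1 he).2.2
    · refine Set.disjoint_left.1 (edgesIn_disjoint ?_) he he'
      rw [Set.disjoint_left]
      rintro z ⟨-, hz⟩ hz'
      have e1 : z i₀ ≤ h := hz
      have e2 : h + 1 ≤ z i₀ := hz'.1.1
      omega
  · intro ω hω
    obtain ⟨⟨hl1, hc1⟩, hl2, hc2⟩ := hpick ω hω
    have hm := (hB (f ω)).measurableSet (hfin _)
    have e0 := Pr_compl (fun _ => p) hm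
    change Pb p {ω' | ¬ B (f ω) ω'} = _ at e0
    change Pb p {ω' | ¬ B (f ω) ω'} ≤ _
    rw [e0]
    have e1 : Pr (fun _ => p) {ω' | B (f ω) ω'} = Pr (fun _ => p) {ω' : Config d | ∀ e ∈ E (f ω), ω' e = true} *
        Pr (fun _ => p) {ω' | Conn ω' S ((f ω).1 + ee i₀) ((f ω).2 + ee i₀)} := by
      refine Pr_and (E (f ω)).finite_toSet (edgesIn_finite (slab_finite _ _ _ _)) (hdE _)
        (detBy_conn _ _ _) ?_ _
      rw [Set.disjoint_left]
      intro e he he'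
      simp only [E, Finset.coe_insert, Finset.coe_singleton, Set.mem_insert_iff,
        Set.mem_singleton_iff] at he
      rcases he with rfl | rfl
      · have h1 := (mk_mem_edgesIn.1 he').1.1.1
        have h2 : (f ω).1 i₀ = h := hl1
        omega
      · have h1 := (mk_mem_edgesIn.1 he').1.1.1
        have h2 : (f ω).2 i₀ = h := hl2
        omega
    have e2 : (p : ℝ) ^ 2 ≤ Pr (fun _ => p) {ω' : Config d | ∀ e ∈ E (f ω), ω' e = true} := by
      rw [Pr_all_true, Finset.prod_const]
      exact pow_le_pow_of_le_one p.2.1 p.2.2 Finset.card_le_two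
    have e3 : c₁ ≤ Pr (fun _ => p) {ω' | Conn ω' S ((f ω).1 + ee i₀) ((f ω).2 + ee i₀)} := by
      have hb : ∀ z, z i₀ = h → z ∈ ball (0 : Zd d) N → (z - h • ee i₀) i₀ = 0 ∧
          ∀ k, k ≠ i₀ → |(z - h • ee i₀) k| ≤ N := by
        intro z hz hzN
        refine ⟨by simp [hz], fun k hk => ?_⟩
        have := hzN k
        simpa [hk] using this
      obtain ⟨b1, b2⟩ := hb _ hl1 hc1.right.1
      obtain ⟨b3, b4⟩ := hb _ hl2 hc2.right.1
      refine (hslab _ _ b1 b3 b2 b4).trans (le_of_eq ?_)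
      refine Eq.trans (Pb_pull p (tr ((h + 1) • ee i₀))
        ((detBy_conn _ _ _).measurableSet (edgesIn_finite (slab_finite _ _ _ _)))).symm ?_
      change Pr _ {ω' : Config d | Conn (pull _ ω') _ _ _} = _
      congr 1
      ext ω'
      change Conn (pull _ ω') _ _ _ ↔ Conn ω' _ _ _
      rw [conn_pull (isAut_tr _), slab_shift, tr_apply, tr_apply]
      have g : ∀ z : Zd d, z - h • ee i₀ + (h + 1) • ee i₀ = z + ee i₀ := fun z => by
        rw [add_smul, one_smul]; abel
      rw [g, g, show 0 + (h + 1) = h + 1 by ring, show θ + (h + 1) = h' by rw [hh']; ring]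
    have e4 := mul_le_mul e2 e3 hc₁ (Pr_nonneg _ _)
    rw [← e1] at e4
    linarith

lemma Apart_pow {p : I} {i₀ : Fin d} {N M h θ W : ℤ} {c₁ : ℝ} (hc₁ : 0 ≤ c₁) (hc₁' : c₁ ≤ 1)
    (hslab : ∀ u₁ u₂ : Zd d, u₁ i₀ = 0 → u₂ i₀ = 0 → (∀ k, k ≠ i₀ → |u₁ k| ≤ N) →
      (∀ k, k ≠ i₀ → |u₂ k| ≤ N) → c₁ ≤ Pb p {ω : Config d | Conn ω (slab i₀ 0 θ W) u₁ u₂})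
    (hNM : N ≤ M) (hWM : W ≤ M) (hθ : 0 ≤ θ) (hh : -M ≤ h) {x y : Zd d} (hx : x i₀ ≤ h)
    (hy : y i₀ ≤ h) (j : ℕ) (hj : h + j * (θ + 1) ≤ M) :
    Pb p {ω | Apart i₀ N M (h + j * (θ + 1)) x y ω} ≤ (1 - p ^ 2 * c₁) ^ j := by
  induction j with
  | zero => simpa using Pr_le_one _ _
  | succ j ih =>
    have e : h + ((j + 1 : ℕ) : ℤ) * (θ + 1) = h + j * (θ + 1) + (θ + 1) := by push_cast; ring
    have h0 : (0 : ℤ) ≤ j * (θ + 1) := by positivity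
    rw [e] at hj ⊢
    have hp2 : (p : ℝ) ^ 2 ≤ 1 := pow_le_one₀ p.2.1 p.2.2
    have h1 : 0 ≤ 1 - (p : ℝ) ^ 2 * c₁ := by nlinarith
    rw [pow_succ']
    exact (Apart_step hc₁ hslab hNM hWM hθ (by omega) hj (by omega) (by omega)).trans
      (mul_le_mul_of_nonneg_left (ih (by omega)) h1)

end Layers

section GoodBlocks
variable {d : ℕ}

/-- The block of radius `R` around `c` meets a long open path. -/
def Cross (R : ℤ) (c : Zd d) (ω : Config d) : Prop :=
  ∃ x ∈ ball c R, CT ω (ball c (11 * R)) x (sph c (11 * R))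

/-- Long open paths near `c` are connected to each other. -/
def Uniq (R : ℤ) (c : Zd d) (ω : Config d) : Prop :=
  ∀ x ∈ ball c (2 * R), ∀ y ∈ ball c (2 * R), CT ω (ball c (10 * R)) x (sph c (10 * R)) →
    CT ω (ball c (10 * R)) y (sph c (10 * R)) → Conn ω (ball c (12 * R)) x y

/-- Both points reach a face but are not connected. -/
def Split (N M : ℤ) (i : Fin d) (τ : ℤˣ) (x y : Zd d) (ω : Config d) : Prop :=
  CT ω (ball 0 N) x (lev i (τ * N)) ∧ CT ω (ball 0 N) y (lev i (τ * N)) ∧ ¬ Conn ω (ball 0 M) x y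

lemma detBy_split {N M : ℤ} (h : N ≤ M) (i : Fin d) (τ : ℤˣ) (x y : Zd d) :
    DetBy (edgesIn (ball 0 M)) (Split N M i τ x y) :=
  ((detBy_CT _ _ _).mono (edgesIn_mono (ball_mono _ h))).and
    (((detBy_CT _ _ _).mono (edgesIn_mono (ball_mono _ h))).and (detBy_conn _ _ _).not)

lemma Pb_split_neg {p : I} {N M : ℤ} (h : N ≤ M) (i : Fin d) (x y : Zd d) :
    Pb p {ω | Split N M i (-1) x y ω} = Pb p {ω | Split N M i 1 (-x) (-y) ω} := by
  refine Eq.trans (Pb_pull p (sgnPerm 1 fun _ => -1)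
    ((detBy_split h i (-1) x y).measurableSet (edgesIn_finite (ball_finite _ _)))).symm ?_
  congr 1
  ext ω
  change Split N M i (-1) x y (pull _ ω) ↔ Split N M i 1 (-x) (-y) ω
  have e1 : ∀ z : Zd d, sgnPerm 1 (fun _ => -1) z = -z := fun z => by ext k; simp [sgnPerm]
  have e2 : sgnPerm 1 (fun _ => -1) '' lev i (((-1 : ℤˣ) : ℤ) * N) = lev i (((1 : ℤˣ) : ℤ) * N) := by
    ext z
    rw [Equiv.image_eq_preimage_symm]
    have : (sgnPerm 1 fun _ => -1).symm z = -z := by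
      rw [Equiv.symm_apply_eq, e1, neg_neg]
    simp only [Set.mem_preimage, this, lev, Set.mem_ofPred_eq, Pi.neg_apply, Units.val_neg,
      Units.val_one]
    constructor <;> intro h <;> linarith
  rw [Split, Split, CT_pull (isAut_sgnPerm _ _), CT_pull (isAut_sgnPerm _ _),
    conn_pull (isAut_sgnPerm _ _), sgnPerm_image_ball, sgnPerm_image_ball, e1, e1, e2]

/-- A long path around a block with the reference point and no splitting gives uniqueness. -/
lemma uniq_of_ref {R : ℤ} {m : ℤ} {ω : Config d}
    (hu : ∃ u ∈ ball (0 : Zd d) m, ∀ i ε, CT ω (ball 0 (10 * R)) u (Fc 0 i ε (10 * R)))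
    (hs : ∀ x ∈ ball (0 : Zd d) (2 * R), ∀ u ∈ ball (0 : Zd d) m, ∀ i τ,
      ¬ Split (10 * R) (12 * R) i τ x u ω) : Uniq R 0 ω := by
  obtain ⟨u, hu, hF⟩ := hu
  have key : ∀ x ∈ ball (0 : Zd d) (2 * R), CT ω (ball 0 (10 * R)) x (sph 0 (10 * R)) →
      Conn ω (ball 0 (12 * R)) x u := by
    rintro x hx ⟨y, hy, hxy⟩
    obtain ⟨i, ε, hyF⟩ := sph_subset_Fc hy
    have hlev : ∀ z ∈ Fc (0 : Zd d) i ε (10 * R), z ∈ lev i (ε i * (10 * R)) := by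
      intro z hz
      have := hz.2.1
      rw [Pi.zero_apply, sub_zero] at this
      exact this
    by_contra hne
    obtain ⟨y', hy', hc'⟩ := hF i ε
    exact hs x hx u hu i (ε i) ⟨⟨y, hlev y hyF, hxy⟩, ⟨y', hlev y' hy', hc'⟩, hne⟩
  exact fun x hx y hy h1 h2 => (key x hx h1).trans (key y hy h2).symm

lemma cross_of_ref {R m : ℤ} (hm : m ≤ R) (hd : 0 < d) {ω : Config d}
    (hu : ∃ u ∈ ball (0 : Zd d) m, ∀ i ε, CT ω (ball 0 (11 * R)) u (Fc 0 i ε (11 * R))) :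
    Cross R 0 ω := by
  obtain ⟨u, hu, hF⟩ := hu
  obtain ⟨y, hy, hc⟩ := hF ⟨0, hd⟩ 1
  exact ⟨u, ball_mono _ hm hu, hc.CT_sph (hc.left)
    (Fc_subset_sph hy).2⟩

lemma eventually_poly_le {a : ℝ} {r : ℝ} (hr0 : 0 ≤ r) (hr : r < 1) (k : ℕ) {ε : ℝ} (hε : 0 < ε) :
    ∀ᶠ n : ℕ in Filter.atTop, a * ((n : ℝ) ^ k * r ^ n) ≤ ε := by
  have h := (tendsto_pow_const_mul_const_pow_of_abs_lt_one k
    (show |r| < 1 by rwa [abs_of_nonneg hr0])).const_mul a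
  rw [mul_zero] at h
  exact h.eventually (ge_mem_nhds hε)

lemma Pb_split_le {p : I} {L n : ℕ} (hL : 1 ≤ L) (hn : 2 ≤ n) {c₁ : ℝ} (hc₁ : 0 ≤ c₁) (hc₁' : c₁ ≤ 1)
    (hslab : ∀ (i₀ : Fin d) (u₁ u₂ : Zd d), u₁ i₀ = 0 → u₂ i₀ = 0 →
      (∀ k, k ≠ i₀ → |u₁ k| ≤ L * (10 * n ^ 2 : ℕ)) → (∀ k, k ≠ i₀ → |u₂ k| ≤ L * (10 * n ^ 2 : ℕ)) →
      c₁ ≤ Pb p {ω : Config d | Conn ω (slab i₀ 0 ((n + 6) * L) (((10 * n ^ 2 : ℕ) + 3) * L)) u₁ u₂})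
    {R : ℤ} (hR : R = L * n ^ 2) (i : Fin d) (τ : ℤˣ) {x y : Zd d} (hx : x ∈ ball 0 (2 * R))
    (hy : y ∈ ball 0 (2 * R)) :
    Pb p {ω | Split (10 * R) (12 * R) i τ x y ω} ≤ (1 - p ^ 2 * c₁) ^ n := by
  have hL' : (1 : ℤ) ≤ L := by exact_mod_cast hL
  have hn2 : (2 : ℤ) ≤ n := by exact_mod_cast hn
  have hn' : (1 : ℤ) ≤ n := by omega
  have hLn : (0 : ℤ) ≤ L * n := by positivity
  have hR1 : (1 : ℤ) ≤ R := by rw [hR]; exact one_le_mul_of_one_le_of_one_le hL' (one_le_pow₀ hn')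
  have hR2 : (n : ℤ) ≤ R := by rw [hR]; nlinarith
  have hR3 : (L : ℤ) * n ≤ R := by rw [hR]; nlinarith
  have hR4 : (4 : ℤ) * L ≤ R := by
    have : (4 : ℤ) ≤ n ^ 2 := by nlinarith
    rw [hR]; nlinarith
  have hj : (n : ℤ) * ((n + 6) * L + 1) ≤ 8 * R := by
    have : (n : ℤ) * ((n + 6) * L + 1) = R + 6 * (L * n) + n := by rw [hR]; ring
    linarith
  have pos : ∀ x y : Zd d, x ∈ ball 0 (2 * R) → y ∈ ball 0 (2 * R) →
      Pb p {ω | Split (10 * R) (12 * R) i 1 x y ω} ≤ (1 - p ^ 2 * c₁) ^ n := by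
    intro x y hx hy
    have hx' : x i ≤ 2 * R := by simpa using (abs_le.1 (hx i)).2
    have hy' : y i ≤ 2 * R := by simpa using (abs_le.1 (hy i)).2
    have h0 : (0 : ℤ) ≤ n * ((n + 6) * L + 1) := by positivity
    refine (Pr_mono _ ?_).trans (Apart_pow (p := p) (i₀ := i) (N := 10 * R) (M := 12 * R) (h := 2 * R)
      (θ := (n + 6) * L) (W := ((10 * n ^ 2 : ℕ) + 3) * L) hc₁ hc₁' ?_ (by omega) ?_ (by positivity)
      (by omega) hx' hy' n (by omega))
    · rintro ω ⟨h1, h2, h3⟩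
      simp only [Units.val_one, one_mul] at h1 h2
      exact ⟨CT_lower (by omega) (by omega) h1, CT_lower (by omega) (by omega) h2,
        fun h => h3 (h.mono Set.inter_subset_left)⟩
    · intro u₁ u₂ a1 a2 a3 a4
      have e : (L : ℤ) * (10 * n ^ 2 : ℕ) = 10 * R := by rw [hR]; push_cast; ring
      exact hslab i u₁ u₂ a1 a2 (by rwa [e]) (by rwa [e])
    · have : (((10 * n ^ 2 : ℕ) : ℤ) + 3) * L = 10 * R + 3 * L := by rw [hR]; push_cast; ring
      linarith [hR4, hR3, this]
  rcases Int.units_eq_one_or τ with rfl | rfl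
  · exact pos x y hx hy
  · rw [Pb_split_neg (by omega)]
    refine pos _ _ (fun k => ?_) fun k => ?_
    · simpa using hx k
    · simpa using hy k

lemma exists_good {p : I} (hp : pc d < p) (hd : 0 < d) {ε : ℝ} (hε : 0 < ε) :
    ∃ R : ℕ, 1 ≤ R ∧ Pb p {ω : Config d | ¬ (Cross R 0 ω ∧ Uniq R 0 ω)} ≤ ε := by
  classical
  have hp0 : 0 < (p : ℝ) := (pc_nonneg d).trans_lt hp
  obtain ⟨L, hL, c, hc, hslab⟩ := exists_slab_conn hp hd
  obtain ⟨c₁, hc₁, hc₁', hcc⟩ : ∃ c₁ : ℝ, 0 < c₁ ∧ c₁ < 1 ∧ c₁ ≤ c :=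
    ⟨min c (1 / 2), by positivity, by norm_num, min_le_left _ _⟩
  obtain ⟨m, L₀, href⟩ := exists_ref hp ⟨0, hd⟩ (show 0 < ε / 3 by positivity)
  have hp2 : (p : ℝ) ^ 2 ≤ 1 := pow_le_one₀ p.2.1 p.2.2
  have hp3 : 0 < (p : ℝ) ^ 2 := by positivity
  have hr0 : 0 ≤ 1 - (p : ℝ) ^ 2 * c₁ := by nlinarith
  have hr1 : 1 - (p : ℝ) ^ 2 * c₁ < 1 := by nlinarith
  have ev1 := eventually_poly_le (a := (29 : ℝ) ^ d * d) (r := 1 / 2) (by norm_num) (by norm_num) (2 * d)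
    one_pos
  have ev2 := eventually_poly_le (a := (5 * L : ℝ) ^ d * (2 * m + 1) ^ d * (d * 2)) hr0 hr1 (2 * d)
    (show 0 < ε / 3 by positivity)
  obtain ⟨n, h1, h2, h3⟩ := (ev1.and (ev2.and (Filter.eventually_ge_atTop (max 2 (max m L₀))))).exists
  have hn2 : 2 ≤ n := (le_max_left _ _).trans h3
  have hn : 1 ≤ n := by omega
  have hnm : m ≤ n := ((le_max_left _ _).trans (le_max_right _ _)).trans h3
  have hnL : L₀ ≤ n := ((le_max_right _ _).trans (le_max_right _ _)).trans h3
  set R : ℕ := L * n ^ 2 with hR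
  have hnR : n ≤ R := by
    have : n * 1 ≤ n ^ 2 := by nlinarith
    nlinarith
  have hnR1 : (1 : ℝ) ≤ n := by exact_mod_cast hn
  have hw : (2 * (n + 10 * n ^ 2 + 3) + 1) ^ d * d ≤ 2 ^ n := by
    have a1 : ((2 * (n + 10 * n ^ 2 + 3) + 1 : ℝ)) ^ d ≤ (29 * (n : ℝ) ^ 2) ^ d :=
      pow_le_pow_left₀ (by positivity) (by nlinarith) d
    have a2 : ((2 * (n + 10 * n ^ 2 + 3) + 1 : ℝ)) ^ d * d ≤ 2 ^ n := by
      refine (mul_le_mul_of_nonneg_right a1 (by positivity)).trans ?_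
      rw [mul_pow, ← pow_mul]
      rw [one_div, inv_pow, ← mul_assoc, ← div_eq_mul_inv, div_le_one (by positivity)] at h1
      calc _ = _ := by ring
        _ ≤ _ := h1
    exact_mod_cast a2
  refine ⟨R, hn.trans hnR, ?_⟩
  have r10 := (href (10 * R) (by omega)).2
  have r11 := (href (11 * R) (by omega)).2
  have hsub : {ω : Config d | ¬ (Cross R 0 ω ∧ Uniq R 0 ω)} ⊆
      ({ω : Config d | ¬ ∃ u ∈ ball (0 : Zd d) m, ∀ i ε, CT ω (ball 0 (10 * R : ℕ)) u (Fc 0 i ε (10 * R : ℕ))} ∪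
       {ω : Config d | ¬ ∃ u ∈ ball (0 : Zd d) m, ∀ i ε, CT ω (ball 0 (11 * R : ℕ)) u (Fc 0 i ε (11 * R : ℕ))}) ∪
      {ω : Config d | ∃ a ∈ (ball_finite (0 : Zd d) (2 * R : ℕ)).toFinset ×ˢ
        ((ball_finite (0 : Zd d) m).toFinset ×ˢ ((Finset.univ : Finset (Fin d)) ×ˢ (Finset.univ : Finset ℤˣ))),
        Split (10 * R) (12 * R) a.2.2.1 a.2.2.2 a.1 a.2.1 ω} := by
    intro ω hω
    by_contra hne
    simp only [Set.mem_union, not_or, Set.mem_ofPred_eq, not_not] at hne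
    obtain ⟨⟨b1, b2⟩, b3⟩ := hne
    push_cast at b1 b2
    refine hω ⟨cross_of_ref (by exact_mod_cast hnm.trans hnR) hd b2, uniq_of_ref b1 ?_⟩
    intro x hx u hu i τ hs
    exact b3 ⟨(x, u, i, τ), by simpa using ⟨hx, hu, Int.units_eq_one_or τ⟩, hs⟩
  refine (Pr_mono _ hsub).trans ((Pr_union_le _ _ _).trans ?_)
  refine (add_le_add (Pr_union_le _ _ _) (Pr_exists_le _ _ _)).trans ?_
  have hsum : ∑ a ∈ (ball_finite (0 : Zd d) (2 * R : ℕ)).toFinset ×ˢ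
        ((ball_finite (0 : Zd d) m).toFinset ×ˢ ((Finset.univ : Finset (Fin d)) ×ˢ (Finset.univ : Finset ℤˣ))),
      Pr (fun _ => p) {ω : Config d | Split (10 * R) (12 * R) a.2.2.1 a.2.2.2 a.1 a.2.1 ω} ≤ ε / 3 := by
    refine (Finset.sum_le_card_nsmul _ _ ((1 - (p : ℝ) ^ 2 * c₁) ^ n) fun a ha => ?_).trans ?_
    · simp only [Finset.mem_product, Set.Finite.mem_toFinset] at ha
      refine Pb_split_le hL hn2 hc₁.le hc₁'.le (fun i₀ u₁ u₂ c1 c2 c3 c4 => hcc.trans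
        (hslab i₀ n (10 * n ^ 2) hw u₁ u₂ c1 c2 c3 c4)) (by rw [hR]; push_cast; ring) _ _ ?_
        (ball_mono _ (by omega) ha.2.1)
      have := ha.1
      push_cast at this
      exact this
    · rw [nsmul_eq_mul, Finset.card_product, Finset.card_product, Finset.card_product, card_ball, card_ball]
      simp only [Finset.card_univ, Fintype.card_fin, Fintype.card_units_int]
      refine le_trans ?_ h2
      have a1 : ((2 * (2 * R) + 1 : ℝ)) ^ d ≤ (5 * L : ℝ) ^ d * (n : ℝ) ^ (2 * d) := by
        rw [pow_mul, ← mul_pow]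
        refine pow_le_pow_left₀ (by positivity) ?_ d
        have : (1 : ℝ) ≤ R := by exact_mod_cast hn.trans hnR
        have e : (R : ℝ) = L * n ^ 2 := by rw [hR]; push_cast; ring
        rw [mul_assoc, ← e]; linarith
      push_cast
      calc _ ≤ (((5 * L : ℝ) ^ d * (n : ℝ) ^ (2 * d)) * ((2 * m + 1) ^ d * (d * 2))) *
            (1 - (p : ℝ) ^ 2 * c₁) ^ n :=
            mul_le_mul_of_nonneg_right (mul_le_mul_of_nonneg_right a1 (by positivity)) (by positivity)
        _ = _ := by ring
  have r10' : Pr (fun _ => p) {ω : Config d | ¬ ∃ u ∈ ball (0 : Zd d) m, ∀ i ε,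
    CT ω (ball 0 (10 * R : ℕ)) u (Fc 0 i ε (10 * R : ℕ))} ≤ ε / 3 := r10
  have r11' : Pr (fun _ => p) {ω : Config d | ¬ ∃ u ∈ ball (0 : Zd d) m, ∀ i ε,
    CT ω (ball 0 (11 * R : ℕ)) u (Fc 0 i ε (11 * R : ℕ))} ≤ ε / 3 := r11
  refine (add_le_add (add_le_add r10' r11') hsum).trans (le_of_eq ?_)
  ring

end GoodBlocks

section Coarse
variable {d : ℕ}

/-- The blocks of side `R` met by `A`. -/
def coarse (R : ℤ) (A : Set (Zd d)) : Set (Zd d) := {z | (A ∩ ball (R • z) R).Nonempty}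

/-- A block met by `A` next to a block not met by `A` contributes a boundary edge of `A`. -/
lemma exists_bdry_near {ω : Config d} {A : Set (Zd d)} {R : ℤ} (hR : 1 ≤ R)
    (hA : ∀ x ∈ A, ∀ y ∈ A, Conn ω A x y) (hbig : ∀ c, ∃ x ∈ A, x ∈ far c (10 * R))
    {z z' : Zd d} (hz : z ∈ coarse R A) (hz' : z' ∉ coarse R A) (hzz' : latAdj z z')
    (hC : Cross R (R • z') ω) (hU : Uniq R (R • z) ω) :
    ∃ e ∈ bdry ω A, e.1 ∈ ball (R • z) (12 * R) := by
  have hnear : ∀ i, |(R • z') i - (R • z) i| ≤ R := by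
    intro i
    have h := hzz'.abs_le i
    rw [abs_sub_comm] at h
    simp only [Pi.smul_apply, smul_eq_mul, ← mul_sub, abs_mul]
    rw [abs_of_pos (by omega : 0 < R)]
    nlinarith
  obtain ⟨x, hxA, hx⟩ := hz
  obtain ⟨x', hx', y', hy', hxy'⟩ := hC
  have hx'A : x' ∉ A := fun h => hz' ⟨x', h, hx'⟩
  have hx'b : x' ∈ ball (R • z) (2 * R) := ball_subset_ball hnear (by omega) hx'
  have hy'f : y' ∈ far (R • z) (10 * R) := by
    obtain ⟨i, hi⟩ := hy'.2
    refine ⟨i, ?_⟩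
    have h1 := hnear i
    rw [abs_le] at h1
    rw [le_abs] at hi ⊢
    omega
  obtain ⟨y, hyA, hy⟩ := hbig (R • z)
  have h1 : CT ω (ball (R • z) (10 * R)) x' (sph (R • z) (10 * R)) :=
    hxy'.CT_sph (ball_mono _ (by omega) hx'b) hy'f
  have h2 : CT ω (ball (R • z) (10 * R)) x (sph (R • z) (10 * R)) :=
    (hA x hxA y hyA).CT_sph (ball_mono _ (by omega) hx) hy
  obtain ⟨u, v, h3, h4, -, h5⟩ := (hU x (ball_mono _ (by omega) hx) x' hx'b h2 h1).exit hxA hx'A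
  exact ⟨(u, v), ⟨h4, h3.right.2, h5⟩, h3.right.1⟩

/-- The block containing a point. -/
def blk (R : ℤ) (x : Zd d) : Zd d := fun i => x i / R

lemma mem_ball_blk {R : ℤ} (hR : 1 ≤ R) (x : Zd d) {i : Fin d} :
    0 ≤ x i - (R • blk R x) i ∧ x i - (R • blk R x) i ≤ R - 1 := by
  simp only [Pi.smul_apply, smul_eq_mul, blk]
  have h1 := Int.emod_add_mul_ediv (x i) R
  have h2 := Int.emod_nonneg (x i) (by omega : R ≠ 0)
  have h3 := Int.emod_lt_of_pos (x i) (by omega : 0 < R)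
  omega

lemma blk_mem_coarse {R : ℤ} (hR : 1 ≤ R) {A : Set (Zd d)} {x : Zd d} (hx : x ∈ A) :
    blk R x ∈ coarse R A := by
  refine ⟨x, hx, fun i => ?_⟩
  have := mem_ball_blk hR x (i := i)
  rw [abs_le]; omega

lemma coarse_conn_blk {R : ℤ} (hR : 1 ≤ R) {A : Set (Zd d)} {x z : Zd d} (hx : x ∈ A)
    (hz : x ∈ ball (R • z) R) : Conn allOpen (coarse R A) z (blk R x) := by
  have h1 : z ∈ Set.Icc (z ⊓ blk R x) (z ⊔ blk R x) := ⟨inf_le_left, le_sup_left⟩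
  have h2 : blk R x ∈ Set.Icc (z ⊓ blk R x) (z ⊔ blk R x) := ⟨inf_le_right, le_sup_right⟩
  refine (conn_Icc h1 h2).mono ?_
  intro w hw
  refine ⟨x, hx, fun i => ?_⟩
  have a1 : min (z i) (blk R x i) ≤ w i := hw.1 i
  have a2 : w i ≤ max (z i) (blk R x i) := hw.2 i
  have a3 : |x i - R * z i| ≤ R := hz i
  have a4 := mem_ball_blk hR x (i := i)
  simp only [Pi.smul_apply, smul_eq_mul] at a4 ⊢
  rw [abs_le] at a3 ⊢
  rcases le_total (z i) (blk R x i) with h | h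
  · rw [min_eq_left h] at a1; rw [max_eq_right h] at a2
    constructor <;> nlinarith
  · rw [min_eq_right h] at a1; rw [max_eq_left h] at a2
    constructor <;> nlinarith

lemma coarse_conn {ω : Config d} {A : Set (Zd d)} {R : ℤ} (hR : 1 ≤ R)
    (hA : ∀ x ∈ A, ∀ y ∈ A, Conn ω A x y) :
    ∀ z ∈ coarse R A, ∀ z' ∈ coarse R A, Conn allOpen (coarse R A) z z' := by
  rintro z ⟨x, hxA, hx⟩ z' ⟨y, hyA, hy⟩
  refine ((coarse_conn_blk hR hxA hx).trans ?_).trans (coarse_conn_blk hR hyA hy).symm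
  refine (hA x hxA y hyA).induct (P := fun y => Conn allOpen (coarse R A) (blk R x) (blk R y))
    (.refl (blk_mem_coarse hR hxA)) ?_
  intro a b ha hab hb h
  refine h.trans (coarse_conn_blk hR hb fun i => ?_)
  have h1 := mem_ball_blk hR a (i := i)
  have h2 := hab.1.abs_le i
  rw [abs_le] at h2 ⊢
  omega

lemma coarse_subset_ball {R : ℤ} (hR : 1 ≤ R) {A : Set (Zd d)} {n : ℤ} (hA : A ⊆ ball 0 n) :
    coarse R A ⊆ ball 0 (n + 1) := by
  rintro z ⟨x, hxA, hx⟩ i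
  have a3 : |x i - R * z i| ≤ R := hx i
  have a4 : |x i - 0| ≤ n := hA hxA i
  simp only [Pi.zero_apply, sub_zero] at *
  rw [abs_le] at *
  constructor
  · by_contra hlt
    have : z i ≤ - n - 2 := by omega
    nlinarith
  · by_contra hlt
    have : n + 2 ≤ z i := by omega
    nlinarith

lemma exists_subset_ball {A : Set (Zd d)} (hA : A.Finite) : ∃ n : ℕ, A ⊆ ball 0 n := by
  classical
  refine ⟨∑ x ∈ hA.toFinset, ∑ i, (x i).natAbs, fun x hx i => ?_⟩
  have h1 : (x i).natAbs ≤ ∑ i, (x i).natAbs :=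
    Finset.single_le_sum (f := fun i => (x i).natAbs) (fun _ _ => Nat.zero_le _) (Finset.mem_univ i)
  have h2 : ∑ i, (x i).natAbs ≤ ∑ x ∈ hA.toFinset, ∑ i, (x i).natAbs :=
    Finset.single_le_sum (f := fun x : Zd d => ∑ i, (x i).natAbs) (fun _ _ => Nat.zero_le _)
      (hA.mem_toFinset.2 hx)
  rw [Pi.zero_apply, sub_zero, Int.abs_eq_natAbs]
  exact_mod_cast h1.trans h2

lemma card_le_coarse {R : ℕ} (hR : 1 ≤ R) {A : Set (Zd d)} (hA : A.Finite) :
    A.ncard ≤ (coarse R A).ncard * (2 * R + 1) ^ d := by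
  obtain ⟨n, hn⟩ := exists_subset_ball hA
  have hf : (coarse (R : ℤ) A).Finite := (ball_finite _ _).subset (coarse_subset_ball (by omega) hn)
  have hsub : A ⊆ ((hf.toFinset.biUnion fun z =>
      (ball_finite ((R : ℤ) • z) R).toFinset : Finset (Zd d)) : Set (Zd d)) := by
    intro x hx
    simp only [Finset.coe_biUnion, Set.mem_iUnion, Set.Finite.coe_toFinset]
    refine ⟨blk R x, blk_mem_coarse (by omega) hx, fun i => ?_⟩
    have := mem_ball_blk (R := R) (by omega) x (i := i)
    rw [abs_le]; omega
  refine (Set.ncard_le_ncard hsub (Finset.finite_toSet _)).trans ?_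
  rw [Set.ncard_coe_finset, Set.ncard_eq_toFinset_card _ hf]
  refine Finset.card_biUnion_le_card_mul _ _ _ fun z _ => le_of_eq ?_
  exact card_ball_center _ _

end Coarse

section Contour
variable {d : ℕ}

/-- A finite set of sites which meets every line through `S` is large (Loomis–Whitney). -/
lemma card_pow_le_of_projection (hd : 2 ≤ d) (S : Finset (Zd d)) (Γ : Finset (Att d))
    (h : ∀ z ∈ S, ∀ i, ∃ t : ℤ, (Function.update z i t, i) ∈ Γ) :
    S.card ^ (d - 1) ≤ Γ.card ^ d := by
  classical
  set μ : Fin d → Measure ℤ := fun _ => Measure.count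
  have hd1 : (1 : ℝ) < d := by exact_mod_cast hd
  have hp := Real.HolderConjugate.conjExponent hd1
  set f : Zd d → ℝ≥0∞ := fun x => ∑ g ∈ Γ, ({g.1} : Set (Zd d)).indicator (fun _ => 1) x with hf
  have hmeas : ∀ g ∈ Γ, Measurable (({g.1} : Set (Zd d)).indicator fun _ => (1 : ℝ≥0∞)) :=
    fun g _ => measurable_const.indicator (measurableSet_singleton _)
  have hpt : ∀ x : Zd d, Measure.pi μ {x} = 1 := fun x => by
    rw [Measure.pi_singleton]; simp [μ]
  have hfm : Measurable f := Finset.measurable_fun_sum _ hmeas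
  have h_integral : ∫⁻ x, f x ∂Measure.pi μ = Γ.card := by
    rw [hf, lintegral_finsetSum _ hmeas]
    simp only [lintegral_indicator_const (measurableSet_singleton _), hpt]
    simp
  have key := lintegral_prod_lintegral_pow_le μ (p := (d : ℝ).conjExponent) (by simpa using hp) hfm
  rw [h_integral] at key
  have hlow : (S.card : ℝ≥0∞) ≤ ∫⁻ x, ∏ i, (∫⁻ t, f (Function.update x i t) ∂μ i) ^
      ((1 : ℝ) / (Fintype.card (Fin d) - 1)) ∂Measure.pi μ := by
    have h1 : (S.card : ℝ≥0∞) = ∫⁻ x, ∑ z ∈ S, ({z} : Set (Zd d)).indicator (fun _ => 1) x ∂Measure.pi μ := by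
      rw [lintegral_finsetSum _ fun z _ => measurable_const.indicator (measurableSet_singleton _)]
      simp only [lintegral_indicator_const (measurableSet_singleton _), hpt]
      simp
    rw [h1]
    refine lintegral_mono fun x => ?_
    by_cases hx : x ∈ S
    · have h2 : (∑ z ∈ S, ({z} : Set (Zd d)).indicator (fun _ => (1 : ℝ≥0∞)) x) = 1 := by
        rw [Finset.sum_eq_single x] <;> simp +contextual [hx, eq_comm]
      rw [h2]
      refine Finset.one_le_prod fun i _ => ENNReal.one_le_rpow ?_ (by
        rw [Fintype.card_fin]; exact div_pos one_pos (by linarith))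
      obtain ⟨t, ht⟩ := h x hx i
      rw [lintegral_count]
      refine le_trans ?_ (ENNReal.le_tsum t)
      rw [hf]
      refine le_trans (le_of_eq ?_) (Finset.single_le_sum (f := fun g : Att d =>
        ({g.1} : Set (Zd d)).indicator (fun _ => (1 : ℝ≥0∞)) (Function.update x i t)) (fun _ _ => zero_le) ht)
      simp
    · refine le_trans (le_of_eq ?_) zero_le
      refine Finset.sum_eq_zero fun z hz => ?_
      simp only [Set.indicator_apply_eq_zero, Set.mem_singleton_iff]
      rintro rfl; exact absurd hz hx
  have h3 := hlow.trans key
  have h4 : ((S.card : ℝ≥0∞)) ^ (d - 1) ≤ (Γ.card : ℝ≥0∞) ^ d := by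
    refine (pow_le_pow_left' h3 (d - 1)).trans (le_of_eq ?_)
    rw [← ENNReal.rpow_natCast, ← ENNReal.rpow_mul, ← ENNReal.rpow_natCast]
    congr 1
    rw [Real.conjExponent, Nat.cast_sub (by omega)]
    field_simp
    have : (d : ℝ) - 1 ≠ 0 := by linarith
    push_cast
    field_simp
  exact_mod_cast h4

/-- The outer contour of a finite connected set. -/
lemma exists_contour {S : Set (Zd d)} {m : ℤ} (hm : 0 ≤ m) (hS : S ⊆ ball 0 m) (hne : S.Nonempty)
    (hc : ∀ x ∈ S, ∀ y ∈ S, Conn allOpen S x y) :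
    ∃ Γ : Finset (Att d), RConn (fun f g => g ∈ nbr f) Γ ∧
      (∀ f ∈ Γ, (f.1 ∈ S ∧ f.1 + ee f.2 ∉ S) ∨ (f.1 ∉ S ∧ f.1 + ee f.2 ∈ S)) ∧
      ∀ z ∈ S, ∀ i, ∃ t : ℤ, (Function.update z i t, i) ∈ Γ := by
  obtain ⟨w₀, hw₀⟩ := hne
  set a : Zd d := fun _ => -(m + 1)
  set b : Zd d := fun _ => m + 1
  have hSb : ∀ z ∈ S, ∀ i, -m ≤ z i ∧ z i ≤ m := by
    intro z hz i
    have h : |z i - 0| ≤ m := hS hz i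
    rwa [sub_zero, abs_le] at h
  have hSI : S ⊆ Set.Icc a b := fun z hz =>
    ⟨fun i => by have := hSb z hz i; simp only [a]; omega,
      fun i => by have := hSb z hz i; simp only [b]; omega⟩
  set W := comp (Set.Icc a b) S b with hW
  have hWI : W ⊆ Set.Icc a b := comp_subset.trans Set.sdiff_subset
  refine ⟨cut a b W, rconn_cut (fun x hx y hy => comp_conn hx hy)
    (comp_compl_conn (fun x hx y hy => conn_Icc hx hy) hSI hc hw₀) hWI, ?_, ?_⟩
  · intro f hf
    rcases cut_comp hf with ⟨h1, h2⟩ | ⟨h1, h2⟩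
    · exact .inl ⟨h1, (comp_subset h2).2⟩
    · exact .inr ⟨(comp_subset h1).2, h2⟩
  · intro z hz i
    have hbox : ∀ t : ℤ, -(m + 1) ≤ t → t ≤ m + 1 → Function.update z i t ∈ Set.Icc a b := by
      intro t h1 h2
      constructor <;> intro j <;> by_cases hj : j = i
      · subst hj; simpa [a] using h1
      · have := hSb z hz j; simp only [Function.update_of_ne hj, a]; omega
      · subst hj; simpa [b] using h2
      · have := hSb z hz j; simp only [Function.update_of_ne hj, b]; omega
    have htop : Function.update z i (m + 1) ∈ W := by
      have hb : b ∈ Set.Icc (Function.update a i (m + 1)) b := by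
        refine ⟨fun j => ?_, le_rfl⟩
        by_cases hj : j = i
        · subst hj; simp [b]
        · simp only [Function.update_of_ne hj, a, b]; omega
      have hz' : Function.update z i (m + 1) ∈ Set.Icc (Function.update a i (m + 1)) b := by
        have h0 := hbox (m + 1) (by omega) le_rfl
        refine ⟨fun j => ?_, h0.2⟩
        have h1 : a j ≤ Function.update z i (m + 1) j := h0.1 j
        by_cases hj : j = i
        · subst hj; simp
        · rwa [Function.update_of_ne hj]
      refine (conn_Icc hb hz').mono fun x hx => ?_
      have h1 : ∀ j, Function.update a i (m + 1) j ≤ x j := fun j => hx.1 j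
      refine ⟨⟨fun j => ?_, hx.2⟩, fun hxS => ?_⟩
      · have h2 := h1 j
        by_cases hj : j = i
        · subst hj; rw [Function.update_self] at h2; simp only [a]; omega
        · rwa [Function.update_of_ne hj] at h2
      · have h2 := h1 i
        have h3 := hSb x hxS i
        rw [Function.update_self] at h2
        omega
    by_contra! hno
    have hind : ∀ j : ℕ, z i + j ≤ m + 1 → Function.update z i (z i + j) ∉ W := by
      intro j
      induction j with
      | zero => intro _ h; exact (comp_subset h).2 (by simpa using hz)
      | succ j ih =>
        intro hj h
        push_cast at hj h
        have hzi := hSb z hz i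
        refine hno (z i + j) (mem_cut.2 ?_)
        have e : Function.update z i (z i + j) + ee i = Function.update z i (z i + (j + 1)) := by
          ext k
          by_cases hk : k = i
          · subst hk; simp [add_assoc]
          · simp [hk]
        simp only [e]
        exact ⟨hbox _ (by omega) (by omega), hbox _ (by omega) (by omega),
          ⟨fun h' => absurd h' (ih (by omega)), fun h' => absurd h h'⟩⟩
    have hzi := hSb z hz i
    refine hind (m + 1 - z i).toNat (by omega) ?_
    rwa [show z i + ((m + 1 - z i).toNat : ℤ) = m + 1 by omega]

end Contour

section Peierls
variable {d : ℕ}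

/-- The block around `c` is good. -/
def Good (R : ℤ) (c : Zd d) (ω : Config d) : Prop := Cross R c ω ∧ Uniq R c ω

lemma detBy_good {R : ℤ} (hR : 0 ≤ R) (c : Zd d) :
    DetBy (edgesIn (ball c (12 * R))) (Good R c) := by
  have h : ∀ (m : ℤ) (x : Zd d) (F : Set (Zd d)), m ≤ 12 * R →
      DetBy (edgesIn (ball c (12 * R))) fun ω => CT ω (ball c m) x F := fun m x F hm =>
    (detBy_CT _ _ _).mono (edgesIn_mono (ball_mono _ hm))
  rw [detBy_iff]
  rintro ω ω' H ⟨⟨x, hx, h1⟩, h2⟩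
  refine ⟨⟨x, hx, (iff_of_eq (h (11 * R) x _ (by omega) ω ω' H)).1 h1⟩, fun x hx y hy h3 h4 => ?_⟩
  have h3' := (iff_of_eq (h (10 * R) x _ (by omega) ω ω' H)).2 h3
  have h4' := (iff_of_eq (h (10 * R) y _ (by omega) ω ω' H)).2 h4
  exact (iff_of_eq (detBy_conn _ x y ω ω' H)).1 (h2 x hx y hy h3' h4')

lemma good_pull (R : ℤ) (c : Zd d) (ω : Config d) : Good R 0 (pull (tr c) ω) ↔ Good R c ω := by
  have hb : ∀ (m : ℤ) (x : Zd d), tr c x ∈ ball c m ↔ x ∈ ball 0 m := fun m x => by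
    simp [mem_ball, tr_apply]
  refine and_congr ?_ ?_
  · refine Iff.trans ?_ (tr c).surjective.exists.symm
    refine exists_congr fun x => ?_
    rw [hb, CT_pull (isAut_tr c), tr_image_ball, tr_image_sph, zero_add]
  · refine Iff.trans ?_ (tr c).surjective.forall.symm
    refine forall_congr' fun x => ?_
    rw [hb]
    refine imp_congr_right fun _ => ?_
    refine Iff.trans ?_ (tr c).surjective.forall.symm
    refine forall_congr' fun y => ?_
    rw [hb, CT_pull (isAut_tr c), CT_pull (isAut_tr c), conn_pull (isAut_tr c), tr_image_ball,
      tr_image_ball, tr_image_sph, zero_add]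

lemma Pb_not_good (p : I) {R : ℤ} (hR : 0 ≤ R) (c : Zd d) :
    Pb p {ω : Config d | ¬ Good R c ω} = Pb p {ω : Config d | ¬ Good R 0 ω} := by
  refine Eq.trans ?_ (Pb_pull p (tr c)
    (((detBy_good hR 0).not).measurableSet (edgesIn_finite (ball_finite _ _))))
  change _ = Pr _ {ω' : Config d | ¬ Good R 0 (pull _ ω')}
  congr 1
  ext ω
  exact not_congr (good_pull R c ω).symm

/-- One of the two blocks at the ends of `f` is not good. -/
def Bad (R : ℤ) (f : Att d) (ω : Config d) : Prop :=
  ¬ Good R (R • f.1) ω ∨ ¬ Good R (R • (f.1 + ee f.2)) ω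

lemma near_scaled {R : ℤ} (hR : 0 ≤ R) (f : Att d) : R • (f.1 + ee f.2) ∈ ball (R • f.1) R := by
  intro k
  simp only [Pi.smul_apply, Pi.add_apply, smul_eq_mul]
  rw [mul_add, add_sub_cancel_left]
  by_cases h : k = f.2
  · rw [ee_apply, if_pos h, mul_one, abs_of_nonneg hR]
  · rw [ee_apply, if_neg h, mul_zero, abs_zero]; exact hR

lemma detBy_bad {R : ℤ} (hR : 0 ≤ R) (f : Att d) :
    DetBy (edgesIn (ball (R • f.1) (13 * R))) (Bad R f) := by
  have h1 := (detBy_good hR (R • f.1)).mono (edgesIn_mono (ball_mono _ (by omega : 12 * R ≤ 13 * R)))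
  have h2 := (detBy_good hR (R • (f.1 + ee f.2))).mono
    (edgesIn_mono (ball_subset_ball (near_scaled hR f) (by omega : 12 * R + R ≤ 13 * R)))
  rw [detBy_iff]
  rintro ω ω' H (h | h)
  · exact .inl fun h' => h ((iff_of_eq (h1 ω ω' H)).2 h')
  · exact .inr fun h' => h ((iff_of_eq (h2 ω ω' H)).2 h')

lemma Pb_bad_le {p : I} {R : ℤ} (hR : 0 ≤ R) {ε : ℝ}
    (h : Pb p {ω : Config d | ¬ Good R 0 ω} ≤ ε) (f : Att d) : Pb p {ω | Bad R f ω} ≤ 2 * ε := by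
  refine (Pr_union_le _ {ω | ¬ Good R (R • f.1) ω} {ω | ¬ Good R (R • (f.1 + ee f.2)) ω}).trans ?_
  have h1 := (Pb_not_good p hR (R • f.1)).trans_le h
  have h2 := (Pb_not_good p hR (R • (f.1 + ee f.2))).trans_le h
  unfold Pb at h1 h2
  linarith

/-- Residue classes of bonds. -/
def cls (f : Att d) : (Fin d → ZMod 27) × Fin d := (fun i => (f.1 i : ZMod 27), f.2)

lemma ball_disjoint_of_cls {R : ℤ} (hR : 1 ≤ R) {f g : Att d} (h : cls f = cls g) (hfg : f ≠ g) :
    Disjoint (ball (R • f.1) (13 * R)) (ball (R • g.1) (13 * R)) := by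
  obtain ⟨h1, h2⟩ := Prod.ext_iff.1 h
  have h3 : ∃ i, f.1 i ≠ g.1 i := by
    by_contra! h3
    exact hfg (Prod.ext (funext h3) h2)
  obtain ⟨i, hi⟩ := h3
  have h4 : ((27 : ℕ) : ℤ) ∣ g.1 i - f.1 i := (ZMod.intCast_eq_intCast_iff_dvd_sub _ _ 27).1 (congrFun h1 i)
  rw [Set.disjoint_left]
  intro x hx hy
  have hx' : |x i - R * f.1 i| ≤ 13 * R := hx i
  have hy' : |x i - R * g.1 i| ≤ 13 * R := hy i
  rw [abs_le] at hx' hy'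
  obtain ⟨k, hk⟩ := h4
  have hk0 : k ≠ 0 := by rintro rfl; apply hi; omega
  have e : R * g.1 i - R * f.1 i = 27 * (R * k) := by rw [← mul_sub, hk]; push_cast; ring
  rcases lt_or_gt_of_ne hk0 with h | h
  · have : R * k ≤ - R := by nlinarith
    omega
  · have : R ≤ R * k := by nlinarith
    omega

lemma card_cls_univ : (Finset.univ : Finset ((Fin d → ZMod 27) × Fin d)).card = 27 ^ d * d := by
  rw [Finset.card_univ, Fintype.card_prod, Fintype.card_fun, ZMod.card, Fintype.card_fin]

open Classical in
lemma exists_cls (S : Finset (Att d)) (hd : 0 < d) :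
    ∃ S' ⊆ S, S.card ≤ S'.card * (27 ^ d * d) ∧ ∀ f ∈ S', ∀ g ∈ S', cls f = cls g := by
  have hne : (Finset.univ : Finset ((Fin d → ZMod 27) × Fin d)).Nonempty := ⟨(0, ⟨0, hd⟩), by simp⟩
  obtain ⟨κ, -, hκ⟩ := Finset.exists_max_image Finset.univ
    (fun κ => (S.filter fun f => cls f = κ).card) hne
  refine ⟨S.filter fun f => cls f = κ, Finset.filter_subset _ _, ?_, ?_⟩
  · rw [← card_cls_univ]
    exact Finset.card_le_mul_card_image_of_maps_to (f := cls) (fun _ _ => Finset.mem_univ _) _ hκ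
  · intro f hf g hg
    rw [(Finset.mem_filter.1 hf).2, (Finset.mem_filter.1 hg).2]

open Classical in
lemma Pb_half_bad_le {p : I} {R : ℤ} (hR : 1 ≤ R) (hd : 0 < d) {ε θ : ℝ} (hθ0 : 0 ≤ θ) (hθ1 : θ ≤ 1)
    (hε : 2 * ε ≤ θ ^ (2 * (27 ^ d * d))) (h : Pb p {ω : Config d | ¬ Good R 0 ω} ≤ ε)
    (T : Finset (Att d)) :
    Pb p {ω | T.card ≤ 2 * (T.filter fun f => Bad R f ω).card} ≤ (2 * θ) ^ T.card := by
  set 𝒮 := T.powerset.filter fun S => T.card ≤ S.card * (2 * (27 ^ d * d)) ∧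
    ∀ f ∈ S, ∀ g ∈ S, cls f = cls g
  have hsub : {ω | T.card ≤ 2 * (T.filter fun f => Bad R f ω).card} ⊆
      {ω | ∃ S ∈ 𝒮, ∀ f ∈ S, Bad R f ω} := by
    intro ω hω
    obtain ⟨S', h1, h2, h3⟩ := exists_cls (T.filter fun f => Bad R f ω) hd
    have hω' : T.card ≤ 2 * (T.filter fun f => Bad R f ω).card := hω
    refine ⟨S', Finset.mem_filter.2 ⟨Finset.mem_powerset.2 (h1.trans (Finset.filter_subset _ _)),
      ?_, h3⟩, fun f hf => (Finset.mem_filter.1 (h1 hf)).2⟩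
    calc T.card ≤ 2 * (S'.card * (27 ^ d * d)) := hω'.trans (Nat.mul_le_mul_left 2 h2)
      _ = _ := by ring
  refine (Pr_mono _ hsub).trans ((Pr_exists_le _ _ _).trans ?_)
  refine (Finset.sum_le_card_nsmul _ _ (θ ^ T.card) ?_).trans ?_
  · intro S hS
    obtain ⟨hST, hS1, hS2⟩ := Finset.mem_filter.1 hS
    rw [Pr_forall S (fun f => edgesIn (ball (R • f.1) (13 * R))) (fun f => Bad R f)
      (fun f _ => edgesIn_finite (ball_finite _ _)) (fun f _ => detBy_bad (by omega) f)
      (fun f hf g hg hfg => edgesIn_disjoint (ball_disjoint_of_cls hR (hS2 f hf g hg) hfg))]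
    calc ∏ f ∈ S, Pr (fun _ => p) {ω | Bad R f ω} ≤ ∏ _f ∈ S, θ ^ (2 * (27 ^ d * d)) :=
          Finset.prod_le_prod (fun _ _ => Pr_nonneg _ _)
            fun f _ => (Pb_bad_le (by omega) h f).trans hε
      _ = θ ^ (S.card * (2 * (27 ^ d * d))) := by
          rw [Finset.prod_const, ← pow_mul, mul_comm]
      _ ≤ θ ^ T.card := pow_le_pow_of_le_one hθ0 hθ1 hS1
  · rw [nsmul_eq_mul, mul_pow]
    refine mul_le_mul_of_nonneg_right ?_ (by positivity)
    have : 𝒮.card ≤ 2 ^ T.card := (Finset.card_filter_le _ _).trans (Finset.card_powerset T).le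
    exact_mod_cast this

end Peierls

section Contours
variable {d : ℕ}

open Classical in
/-- At least half of the bonds of some large contour in the box of radius `n` are bad. -/
def ManyBad (R : ℤ) (n : ℕ) (ω : Config d) : Prop :=
  ∃ Γ : Finset (Att d), Γ.Nonempty ∧ (∀ f ∈ Γ, f.1 ∈ ball 0 (n + 2)) ∧
    RConn (fun f g => g ∈ nbr f) Γ ∧ n ^ (2 * d + 2) ≤ 2 ^ Γ.card ∧
    Γ.card ≤ 2 * (Γ.filter fun f => Bad R f ω).card

open Classical in
lemma Pb_manyBad_le {p : I} {R : ℤ} (hR : 1 ≤ R) (hd : 0 < d) {ε : ℝ}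
    (hε : 2 * ε ≤ (1 / (4 * ((3 : ℝ) ^ d * d) ^ 2)) ^ (2 * (27 ^ d * d)))
    (h : Pb p {ω : Config d | ¬ Good R 0 ω} ≤ ε) {n : ℕ} (hn : 0 < n) :
    Pb p {ω : Config d | ManyBad R n ω} ≤
      ((2 * n + 5) ^ d * d) * ((2 * n + 5) ^ d * d + 1) * (1 / (n : ℝ) ^ (2 * d + 2)) := by
  set Δ : ℕ := 3 ^ d * d with hΔ
  have hΔ1 : 1 ≤ Δ := Nat.mul_pos (by positivity) hd
  have hΔr : (1 : ℝ) ≤ Δ := by exact_mod_cast hΔ1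
  set θ : ℝ := 1 / (4 * (Δ : ℝ) ^ 2) with hθ
  have hθ0 : 0 ≤ θ := by positivity
  have hθ1 : θ ≤ 1 := by
    rw [hθ, div_le_one (by positivity)]
    nlinarith
  have hθε : 2 * ε ≤ θ ^ (2 * (27 ^ d * d)) := by
    rw [hθ, hΔ]; push_cast; exact hε
  set B : Finset (Att d) := (ball_finite (0 : Zd d) (n + 2)).toFinset ×ˢ Finset.univ
  have hB : B.card = (2 * n + 5) ^ d * d := by
    rw [Finset.card_product, Finset.card_univ, Fintype.card_fin]
    have := card_ball_center (0 : Zd d) (n + 2)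
    push_cast at this
    rw [this]; congr 2
  set J : Finset ℕ := (Finset.range (B.card + 1)).filter fun s => n ^ (2 * d + 2) ≤ 2 ^ s
  have hJ : J.card ≤ B.card + 1 := (Finset.card_filter_le _ _).trans (Finset.card_range _).le
  have hsub : {ω : Config d | ManyBad R n ω} ⊆ {ω | ∃ a ∈ B ×ˢ J, ∃ T : Finset (Att d), a.1 ∈ T ∧
      T.card = a.2 ∧ RConn (fun f g => g ∈ nbr f) T ∧
        T.card ≤ 2 * (T.filter fun f => Bad R f ω).card} := by
    rintro ω ⟨Γ, ⟨v, hv⟩, h1, h2, h3, h4⟩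
    have hΓB : Γ ⊆ B := fun f hf =>
      Finset.mem_product.2 ⟨(Set.Finite.mem_toFinset _).2 (h1 f hf), Finset.mem_univ _⟩
    refine ⟨(v, Γ.card), Finset.mem_product.2 ⟨hΓB hv, Finset.mem_filter.2
      ⟨Finset.mem_range.2 ?_, h3⟩⟩, Γ, hv, rfl, h2, h4⟩
    have := Finset.card_le_card hΓB
    omega
  refine (Pr_mono _ hsub).trans ((Pr_exists_le _ _ _).trans ?_)
  refine (Finset.sum_le_card_nsmul _ _ (1 / (n : ℝ) ^ (2 * d + 2)) ?_).trans ?_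
  · rintro ⟨v, s⟩ ha
    have hs := (Finset.mem_filter.1 (Finset.mem_product.1 ha).2).2
    refine (Pr_exists_animal nbr (fun _ => p) hΔ1 (fun f => (card_nbr f).le)
      (fun a b hab => nbr_comm hab) s (b := (2 * θ) ^ s) (by positivity)
      (fun T ω => T.card ≤ 2 * (T.filter fun f => Bad R f ω).card) ?_ v).trans ?_
    · intro T hT
      rw [← hT]
      exact Pb_half_bad_le hR hd hθ0 hθ1 hθε h T
    · rw [← mul_pow]
      have e : (Δ : ℝ) ^ 2 * (2 * θ) = 1 / 2 := by
        rw [hθ]; field_simp; norm_num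
      rw [e, one_div_pow]
      have hs' : (n : ℝ) ^ (2 * d + 2) ≤ 2 ^ s := by exact_mod_cast hs
      exact one_div_le_one_div_of_le (by positivity) hs'
  · rw [nsmul_eq_mul, Finset.card_product]
    refine mul_le_mul_of_nonneg_right ?_ (by positivity)
    have : B.card * J.card ≤ ((2 * n + 5) ^ d * d) * ((2 * n + 5) ^ d * d + 1) := by
      rw [← hB]; exact Nat.mul_le_mul_left _ hJ
    exact_mod_cast this

/-- At a suitable scale, contours with many bad bonds are eventually absent. -/
lemma ae_eventually_not_manyBad {p : I} (hp : pc d < p) (hd : 0 < d) :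
    ∃ R : ℕ, 1 ≤ R ∧ ∀ᵐ ω ∂(PP d p), ∃ N : ℕ, ∀ n ≥ N, ¬ ManyBad (R : ℤ) n ω := by
  have hd' : (0 : ℝ) < d := by exact_mod_cast hd
  obtain ⟨R, hR, hg⟩ := exists_good hp hd
    (ε := (1 / (4 * ((3 : ℝ) ^ d * d) ^ 2)) ^ (2 * (27 ^ d * d)) / 2) (by positivity)
  refine ⟨R, hR, ?_⟩
  have hb : ∀ n : ℕ, 0 < n → Pb p {ω : Config d | ManyBad (R : ℤ) n ω} ≤
      (7 ^ d * d * (7 ^ d * d + 1)) * (1 / (n : ℝ) ^ 2) := by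
    intro n hn
    refine (Pb_manyBad_le (by omega) hd (by linarith) hg hn).trans ?_
    have hn1 : (1 : ℝ) ≤ n := by exact_mod_cast hn
    have h1 : ((2 * n + 5 : ℝ)) ^ d ≤ 7 ^ d * (n : ℝ) ^ d := by
      rw [← mul_pow]
      exact pow_le_pow_left₀ (by positivity) (by linarith) d
    have hnd : (1 : ℝ) ≤ (n : ℝ) ^ d := one_le_pow₀ hn1
    have h2 : ((2 * n + 5 : ℝ)) ^ d * d ≤ (7 ^ d * d) * (n : ℝ) ^ d := by
      calc _ ≤ (7 ^ d * (n : ℝ) ^ d) * d := mul_le_mul_of_nonneg_right h1 hd'.le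
        _ = _ := by ring
    have h3 : ((2 * n + 5 : ℝ)) ^ d * d + 1 ≤ (7 ^ d * d + 1) * (n : ℝ) ^ d := by
      rw [add_mul, one_mul]; linarith
    calc _ ≤ ((7 ^ d * d) * (n : ℝ) ^ d) * ((7 ^ d * d + 1) * (n : ℝ) ^ d) * (1 / (n : ℝ) ^ (2 * d + 2)) :=
          mul_le_mul_of_nonneg_right (mul_le_mul h2 h3 (by positivity) (by positivity)) (by positivity)
      _ = _ := by field_simp; ring
  have hsum : ∑' n : ℕ, PP d p {ω : Config d | ManyBad (R : ℤ) n ω} ≠ ∞ := by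
    have hs : Summable fun n : ℕ => (7 ^ d * d * (7 ^ d * d + 1)) * (1 / (n : ℝ) ^ 2) +
        (if n = 0 then 1 else 0 : ℝ) :=
      ((Real.summable_one_div_nat_pow.2 one_lt_two).mul_left _).add
        (summable_of_ne_finset_zero (s := {0}) fun n hn => by
          rw [if_neg]; simpa using hn)
    refine ne_top_of_le_ne_top hs.tsum_ofReal_ne_top (ENNReal.tsum_le_tsum fun n => ?_)
    rw [← ofReal_measureReal]
    refine ENNReal.ofReal_le_ofReal ?_
    rcases Nat.eq_zero_or_pos n with rfl | hn
    · rw [if_pos rfl]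
      refine measureReal_le_one.trans ?_
      have : (0 : ℝ) ≤ 7 ^ d * d * (7 ^ d * d + 1) * (1 / ((0 : ℕ) : ℝ) ^ 2) := by positivity
      linarith
    · rw [if_neg (by omega), add_zero]
      exact hb n hn
  have h0 := measure_setOfPred_frequently_eq_zero hsum
  rw [ae_iff]
  refine measure_mono_null (fun ω hω => ?_) h0
  have hω' : ¬ ∃ N : ℕ, ∀ n ≥ N, ¬ ManyBad (R : ℤ) n ω := hω
  change ∃ᶠ n in Filter.atTop, ManyBad (R : ℤ) n ω
  rwa [Filter.Frequently, Filter.eventually_atTop]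

end Contours

section Boundary
variable {d : ℕ}

lemma bdry_finite (ω : Config d) {A : Set (Zd d)} (hA : A.Finite) : (bdry ω A).Finite := by
  obtain ⟨n, hn⟩ := exists_subset_ball hA
  refine (hA.prod (ball_finite 0 (n + 1))).subset ?_
  rintro ⟨x, y⟩ ⟨h1, h2, -⟩
  refine ⟨h2, ?_⟩
  have hyx : y ∈ ball x 1 := fun i => by
    have := h1.1.abs_le i
    rwa [abs_sub_comm] at this
  exact ball_subset_ball (hn h2) (by omega) hyx

lemma bdry_nonempty {ω : Config d} (hω : (cluster ω).Infinite) {A : Set (Zd d)} (hA : A.Finite)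
    (hne : A.Nonempty) (hAC : A ⊆ cluster ω) : (bdry ω A).Nonempty := by
  obtain ⟨x, hx⟩ := hne
  obtain ⟨y, hy, hyA⟩ := hω.exists_notMem_finite hA
  have hx' := hAC hx
  rw [cluster_eq] at hx' hy
  obtain ⟨u, v, h1, h2, -, h4⟩ := ((Conn.symm hx').trans hy).exit hx hyA
  exact ⟨(u, v), h2, h1.right.2, h4⟩

/-- A set with small boundary contains a connected set with small boundary. -/
lemma exists_connected_subset (ω : Config d) {k : ℝ} {A : Set (Zd d)} (hA : A.Finite)
    (hne : A.Nonempty) (h : k * (bdry ω A).ncard ≤ A.ncard) :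
    ∃ A' ⊆ A, A'.Nonempty ∧ (∀ x ∈ A', ∀ y ∈ A', Conn ω A' x y) ∧
      k * (bdry ω A').ncard ≤ A'.ncard := by
  induction hn : A.ncard using Nat.strong_induction_on generalizing A with
  | _ n ih =>
    obtain ⟨x, hx⟩ := hne
    set K : Set (Zd d) := {y | Conn ω A x y} with hK
    have hKA : K ⊆ A := fun y hy => hy.right
    have hxK : x ∈ K := .refl hx
    have hKc : ∀ y ∈ K, Conn ω K x y := fun y hy =>
      hy.induct (P := fun y => Conn ω K x y) (.refl hxK) fun a b ha hab hb h' =>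
        h'.trans (.of_adj hab ha (ha.trans (.of_adj hab ha.right hb)))
    by_cases hk : k * (bdry ω K).ncard ≤ K.ncard
    · exact ⟨K, hKA, ⟨x, hxK⟩, fun y hy z hz => (hKc y hy).symm.trans (hKc z hz), hk⟩
    push Not at hk
    have hKf := hA.subset hKA
    have hDf : (A \ K).Finite := hA.subset Set.sdiff_subset
    have hb : (bdry ω K).ncard + (bdry ω (A \ K)).ncard ≤ (bdry ω A).ncard := by
      rw [← Set.ncard_union_eq ?_ (bdry_finite ω hKf) (bdry_finite ω hDf)]
      · refine Set.ncard_le_ncard ?_ (bdry_finite ω hA)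
        rintro ⟨u, v⟩ (⟨h1, h2, h3⟩ | ⟨h1, h2, h3⟩)
        · exact ⟨h1, hKA h2, fun hv => h3 (Conn.trans h2 (.of_adj h1 (hKA h2) hv))⟩
        · refine ⟨h1, h2.1, fun hv => h3 ⟨hv, fun hv' => h2.2 ?_⟩⟩
          exact Conn.trans hv' (.of_adj (openAdj_comm.1 h1) hv h2.1)
      · rw [Set.disjoint_left]
        rintro e h1 h2
        exact h2.2.1.2 h1.2.1
    have hc : K.ncard + (A \ K).ncard = A.ncard := by
      rw [add_comm]; exact Set.ncard_sdiff_add_ncard_of_subset hKA hA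
    have hKpos : 0 < K.ncard := (Set.ncard_pos hKf).2 ⟨x, hxK⟩
    have hk0 : 0 ≤ k := by
      by_contra hk0
      push Not at hk0
      have h1 : k * (bdry ω K).ncard ≤ 0 := mul_nonpos_of_nonpos_of_nonneg hk0.le (by positivity)
      have h2 : (0 : ℝ) < K.ncard := by exact_mod_cast hKpos
      linarith
    have hb' : ((bdry ω K).ncard : ℝ) + (bdry ω (A \ K)).ncard ≤ (bdry ω A).ncard := by exact_mod_cast hb
    have hc' : (K.ncard : ℝ) + (A \ K).ncard = A.ncard := by exact_mod_cast hc
    have hkD : k * (bdry ω (A \ K)).ncard < (A \ K).ncard := by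
      have := mul_le_mul_of_nonneg_left hb' hk0
      rw [mul_add] at this
      linarith
    have hDne : (A \ K).Nonempty := by
      rw [← Set.ncard_pos hDf]
      have : (0 : ℝ) < (A \ K).ncard := lt_of_le_of_lt (by positivity) hkD
      exact_mod_cast this
    obtain ⟨A', h1, h2⟩ := ih (A \ K).ncard (by omega) hDf hDne hkD.le rfl
    exact ⟨A', h1.trans Set.sdiff_subset, h2⟩

lemma exists_far_of_card {A : Set (Zd d)} {R : ℕ} (h : (2 * R + 1) ^ d < A.ncard) (c : Zd d) :
    ∃ x ∈ A, x ∈ far c R := by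
  by_contra! hno
  have hsub : A ⊆ ball c R := fun x hx => by
    by_contra hb
    exact hno x hx (far_anti c (by omega) (not_mem_ball.1 hb))
  have h1 := Set.ncard_le_ncard hsub (ball_finite c R)
  rw [Set.ncard_eq_toFinset_card _ (ball_finite c R), card_ball_center] at h1
  omega

lemma mem_ball_blk_of_mem {R : ℤ} (hR : 1 ≤ R) {x z : Zd d} {m : ℤ} (h : x ∈ ball (R • z) (m * R)) :
    z ∈ ball (blk R x) m := by
  intro i
  have h1 := mem_ball_blk hR x (i := i)
  have h2 := h i
  simp only [Pi.smul_apply, smul_eq_mul] at h1 h2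
  rw [abs_le] at h2 ⊢
  constructor
  · by_contra hlt
    have : z i + m + 1 ≤ blk R x i := by omega
    nlinarith
  · by_contra hlt
    have : blk R x i + m + 1 ≤ z i := by omega
    nlinarith

/-- The isoperimetric inequality for large connected sets in a good environment. -/
lemma isoperimetric (hd : 2 ≤ d) {ω : Config d} {R n : ℕ} (hR : 1 ≤ R)
    (hω : ¬ ManyBad (R : ℤ) n ω) {A : Set (Zd d)} (hAn : A ⊆ ball 0 n)
    (hA : ∀ x ∈ A, ∀ y ∈ A, Conn ω A x y) (hbig : (2 * (10 * R) + 1) ^ d < A.ncard)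
    (hlog : ∀ g : ℕ, A.ncard ≤ g ^ d * (2 * R + 1) ^ d → n ^ (2 * d + 2) ≤ 2 ^ g) :
    A.ncard ^ (d - 1) ≤
      ((bdry ω A).ncard * (2 * (27 ^ d * d) * (2 * R + 1) ^ (d - 1))) ^ d := by
  classical
  have hR' : (1 : ℤ) ≤ R := by exact_mod_cast hR
  have hAf : A.Finite := (ball_finite _ _).subset hAn
  have hfar : ∀ c : Zd d, ∃ x ∈ A, x ∈ far c (10 * (R : ℤ)) := fun c => by
    have := exists_far_of_card (R := 10 * R) hbig c
    push_cast at this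
    exact this
  have hSb := coarse_subset_ball hR' hAn
  have hSf : (coarse (R : ℤ) A).Finite := (ball_finite _ _).subset hSb
  have hSne : (coarse (R : ℤ) A).Nonempty := by
    obtain ⟨x, hx, -⟩ := hfar 0
    exact ⟨_, blk_mem_coarse hR' hx⟩
  obtain ⟨Γ, hΓc, hΓS, hΓl⟩ := exists_contour (by omega) hSb hSne (coarse_conn hR' hA)
  have hLW : (coarse (R : ℤ) A).ncard ^ (d - 1) ≤ Γ.card ^ d := by
    rw [Set.ncard_eq_toFinset_card _ hSf]
    exact card_pow_le_of_projection hd _ _ fun z hz => hΓl z ((Set.Finite.mem_toFinset _).1 hz)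
  have hcard := card_le_coarse hR hAf
  have hΓne : Γ.Nonempty := by
    obtain ⟨z, hz⟩ := hSne
    obtain ⟨t, ht⟩ := hΓl z hz ⟨0, by omega⟩
    exact ⟨_, ht⟩
  have hAΓ : A.ncard ≤ Γ.card ^ d * (2 * R + 1) ^ d := by
    refine hcard.trans (Nat.mul_le_mul_right _ (le_trans ?_ hLW))
    exact Nat.le_self_pow (by omega) _
  have hhalf : Γ.card ≤ 2 * (Γ.filter fun f => ¬ Bad R f ω).card := by
    have h1 : 2 * (Γ.filter fun f => Bad R f ω).card < Γ.card := by
      by_contra hle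
      refine hω ⟨Γ, hΓne, fun f hf => ?_, hΓc, hlog _ hAΓ, by omega⟩
      rcases hΓS f hf with ⟨h1, -⟩ | ⟨-, h1⟩
      · exact ball_mono _ (by omega) (hSb h1)
      · refine ball_subset_ball (hSb h1) (by omega : (1 : ℤ) + (n + 1) ≤ n + 2) (fun i => ?_)
        have := (latAdj_add f.1 f.2).abs_le i
        exact this
    have h2 := Finset.card_filter_add_card_filter_not (s := Γ) (fun f => Bad (R : ℤ) f ω)
    omega
  have hedge : ∀ f ∈ Γ.filter fun f => ¬ Bad (R : ℤ) f ω,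
      ∃ e ∈ bdry ω A, e.1 ∈ ball ((R : ℤ) • f.1) (13 * R) := by
    intro f hf
    obtain ⟨hfΓ, hfb⟩ := Finset.mem_filter.1 hf
    obtain ⟨g1, g2⟩ : Good R ((R : ℤ) • f.1) ω ∧ Good R ((R : ℤ) • (f.1 + ee f.2)) ω := by
      simpa [Bad] using hfb
    rcases hΓS f hfΓ with ⟨h1, h2⟩ | ⟨h1, h2⟩
    · obtain ⟨e, he, he'⟩ := exists_bdry_near hR' hA hfar h1 h2 (latAdj_add _ _) g2.1 g1.2
      exact ⟨e, he, ball_mono _ (by omega) he'⟩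
    · obtain ⟨e, he, he'⟩ := exists_bdry_near hR' hA hfar h2 h1
        (latAdj_comm.1 (latAdj_add _ _)) g1.1 g2.2
      exact ⟨e, he, ball_subset_ball (near_scaled (by omega) f) (by omega) he'⟩
  choose! F hF1 hF2 using hedge
  have hbf := bdry_finite ω hAf
  have hgood : (Γ.filter fun f => ¬ Bad R f ω).card ≤ (27 ^ d * d) * (bdry ω A).ncard := by
    rw [Set.ncard_eq_toFinset_card _ hbf]
    refine Finset.card_le_mul_card_image_of_maps_to (f := F)
      (fun f hf => (Set.Finite.mem_toFinset _).2 (hF1 f hf)) _ fun e _ => ?_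
    have h27 : 27 ^ d * d = ((ball_finite (blk (R : ℤ) e.1) 13).toFinset ×ˢ
        (Finset.univ : Finset (Fin d))).card := by
      rw [Finset.card_product, Finset.card_univ, Fintype.card_fin]
      have := card_ball_center (blk (R : ℤ) e.1) 13
      push_cast at this
      rw [this]
    rw [h27]
    refine Finset.card_le_card fun f hf => ?_
    obtain ⟨h1, h2⟩ := Finset.mem_filter.1 hf
    refine Finset.mem_product.2 ⟨(Set.Finite.mem_toFinset _).2 ?_, Finset.mem_univ _⟩
    rw [← h2]
    exact mem_ball_blk_of_mem hR' (hF2 f h1)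
  have hΓb : Γ.card ≤ (bdry ω A).ncard * (2 * (27 ^ d * d)) := by
    calc Γ.card ≤ 2 * ((27 ^ d * d) * (bdry ω A).ncard) := hhalf.trans (Nat.mul_le_mul_left 2 hgood)
      _ = _ := by ring
  calc A.ncard ^ (d - 1) ≤ ((coarse (R : ℤ) A).ncard * (2 * R + 1) ^ d) ^ (d - 1) :=
        Nat.pow_le_pow_left hcard _
    _ = (coarse (R : ℤ) A).ncard ^ (d - 1) * ((2 * R + 1) ^ (d - 1)) ^ d := by
        rw [mul_pow, ← pow_mul, ← pow_mul, mul_comm d]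
    _ ≤ ((bdry ω A).ncard * (2 * (27 ^ d * d))) ^ d * ((2 * R + 1) ^ (d - 1)) ^ d :=
        Nat.mul_le_mul_right _ (hLW.trans (Nat.pow_le_pow_left hΓb _))
    _ = _ := by rw [← mul_pow]; congr 1; ring

lemma eventually_pow_le_two_pow {γ c : ℝ} (hγ : 0 < γ) (hc : 0 < c) (hd : 0 < d) :
    ∀ᶠ n : ℕ in Filter.atTop, ∀ g : ℕ, c * (n : ℝ) ^ γ ≤ (g : ℝ) ^ d → n ^ (2 * d + 2) ≤ 2 ^ g := by
  have hd' : (0 : ℝ) < d := by exact_mod_cast hd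
  have hl2 : 0 < Real.log 2 := Real.log_pos one_lt_two
  set δ : ℝ := Real.log 2 * c ^ (1 / d : ℝ) / (2 * d + 2) with hδ
  have hδ0 : 0 < δ := by positivity
  have h1 := (isLittleO_log_rpow_atTop (div_pos hγ hd')).bound hδ0
  have h2 := (tendsto_natCast_atTop_atTop (R := ℝ)).eventually h1
  filter_upwards [h2, Filter.eventually_ge_atTop 1] with n hn hn1 g hg
  have hn0 : (0 : ℝ) < n := by exact_mod_cast hn1
  have hlog : Real.log n ≤ δ * (n : ℝ) ^ (γ / d) := by
    refine (le_abs_self _).trans (hn.trans (le_of_eq ?_))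
    rw [Real.norm_of_nonneg (by positivity)]
  have hroot : c ^ (1 / d : ℝ) * (n : ℝ) ^ (γ / d) ≤ g := by
    refine le_of_pow_le_pow_left₀ hd.ne' (by positivity) (le_trans (le_of_eq ?_) hg)
    rw [mul_pow, ← Real.rpow_natCast, ← Real.rpow_natCast, ← Real.rpow_mul hc.le, ← Real.rpow_mul hn0.le]
    rw [one_div_mul_cancel hd'.ne', div_mul_cancel₀ _ hd'.ne', Real.rpow_one]
  have key : (2 * d + 2) * Real.log n ≤ g * Real.log 2 := by
    calc (2 * d + 2) * Real.log n ≤ (2 * d + 2) * (δ * (n : ℝ) ^ (γ / d)) :=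
          mul_le_mul_of_nonneg_left hlog (by positivity)
      _ = (c ^ (1 / d : ℝ) * (n : ℝ) ^ (γ / d)) * Real.log 2 := by rw [hδ]; field_simp
      _ ≤ _ := mul_le_mul_of_nonneg_right hroot hl2.le
  have h3 : ((n : ℝ)) ^ (2 * d + 2) ≤ 2 ^ g := by
    rw [← Real.log_le_log_iff (by positivity) (by positivity), Real.log_pow, Real.log_pow]
    push_cast; exact key
  exact_mod_cast h3

end Boundary

section Folner
variable {d : ℕ}

lemma clusterN_subset (ω : Config d) (n : ℕ) : clusterN ω n ⊆ cluster ω ∩ ball 0 n := by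
  intro y hy
  constructor
  · change Relation.ReflTransGen (openAdj ω) 0 y
    induction hy with
    | refl => exact .refl
    | tail _ h ih => exact ih.tail h.1
  have hb : box d n = ball 0 n := by ext x; simp [box, mem_ball]
  rw [← hb]
  induction hy with
  | refl => simp [box]
  | tail _ h _ => exact h.2.2

lemma le_FolC {ω : Config d} {n : ℕ} {k r : ℝ} (hk : 0 < k)
    (h : ∀ A ⊆ clusterN ω n, A.Nonempty → k * (bdry ω A).ncard ≤ A.ncard → r ≤ A.ncard) :
    ENNReal.ofReal r ≤ FolC ω n k := by
  refine le_sInf ?_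
  rintro m ⟨A, hA, hne, hb, rfl⟩
  have hAf : A.Finite := (ball_finite 0 n).subset (hA.trans ((clusterN_subset ω n).trans Set.inter_subset_right))
  have hpos : (0 : ℝ) < A.ncard := by exact_mod_cast (Set.ncard_pos hAf).2 hne
  rw [div_le_div_iff₀ hpos hk, one_mul] at hb
  refine (ENNReal.ofReal_le_ofReal (h A hA hne (by linarith))).trans ?_
  rw [ENNReal.ofReal_natCast]

lemma le_card_of_infinite {ω : Config d} (hω : (cluster ω).Infinite) {A : Set (Zd d)}
    (hA : A.Finite) (hne : A.Nonempty) (hAC : A ⊆ cluster ω) {k : ℝ} (hk : 0 ≤ k)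
    (h : k * (bdry ω A).ncard ≤ A.ncard) : k ≤ A.ncard := by
  have h1 : (1 : ℝ) ≤ (bdry ω A).ncard := by
    exact_mod_cast (Set.ncard_pos (bdry_finite ω hA)).2 (bdry_nonempty hω hA hne hAC)
  nlinarith

/-- The lower bounds on the Følner function in a good environment. -/
lemma folner_bounds (hd : 2 ≤ d) {γ c : ℝ} (hγ : 0 < γ) (hc : 0 < c) {R : ℕ} (hR : 1 ≤ R)
    {ω : Config d} (hω : ∃ N : ℕ, ∀ n ≥ N, ¬ ManyBad (R : ℤ) n ω) (hinf : (cluster ω).Infinite) :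
    ∃ N : ℕ, ∀ n ≥ N, ∀ k : ℝ, 1 ≤ k →
      (k < c * (n : ℝ) ^ γ → ENNReal.ofReal k ≤ FolC ω n k) ∧
        (c * (n : ℝ) ^ γ ≤ k → ENNReal.ofReal
          (((1 / (2 * (27 ^ d * d) * (2 * R + 1) ^ (d - 1) : ℝ)) * k) ^ d) ≤ FolC ω n k) := by
  have hd0 : 0 < d := by omega
  have hd' : (0 : ℝ) < d := by exact_mod_cast hd0
  set M : ℝ := 2 * (27 ^ d * d) * (2 * R + 1) ^ (d - 1) with hM
  have hM0 : 0 < M := by positivity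
  obtain ⟨N, hN⟩ := hω
  have hlim : Filter.Tendsto (fun n : ℕ => c * (n : ℝ) ^ γ) Filter.atTop Filter.atTop :=
    ((tendsto_rpow_atTop hγ).comp tendsto_natCast_atTop_atTop).const_mul_atTop hc
  have hev := ((eventually_pow_le_two_pow hγ (div_pos hc (show (0 : ℝ) < (2 * R + 1) ^ d by positivity))
    hd0).and (hlim.eventually_gt_atTop ((2 * (10 * R) + 1) ^ d))).and (Filter.eventually_ge_atTop N)
  obtain ⟨N', hN'⟩ := Filter.eventually_atTop.1 hev
  refine ⟨N', fun n hn k hk => ?_⟩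
  obtain ⟨⟨hlog, hlarge⟩, hnN⟩ := hN' n hn
  have hsub := clusterN_subset ω n
  have hfin : ∀ A ⊆ clusterN ω n, A.Finite := fun A hA =>
    (ball_finite 0 n).subset (hA.trans (hsub.trans Set.inter_subset_right))
  refine ⟨fun _ => le_FolC (by linarith) fun A hA hne h => le_card_of_infinite hinf (hfin A hA) hne
    (hA.trans (hsub.trans Set.inter_subset_left)) (by linarith) h, fun hck => ?_⟩
  refine le_FolC (by linarith) fun A hA hne h => ?_
  obtain ⟨A', hA'A, hne', hconn, h'⟩ := exists_connected_subset ω (hfin A hA) hne h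
  have hA' := hA'A.trans hA
  have hkA := le_card_of_infinite hinf (hfin A' hA') hne' (hA'.trans (hsub.trans Set.inter_subset_left))
    (by linarith) h'
  have hiso := isoperimetric hd hR (hN n hnN) (hA'.trans (hsub.trans Set.inter_subset_right)) hconn
    (by
      have : ((2 * (10 * R) + 1 : ℝ)) ^ d < A'.ncard := by linarith
      exact_mod_cast this)
    (fun g hg => hlog g (by
      have hg' : (A'.ncard : ℝ) ≤ (g : ℝ) ^ d * (2 * R + 1) ^ d := by exact_mod_cast hg
      rw [div_mul_eq_mul_div, div_le_iff₀ (by positivity)]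
      linarith))
  have hiso' : (A'.ncard : ℝ) ^ (d - 1) ≤ ((bdry ω A').ncard * M) ^ d := by
    rw [hM]; exact_mod_cast hiso
  have ha : (0 : ℝ) < A'.ncard := by linarith
  have hle : (A'.ncard : ℝ) ≤ A.ncard := by exact_mod_cast Set.ncard_le_ncard hA'A (hfin A hA)
  refine le_trans ?_ hle
  rw [one_div_mul_eq_div, div_pow, div_le_iff₀ (by positivity)]
  refine le_of_mul_le_mul_right ?_ (pow_pos ha (d - 1))
  calc k ^ d * (A'.ncard : ℝ) ^ (d - 1) ≤ k ^ d * ((bdry ω A').ncard * M) ^ d :=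
        mul_le_mul_of_nonneg_left hiso' (by positivity)
    _ = (k * (bdry ω A').ncard) ^ d * M ^ d := by rw [← mul_pow, ← mul_pow]; ring
    _ ≤ (A'.ncard : ℝ) ^ d * M ^ d :=
        mul_le_mul_of_nonneg_right (pow_le_pow_left₀ (by positivity) h' d) (by positivity)
    _ = (A'.ncard : ℝ) * M ^ d * (A'.ncard : ℝ) ^ (d - 1) := by
        obtain ⟨e, rfl⟩ : ∃ e, d = e + 1 := ⟨d - 1, by omega⟩
        rw [Nat.add_sub_cancel, pow_succ (A'.ncard : ℝ)]; ring

end Folner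

/-- lower bound on the Følner function of `C_n^g` relative to `C^g`. -/
theorem stmt9 (d : ℕ) (hd : 2 ≤ d) (γ : ℝ) (hγ : 0 < γ)
    (p : ℝ) (hp : pc d < p) (hp1 : p ≤ 1) :
    ∃ β > (0 : ℝ), ∀ c > (0 : ℝ),
      ∀ Q : Measure (Config d), IsBernoulli p Q →
        ∀ᵐ ω ∂Q, (cluster ω).Infinite →
          ∃ N : ℕ, ∀ n ≥ N, ∀ k : ℝ, 1 ≤ k →
            (k < c * (n : ℝ) ^ γ → ENNReal.ofReal k ≤ FolC ω n k) ∧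
              (c * (n : ℝ) ^ γ ≤ k → ENNReal.ofReal ((β * k) ^ d) ≤ FolC ω n k) := by
  have hd' : (0 : ℝ) < d := by exact_mod_cast (by omega : 0 < d)
  lift p to I using ⟨(pc_nonneg d).trans hp.le, hp1⟩
  obtain ⟨R, hR, hae⟩ := ae_eventually_not_manyBad hp (by omega)
  refine ⟨1 / (2 * (27 ^ d * d) * (2 * R + 1) ^ (d - 1) : ℝ), by positivity, fun c hc Q hQ => ?_⟩
  rw [isBernoulli_eq hQ]
  filter_upwards [hae] with ω hω hinf
  exact folner_bounds hd hγ hc hR hω hinf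

end Perco
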